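/- Let k ≥ 10 and let M be the real matrix whose rows and columns are indexed by the perfect matchings of K_{2k}, defined by: M(P,Q) = 1/(4·(2k−6)!!) if P and Q have no edge in common and the graph on {1,…,2k} with edge set P ∪ Q is connected; M(P,Q) = 1/(2k−6)!! if P and Q have exactly one edge in common and the graph with edge set P ∪ Q has exactly two connected components; M(P,Q) = 1/(2k−6)!! if P and Q have no edge in common and the graph with edge set P ∪ Q has exactly two connected components, one of which has exactly 4 vertices; and M(P,Q) = 0 otherwise. Then every row of M sums to (2k−1)(2k−3) − 1 and the least eigenvalue of M equals −1. -/

import Mathlib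

/-- A perfect matching of the complete graph on `Fin n`: a finite set of non-loop edges such
that every vertex lies on exactly one of them. -/
def IsPM {n : ℕ} (P : Finset (Sym2 (Fin n))) : Prop :=
  (∀ e ∈ P, ¬ e.IsDiag) ∧ ∀ v : Fin n, ∃! e, e ∈ P ∧ v ∈ e

instance {n : ℕ} : DecidablePred (IsPM (n := n)) := fun _ => by
  unfold IsPM ExistsUnique; infer_instance

/-- The type of perfect matchings of the complete graph `K_n` on `Fin n`. -/
abbrev PM (n : ℕ) := {P : Finset (Sym2 (Fin n)) // IsPM P}

/-- The graph on `Fin n` whose edge set is the union of the two matchings `P` and `Q`. -/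
def unionGraph {n : ℕ} (P Q : PM n) : SimpleGraph (Fin n) :=
  SimpleGraph.fromEdgeSet (↑(P.1 ∪ Q.1) : Set (Sym2 (Fin n)))

open Equiv in
/-- The transposition of the points `i` and `j` acting through `ρ`. -/
def transp {V : Type*} [AddCommGroup V] [Module ℝ V] {N : ℕ} [NeZero N]
    (ρ : Perm (Fin N) →* Module.End ℝ V) (i j : ℕ) : Module.End ℝ V :=
  ρ (swap (Fin.ofNat N i) (Fin.ofNat N j))

/-- The Jucys–Murphy element of index `m` acting through `ρ`. -/
def jm {V : Type*} [AddCommGroup V] [Module ℝ V] {N : ℕ} [NeZero N]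
    (ρ : Equiv.Perm (Fin N) →* Module.End ℝ V) (m : ℕ) : Module.End ℝ V :=
  ∑ i ∈ Finset.range m, transp ρ i m

/-- The content vector `c` is realised by a nonzero joint eigenvector of the Jucys–Murphy
elements. -/
def IsJMSpec {V : Type*} [AddCommGroup V] [Module ℝ V] {N : ℕ} [NeZero N]
    (ρ : Equiv.Perm (Fin N) →* Module.End ℝ V) (c : ℕ → ℝ) : Prop :=
  ∃ w : V, w ≠ 0 ∧ ∀ i < N, jm ρ i w = c i • w

section JucysMurphy

variable {V : Type*} [AddCommGroup V] [Module ℝ V] {N : ℕ} [NeZero N]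
  (ρ : Equiv.Perm (Fin N) →* Module.End ℝ V)

theorem ofNat_inj_of_lt {a b : ℕ} (ha : a < N) (hb : b < N) :
    Fin.ofNat N a = Fin.ofNat N b ↔ a = b := by
  simp [Fin.ext_iff, Fin.ofNat, Nat.mod_eq_of_lt ha, Nat.mod_eq_of_lt hb]

theorem swap_ofNat {a b i : ℕ} (ha : a < N) (hb : b < N) (hi : i < N) :
    Equiv.swap (Fin.ofNat N a) (Fin.ofNat N b) (Fin.ofNat N i) =
      Fin.ofNat N (Equiv.swap a b i) := by
  simp only [Equiv.swap_apply_def, ofNat_inj_of_lt hi ha, ofNat_inj_of_lt hi hb]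
  split_ifs <;> rfl

theorem transp_comm (i j : ℕ) : transp ρ i j = transp ρ j i := by
  rw [transp, transp, Equiv.swap_comm]

theorem transp_mul_self (i j : ℕ) : transp ρ i j * transp ρ i j = 1 := by
  simp [transp, ← map_mul]

theorem transp_mul_transp {a b i j : ℕ} (ha : a < N) (hb : b < N) (hi : i < N) (hj : j < N) :
    transp ρ a b * transp ρ i j =
      transp ρ (Equiv.swap a b i) (Equiv.swap a b j) * transp ρ a b := by
  rw [transp, transp, ← map_mul, Equiv.mul_swap_eq_swap_mul, map_mul, swap_ofNat ha hb hi,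
    swap_ofNat ha hb hj]
  rfl

theorem swap_nat_lt {a b m i : ℕ} (ha : a < m) (hb : b < m) (hi : i < m) :
    Equiv.swap a b i < m := by
  rw [Equiv.swap_apply_def]; split_ifs <;> assumption

theorem transp_mul_jm {a b m : ℕ} (ha : a < m) (hb : b < m) (hm : m < N) :
    transp ρ a b * jm ρ m = jm ρ m * transp ρ a b := by
  rw [jm, Finset.mul_sum, Finset.sum_mul]
  refine Finset.sum_bij' (fun i _ => Equiv.swap a b i) (fun i _ => Equiv.swap a b i) ?_ ?_ ?_ ?_ ?_
  · intro i hi; simpa using swap_nat_lt ha hb (by simpa using hi)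
  · intro i hi; simpa using swap_nat_lt ha hb (by simpa using hi)
  · simp
  · simp
  · intro i hi
    have hi : i < m := by simpa using hi
    rw [transp_mul_transp ρ (by lia) (by lia) (by lia) hm,
      Equiv.swap_apply_of_ne_of_ne (a := a) (b := b) (x := m) (by lia) (by lia)]

theorem transp_mul_jm_of_gt {a b m : ℕ} (ha : m < a) (hb : m < b) (haN : a < N) (hbN : b < N) :
    transp ρ a b * jm ρ m = jm ρ m * transp ρ a b := by
  rw [jm, Finset.mul_sum, Finset.sum_mul]
  refine Finset.sum_congr rfl fun i hi => ?_
  have hi : i < m := by simpa using hi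
  rw [transp_mul_transp ρ haN hbN (by lia) (by lia),
    Equiv.swap_apply_of_ne_of_ne (by lia) (by lia), Equiv.swap_apply_of_ne_of_ne (by lia) (by lia)]

theorem jm_commute {l m : ℕ} (hl : l < N) (hm : m < N) : Commute (jm ρ l) (jm ρ m) := by
  wlog h : l ≤ m generalizing l m
  · exact (this hm hl (by lia)).symm
  rcases h.eq_or_lt with rfl | h
  · exact Commute.refl _
  · rw [jm]
    refine Commute.sum_left _ _ _ fun i hi => ?_
    exact transp_mul_jm ρ (by have := Finset.mem_range.1 hi; lia) h hm

theorem jm_succ (i : ℕ) (hi : i + 1 < N) :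
    jm ρ (i + 1) = transp ρ i (i + 1) * jm ρ i * transp ρ i (i + 1) + transp ρ i (i + 1) := by
  rw [jm, Finset.sum_range_succ, jm, Finset.mul_sum, Finset.sum_mul]
  congr 1
  refine Finset.sum_congr rfl fun j hj => ?_
  have hj : j < i := by simpa using hj
  rw [transp_mul_transp ρ (by lia) hi (by lia) (by lia), mul_assoc, transp_mul_self, mul_one,
    Equiv.swap_apply_left, Equiv.swap_apply_of_ne_of_ne (by lia) (by lia)]

theorem transp_mul_jm_self (i : ℕ) (hi : i + 1 < N) :
    transp ρ i (i + 1) * jm ρ i = jm ρ (i + 1) * transp ρ i (i + 1) - 1 := by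
  rw [jm_succ ρ i hi, add_mul, mul_assoc _ (transp ρ i (i + 1)), transp_mul_self]
  simp

theorem transp_mul_jm_succ (i : ℕ) (hi : i + 1 < N) :
    transp ρ i (i + 1) * jm ρ (i + 1) = jm ρ i * transp ρ i (i + 1) + 1 := by
  rw [jm_succ ρ i hi, mul_add, ← mul_assoc, ← mul_assoc, transp_mul_self]
  simp

theorem transp_mul_jm_of_ne {i m : ℕ} (hi : i + 1 < N) (hm : m < N) (h1 : m ≠ i)
    (h2 : m ≠ i + 1) : transp ρ i (i + 1) * jm ρ m = jm ρ m * transp ρ i (i + 1) := by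
  rcases lt_or_gt_of_ne h1 with h | h
  · exact transp_mul_jm_of_gt ρ h (by lia) (by lia) hi
  · exact transp_mul_jm ρ h (by lia) hm

/-- The product of all `z - jm i` is central. -/
theorem prod_sub_jm_central (z : ℝ) (g : Equiv.Perm (Fin N)) (P : Module.End ℝ V)
    (hP : P = ((List.range N).map fun i => algebraMap ℝ (Module.End ℝ V) z - jm ρ i).prod) :
    Commute (ρ g) P := by
  have key : ∀ i, i + 1 < N → Commute (transp ρ i (i + 1)) P := by
    intro i hi
    obtain ⟨r, hr⟩ : ∃ r, N = i + 2 + r := ⟨N - (i + 2), by lia⟩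
    have hsplit : List.range N =
        List.range i ++ ([i, i + 1] ++ (List.range r).map (fun x => i + 2 + x)) := by
      rw [hr, List.range_add, List.range_succ, List.range_succ]; simp
    have hz : ∀ X : Module.End ℝ V, Commute X (algebraMap ℝ (Module.End ℝ V) z) :=
      fun X => (Algebra.commutes z X).symm
    rw [hP, hsplit, List.map_append, List.map_append, List.prod_append, List.prod_append]
    refine Commute.mul_right ?_ (Commute.mul_right ?_ ?_)
    · refine Commute.list_prod_right _ _ fun x hx => ?_
      obtain ⟨m, hm, rfl⟩ := List.mem_map.1 hx
      have hm := List.mem_range.1 hm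
      exact (hz _).sub_right (transp_mul_jm_of_ne ρ hi (by lia) (by lia) (by lia))
    · simp only [List.map_cons, List.map_nil, List.prod_cons, List.prod_nil, mul_one]
      set s := transp ρ i (i + 1) with hs
      set Z := algebraMap ℝ (Module.End ℝ V) z with hZ
      have h1 := transp_mul_jm_self ρ i hi
      have h2 := transp_mul_jm_succ ρ i hi
      have hc := (jm_commute ρ (l := i) (m := i + 1) (by lia) hi).eq
      rw [← hs] at h1 h2
      have e1 : s * (Z - jm ρ i) = (Z - jm ρ (i + 1)) * s + 1 := by
        rw [mul_sub, sub_mul, h1, (hz s).eq]; abel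
      have e2 : s * (Z - jm ρ (i + 1)) = (Z - jm ρ i) * s - 1 := by
        rw [mul_sub, sub_mul, h2, (hz s).eq]; abel
      have e3 : (Z - jm ρ i) * (Z - jm ρ (i + 1)) = (Z - jm ρ (i + 1)) * (Z - jm ρ i) :=
        (Commute.sub_left (Commute.sub_right (Commute.refl Z) (hz (jm ρ (i + 1))).symm)
          ((hz (jm ρ i)).sub_right (jm_commute ρ (by lia) hi))).eq
      change s * _ = _ * s
      rw [← mul_assoc, e1, add_mul, mul_assoc, e2, mul_sub, ← mul_assoc, ← e3]
      simp
    · refine Commute.list_prod_right _ _ fun x hx => ?_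
      obtain ⟨m, hm, rfl⟩ := List.mem_map.1 hx
      obtain ⟨q, hq, rfl⟩ := List.mem_map.1 hm
      have hq := List.mem_range.1 hq
      exact (hz _).sub_right (transp_mul_jm_of_ne ρ hi (by lia) (by lia) (by lia))
  obtain ⟨n, rfl⟩ : ∃ n, N = n + 1 := ⟨N - 1, by have := NeZero.pos N; lia⟩
  have hg : g ∈ Submonoid.closure (Set.range fun i : Fin n ↦ Equiv.swap i.castSucc i.succ) := by
    rw [Equiv.Perm.mclosure_swap_castSucc_succ]; trivial
  induction hg using Submonoid.closure_induction with
  | mem x hx =>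
    obtain ⟨i, rfl⟩ := hx
    have := key i (by lia)
    rw [transp] at this
    convert this using 4
    · ext; simp [Fin.ofNat, Nat.mod_eq_of_lt (show (i : ℕ) < n + 1 by lia)]
    · ext; simpa [Fin.ofNat] using (Nat.mod_eq_of_lt (by lia)).symm
  | one => simp
  | mul x y _ _ hx hy => rw [map_mul]; exact hx.mul_left hy

end JucysMurphy

section Spectrum

open scoped InnerProductSpace

variable {V : Type*} [NormedAddCommGroup V] [InnerProductSpace ℝ V] {N : ℕ} [NeZero N]
  {ρ : Equiv.Perm (Fin N) →* Module.End ℝ V}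

theorem transp_symm (hρ : ∀ g x y, ⟪ρ g x, ρ g y⟫_ℝ = ⟪x, y⟫_ℝ) (i j : ℕ) (x y : V) :
    ⟪transp ρ i j x, y⟫_ℝ = ⟪x, transp ρ i j y⟫_ℝ := by
  have h : transp ρ i j (transp ρ i j y) = y := by
    rw [← Module.End.mul_apply, transp_mul_self, Module.End.one_apply]
  conv_lhs => rw [← h]
  exact hρ _ _ _

theorem jm_symm (hρ : ∀ g x y, ⟪ρ g x, ρ g y⟫_ℝ = ⟪x, y⟫_ℝ) (m : ℕ) (x y : V) :
    ⟪jm ρ m x, y⟫_ℝ = ⟪x, jm ρ m y⟫_ℝ := by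
  simp [jm, LinearMap.sum_apply, sum_inner, inner_sum, transp_symm hρ]

theorem jm_transp_apply {c : ℕ → ℝ} {w : V} (hw : ∀ i < N, jm ρ i w = c i • w) {i : ℕ}
    (hi : i + 1 < N) :
    jm ρ i (transp ρ i (i + 1) w) = c (i + 1) • transp ρ i (i + 1) w - w ∧
      jm ρ (i + 1) (transp ρ i (i + 1) w) = c i • transp ρ i (i + 1) w + w := by
  have h1 := congrArg (fun f => f w) (transp_mul_jm_self ρ i hi)
  have h2 := congrArg (fun f => f w) (transp_mul_jm_succ ρ i hi)
  simp only [Module.End.mul_apply, LinearMap.sub_apply, LinearMap.add_apply, Module.End.one_apply,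
    hw i (by lia), hw (i + 1) hi, map_smul] at h1 h2
  exact ⟨by rw [h2]; abel, by rw [h1]; abel⟩

theorem jm_transp_apply_of_ne {c : ℕ → ℝ} {w : V} (hw : ∀ i < N, jm ρ i w = c i • w) {i m : ℕ}
    (hi : i + 1 < N) (hm : m < N) (h1 : m ≠ i) (h2 : m ≠ i + 1) :
    jm ρ m (transp ρ i (i + 1) w) = c m • transp ρ i (i + 1) w := by
  have h := congrArg (fun f => f w) (transp_mul_jm_of_ne ρ hi hm h1 h2)
  simp only [Module.End.mul_apply, hw m hm, map_smul] at h
  exact h.symm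

theorem transp_transp_apply (i j : ℕ) (w : V) : transp ρ i j (transp ρ i j w) = w := by
  rw [← Module.End.mul_apply, transp_mul_self, Module.End.one_apply]

theorem IsJMSpec.zero {c : ℕ → ℝ} (h : IsJMSpec ρ c) : c 0 = 0 := by
  obtain ⟨w, hw0, hw⟩ := h
  have := hw 0 (NeZero.pos N)
  exact (smul_eq_zero.1 (by simpa [jm] using this.symm)).resolve_right hw0

theorem IsJMSpec.ne (hρ : ∀ g x y, ⟪ρ g x, ρ g y⟫_ℝ = ⟪x, y⟫_ℝ) {c : ℕ → ℝ} (h : IsJMSpec ρ c)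
    {i : ℕ} (hi : i + 1 < N) : c i ≠ c (i + 1) := by
  obtain ⟨w, hw0, hw⟩ := h
  intro hc
  have h2 := (jm_transp_apply hw hi).2
  have h3 := jm_symm hρ (i + 1) w (transp ρ i (i + 1) w)
  rw [h2, hw _ hi, inner_add_right, inner_smul_left, inner_smul_right, hc] at h3
  have h4 : ⟪w, w⟫_ℝ = 0 := by simpa using h3
  exact hw0 (inner_self_eq_zero.1 h4)

theorem IsJMSpec.swap (hρ : ∀ g x y, ⟪ρ g x, ρ g y⟫_ℝ = ⟪x, y⟫_ℝ) {c : ℕ → ℝ}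
    (h : IsJMSpec ρ c) {i : ℕ} (hi : i + 1 < N) (h1 : c (i + 1) ≠ c i + 1)
    (h2 : c (i + 1) ≠ c i - 1) : IsJMSpec ρ (c ∘ Equiv.swap i (i + 1)) := by
  have hne := h.ne hρ hi
  obtain ⟨w, hw0, hw⟩ := h
  have hd : c (i + 1) - c i ≠ 0 := fun h => hne (by linarith)
  obtain ⟨e1, e2⟩ := jm_transp_apply hw hi
  refine ⟨transp ρ i (i + 1) w - (c (i + 1) - c i)⁻¹ • w, ?_, ?_⟩
  · intro h0
    have h3 : transp ρ i (i + 1) w = (c (i + 1) - c i)⁻¹ • w := sub_eq_zero.1 h0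
    have h4 := transp_transp_apply (ρ := ρ) i (i + 1) w
    rw [h3, map_smul, h3, smul_smul] at h4
    have h5 : ((c (i + 1) - c i)⁻¹ * (c (i + 1) - c i)⁻¹ - 1) • w = 0 := by
      rw [sub_smul, h4, one_smul, sub_self]
    rcases smul_eq_zero.1 h5 with h6 | h6
    · have h7 : (c (i + 1) - c i - 1) * (c (i + 1) - c i + 1) = 0 := by
        field_simp at h6; linarith
      rcases mul_eq_zero.1 h7 with h8 | h8
      · exact h1 (by linarith)
      · exact h2 (by linarith)
    · exact hw0 h6
  · intro m hm
    rw [map_sub, map_smul, hw m hm, Function.comp_apply]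
    by_cases hmi : m = i
    · subst hmi
      rw [e1, Equiv.swap_apply_left]
      match_scalars <;> field_simp <;> ring
    · by_cases hmi1 : m = i + 1
      · subst hmi1
        rw [e2, Equiv.swap_apply_right]
        match_scalars <;> field_simp <;> ring
      · rw [jm_transp_apply_of_ne hw hi hm hmi hmi1, Equiv.swap_apply_of_ne_of_ne hmi hmi1]
        module

theorem transp_apply_eq_of_adjacent (hρ : ∀ g x y, ⟪ρ g x, ρ g y⟫_ℝ = ⟪x, y⟫_ℝ) {c : ℕ → ℝ}
    {w : V} (hw : ∀ i < N, jm ρ i w = c i • w) {i : ℕ} (hi : i + 1 < N) {ε : ℝ}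
    (hε : ε * ε = 1) (h : c (i + 1) = c i + ε) : transp ρ i (i + 1) w = ε • w := by
  obtain ⟨e1, e2⟩ := jm_transp_apply hw hi
  have h3 := jm_symm hρ i (transp ρ i (i + 1) w) w
  rw [e1, hw i (by lia), h, inner_sub_left, inner_smul_left, inner_smul_right] at h3
  have h5 : ⟪transp ρ i (i + 1) w, transp ρ i (i + 1) w⟫_ℝ = ⟪w, w⟫_ℝ := hρ _ _ _
  have h4 : ε * ⟪transp ρ i (i + 1) w, w⟫_ℝ = ⟪w, w⟫_ℝ := by
    simp only [conj_trivial] at h3; linarith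
  rw [← sub_eq_zero, ← inner_self_eq_zero (𝕜 := ℝ), inner_sub_left, inner_sub_right,
    inner_sub_right, h5, inner_smul_right, inner_smul_left, inner_smul_left, inner_smul_right,
    real_inner_comm (transp ρ i (i + 1) w) w]
  simp only [conj_trivial]
  rw [h4, ← mul_assoc, hε]; ring

theorem braid (i : ℕ) (hi : i + 2 < N) :
    transp ρ i (i + 1) * transp ρ (i + 1) (i + 2) * transp ρ i (i + 1) =
      transp ρ (i + 1) (i + 2) * transp ρ i (i + 1) * transp ρ (i + 1) (i + 2) := by
  rw [transp_mul_transp ρ (a := i) (b := i + 1) (by lia) (by lia) (by lia) hi, mul_assoc,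
    transp_mul_self,
    transp_mul_transp ρ (a := i + 1) (b := i + 2) (by lia) (by lia) (by lia) (by lia),
    mul_assoc, transp_mul_self, Equiv.swap_apply_right, Equiv.swap_apply_left,
    Equiv.swap_apply_of_ne_of_ne (by lia) (by lia), Equiv.swap_apply_of_ne_of_ne (by lia) (by lia)]

theorem IsJMSpec.not_aba (hρ : ∀ g x y, ⟪ρ g x, ρ g y⟫_ℝ = ⟪x, y⟫_ℝ) {c : ℕ → ℝ}
    (h : IsJMSpec ρ c) {i : ℕ} (hi : i + 2 < N) {ε : ℝ} (hε : ε * ε = 1)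
    (h1 : c (i + 1) = c i + ε) (h2 : c (i + 2) = c i) : False := by
  obtain ⟨w, hw0, hw⟩ := h
  have e1 := transp_apply_eq_of_adjacent hρ hw (by lia) hε h1
  have e2 : transp ρ (i + 1) (i + 2) w = -ε • w :=
    transp_apply_eq_of_adjacent hρ hw (i := i + 1) (by lia) (ε := -ε)
    (by rw [neg_mul_neg, hε]) (by rw [h2, h1]; ring)
  have e3 := congrArg (fun f => f w) (braid (ρ := ρ) i hi)
  simp only [Module.End.mul_apply, e1, e2, map_smul, smul_smul] at e3
  have h6 : (2 * ε) • w = 0 := by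
    have : 2 * ε = ε * -ε * -ε - ε * ε * -ε := by linear_combination -2 * ε * hε
    rw [this, sub_smul, sub_eq_zero, ← sub_eq_zero]
    convert sub_eq_zero.2 e3.symm using 3 <;> ring
  rcases smul_eq_zero.1 h6 with h7 | h7
  · have : ε = 0 := by linarith
    simp [this] at hε
  · exact hw0 h7

end Spectrum

section Contents

open scoped InnerProductSpace

variable {V : Type*} [NormedAddCommGroup V] [InnerProductSpace ℝ V] {N : ℕ} [NeZero N]
  {ρ : Equiv.Perm (Fin N) →* Module.End ℝ V}

theorem IsJMSpec.exists_adjacent (hρ : ∀ g x y, ⟪ρ g x, ρ g y⟫_ℝ = ⟪x, y⟫_ℝ) {q : ℕ} :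
    ∀ {c : ℕ → ℝ}, IsJMSpec ρ c → q < N → c q ≠ 0 →
      ∃ p < q, c p = c q + 1 ∨ c p = c q - 1 := by
  induction q with
  | zero => intro c h _ h0; exact absurd h.zero h0
  | succ q ih =>
    intro c h hq h0
    by_cases h1 : c (q + 1) = c q + 1
    · exact ⟨q, by lia, Or.inr (by rw [h1]; ring)⟩
    by_cases h2 : c (q + 1) = c q - 1
    · exact ⟨q, by lia, Or.inl (by rw [h2]; ring)⟩
    obtain ⟨p, hp, hcp⟩ := ih (h.swap hρ hq h1 h2) (by lia) (by simpa using h0)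
    refine ⟨p, by lia, ?_⟩
    simpa [Equiv.swap_apply_of_ne_of_ne (show p ≠ q by lia) (show p ≠ q + 1 by lia)] using hcp

theorem IsJMSpec.exists_between (hρ : ∀ g x y, ⟪ρ g x, ρ g y⟫_ℝ = ⟪x, y⟫_ℝ) (d : ℕ) :
    ∀ {c : ℕ → ℝ}, IsJMSpec ρ c → ∀ p, p + (d + 1) < N → c p = c (p + (d + 1)) →
      (∃ r, p < r ∧ r < p + (d + 1) ∧ c r = c p + 1) ∧
        ∃ r, p < r ∧ r < p + (d + 1) ∧ c r = c p - 1 := by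
  induction d using Nat.strong_induction_on with
  | _ d ih =>
  intro c h p hp hc
  rcases d with _ | d
  · exact absurd hc (h.ne hρ hp)
  by_cases hl : c (p + 1) = c p + 1 ∨ c (p + 1) = c p - 1
  swap
  · push Not at hl
    have hs := h.swap hρ (i := p) (by lia) hl.1 hl.2
    have e1 : (c ∘ Equiv.swap p (p + 1)) (p + 1) = c p := by simp
    have e2 : ∀ r, p + 1 < r → (c ∘ Equiv.swap p (p + 1)) r = c r := fun r hr => by
      simp [Equiv.swap_apply_of_ne_of_ne (show r ≠ p by lia) (show r ≠ p + 1 by lia)]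
    obtain ⟨⟨r, hr1, hr2, hr3⟩, s, hs1, hs2, hs3⟩ := ih d (by lia) hs (p + 1) (by lia)
      (by rw [e1, e2 _ (by lia), hc]; congr 1; lia)
    rw [e1, e2 _ hr1] at hr3
    rw [e1, e2 _ hs1] at hs3
    exact ⟨⟨r, by lia, by lia, hr3⟩, s, by lia, by lia, hs3⟩
  by_cases hr : c p = c (p + (d + 1)) + 1 ∨ c p = c (p + (d + 1)) - 1
  swap
  · push Not at hr
    have hs := h.swap hρ (i := p + (d + 1)) (by lia)
      (by rw [show p + (d + 1) + 1 = p + (d + 1 + 1) by lia, ← hc]; exact hr.1)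
      (by rw [show p + (d + 1) + 1 = p + (d + 1 + 1) by lia, ← hc]; exact hr.2)
    set c' := c ∘ Equiv.swap (p + (d + 1)) (p + (d + 1) + 1) with hc'
    have e1 : c' (p + (d + 1)) = c p := by rw [hc']; simp [hc, add_assoc]
    have e2 : ∀ r, r < p + (d + 1) → c' r = c r := fun r hr => by
      simp [hc', Equiv.swap_apply_of_ne_of_ne (show r ≠ p + (d + 1) by lia)
        (show r ≠ p + (d + 1) + 1 by lia)]
    obtain ⟨⟨r, hr1, hr2, hr3⟩, s, hs1, hs2, hs3⟩ := ih d (by lia) hs p (by lia)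
      (by rw [e1, e2 _ (by lia)])
    rw [e2 p (by lia), e2 _ hr2] at hr3
    rw [e2 p (by lia), e2 _ hs2] at hs3
    exact ⟨⟨r, by lia, by lia, hr3⟩, s, by lia, by lia, hs3⟩
  rcases d with _ | d
  · exfalso
    rcases hl with hl | hl
    · exact h.not_aba hρ (i := p) hp (ε := 1) (by norm_num) hl hc.symm
    · exact h.not_aba hρ (i := p) hp (ε := -1) (by norm_num) (by rw [hl]; ring) hc.symm
  rcases hl with hl | hl <;> rcases hr with hr | hr
  · exact ⟨⟨p + 1, by lia, by lia, hl⟩, p + (d + 1 + 1), by lia, by lia, by rw [hr]; ring⟩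
  · obtain ⟨-, s, hs1, hs2, hs3⟩ := ih d (by lia) h (p + 1) (by lia)
      (by rw [hl, hr, show p + (d + 1 + 1) = p + 1 + (d + 1) by lia]; ring)
    obtain ⟨e, rfl⟩ : ∃ e, s = p + (e + 1) := ⟨s - p - 1, by lia⟩
    obtain ⟨⟨r, hr1, hr2, hr3⟩, t, ht1, ht2, ht3⟩ := ih e (by lia) h p (by lia)
      (by rw [hs3, hl]; ring)
    exact ⟨⟨r, by lia, by lia, hr3⟩, t, by lia, by lia, ht3⟩
  · obtain ⟨⟨s, hs1, hs2, hs3⟩, -⟩ := ih d (by lia) h (p + 1) (by lia)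
      (by rw [hl, hr, show p + (d + 1 + 1) = p + 1 + (d + 1) by lia]; ring)
    obtain ⟨e, rfl⟩ : ∃ e, s = p + (e + 1) := ⟨s - p - 1, by lia⟩
    obtain ⟨⟨r, hr1, hr2, hr3⟩, t, ht1, ht2, ht3⟩ := ih e (by lia) h p (by lia)
      (by rw [hs3, hl]; ring)
    exact ⟨⟨r, by lia, by lia, hr3⟩, t, by lia, by lia, ht3⟩
  · exact ⟨⟨p + (d + 1 + 1), by lia, by lia, by rw [hr, sub_add_cancel]⟩, p + 1, by lia, by lia, hl⟩

theorem IsJMSpec.exists_int (hρ : ∀ g x y, ⟪ρ g x, ρ g y⟫_ℝ = ⟪x, y⟫_ℝ) {c : ℕ → ℝ}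
    (h : IsJMSpec ρ c) (q : ℕ) (hq : q < N) : ∃ z : ℤ, c q = z := by
  induction q using Nat.strong_induction_on with
  | _ q ih =>
  by_cases h0 : c q = 0
  · exact ⟨0, by simp [h0]⟩
  obtain ⟨p, hp, hcp⟩ := h.exists_adjacent hρ hq h0
  obtain ⟨z, hz⟩ := ih p hp (by lia)
  rcases hcp with h1 | h1
  · exact ⟨z - 1, by push_cast; linarith⟩
  · exact ⟨z + 1, by push_cast; linarith⟩

end Contents

/-- The content vectors of length `n` in which nonzero entries have an earlier neighbouring
entry and equal entries are separated by both neighbouring values. -/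
structure IsContentVector (N : ℕ) (c : ℕ → ℤ) : Prop where
  adjacent : ∀ q < N, c q ≠ 0 → ∃ p < q, c p = c q + 1 ∨ c p = c q - 1
  between_add : ∀ p q, p < q → q < N → c p = c q → ∃ r, p < r ∧ r < q ∧ c r = c p + 1
  between_sub : ∀ p q, p < q → q < N → c p = c q → ∃ r, p < r ∧ r < q ∧ c r = c p - 1

open scoped InnerProductSpace in
theorem IsJMSpec.isContentVector {V : Type*} [NormedAddCommGroup V] [InnerProductSpace ℝ V]
    {N : ℕ} [NeZero N] {ρ : Equiv.Perm (Fin N) →* Module.End ℝ V}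
    (hρ : ∀ g x y, ⟪ρ g x, ρ g y⟫_ℝ = ⟪x, y⟫_ℝ) {c : ℕ → ℝ} (h : IsJMSpec ρ c) :
    ∃ z : ℕ → ℤ, (∀ q < N, c q = z q) ∧ IsContentVector N z := by
  choose! z hz using h.exists_int hρ
  refine ⟨z, hz, fun q hq h0 => ?_, fun p q hpq hq he => ?_, fun p q hpq hq he => ?_⟩
  · obtain ⟨p, hp, hcp⟩ := h.exists_adjacent hρ hq (by rw [hz q hq]; exact_mod_cast h0)
    rw [hz q hq, hz p (by lia)] at hcp
    exact ⟨p, hp, by exact_mod_cast hcp⟩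
  all_goals
    obtain ⟨d, rfl⟩ : ∃ d, q = p + (d + 1) := ⟨q - p - 1, by lia⟩
    obtain ⟨⟨r, hr1, hr2, hr3⟩, s, hs1, hs2, hs3⟩ := h.exists_between hρ d p hq
      (by rw [hz _ hq, hz p (by lia), he])
    rw [hz _ (by lia), hz p (by lia)] at hr3 hs3
  · exact ⟨r, hr1, hr2, by exact_mod_cast hr3⟩
  · exact ⟨s, hs1, hs2, by exact_mod_cast hs3⟩

/-- The prefix of length `n` of the content vector `c` fills the diagram with row lengths `r`. -/
structure FillsDiagram (c : ℕ → ℤ) (n : ℕ) (r : ℕ → ℕ) : Prop where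
  anti : Antitone r
  mem : ∀ p < n, ∃ i j : ℕ, j < r i ∧ c p = j - i
  last : ∀ i j : ℕ, j < r i → r (i + 1) ≤ j + 1 → ∃ p < n, c p = j - i ∧
    (r i ≤ j + 1 → ∀ q, p < q → q < n → c q ≠ c p + 1) ∧
    (r (i + 1) ≤ j → ∀ q, p < q → q < n → c q ≠ c p - 1)
  zero : ∀ i, n ≤ i → r i = 0

theorem fillsDiagram_zero (c : ℕ → ℤ) : FillsDiagram c 0 0 :=
  ⟨fun _ _ _ => le_rfl, by simp, by simp, by simp⟩

theorem FillsDiagram.grow {N : ℕ} {c : ℕ → ℤ} (hc : IsContentVector N c) {n : ℕ} (hn : n < N)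
    {r : ℕ → ℕ} (h : FillsDiagram c n r) :
    ∃ i, (i = 0 ∨ r i < r (i - 1)) ∧ c n = r i - i ∧
      FillsDiagram c (n + 1) (Function.update r i (r i + 1)) := by
  have hex : ∃ i, (r i : ℤ) - i ≤ c n := by
    refine ⟨n + (c n).natAbs, ?_⟩
    rw [h.zero _ (by lia)]
    have := neg_abs_le (c n)
    push_cast; lia
  classical
  set i := Nat.find hex with hi
  have hi1 : (r i : ℤ) - i ≤ c n := Nat.find_spec hex
  have hi2 : ∀ j < i, c n < r j - j := fun j hj => not_le.1 (Nat.find_min hex hj)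
  clear_value i
  by_cases heq : c n = r i - i
  swap
  · exfalso
    rcases i with _ | i
    · have h0 : r 0 < c n := by simp at hi1 heq; lia
      obtain ⟨p, hp, hcp⟩ := hc.adjacent n hn (by lia)
      obtain ⟨a, b, hab, hp'⟩ := h.mem p hp
      have := h.anti (Nat.zero_le a)
      lia
    · have h1 := hi2 i (by lia)
      obtain ⟨j, hj⟩ : ∃ j : ℕ, c n = j - i := ⟨(c n + i).toNat, by push_cast at *; lia⟩
      obtain ⟨p, hp, hcp, -, hl⟩ := h.last i j (by lia) (by push_cast at *; lia)
      obtain ⟨q, hq1, hq2, hq3⟩ := hc.between_sub p n hp hn (by lia)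
      exact hl (by push_cast at *; lia) q hq1 hq2 hq3
  by_cases hcor : i = 0 ∨ r i < r (i - 1)
  swap
  · exfalso
    push Not at hcor
    obtain ⟨i, rfl⟩ : ∃ l, i = l + 1 := ⟨i - 1, by lia⟩
    have h2 := h.anti (show i ≤ i + 1 by lia)
    have h3 : r i = r (i + 1) := by simp at hcor; lia
    rcases Nat.eq_zero_or_pos (r i) with h0 | h0
    · obtain ⟨p, hp, hcp⟩ := hc.adjacent n hn (by push_cast at *; lia)
      obtain ⟨a, b, hab, hp'⟩ := h.mem p hp
      have : r a ≤ r i := h.anti (by push_cast at *; lia)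
      lia
    · obtain ⟨p, hp, hcp, hl, -⟩ := h.last i (r i - 1) (by lia) (by lia)
      obtain ⟨q, hq1, hq2, hq3⟩ := hc.between_add p n hp hn (by push_cast at *; lia)
      exact hl (by lia) q hq1 hq2 hq3
  refine ⟨i, hcor, heq, ?_, ?_, ?_, ?_⟩
  · intro a b hab
    have h1 := h.anti hab
    simp only [Function.update_apply]
    split_ifs with hb ha ha
    · lia
    · subst hb
      have : r (b - 1) ≤ r a := h.anti (by lia)
      lia
    · subst ha; lia
    · exact h1
  · intro p hp
    rcases (Nat.lt_succ_iff_lt_or_eq.1 hp) with hp | rfl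
    · obtain ⟨a, b, hab, e⟩ := h.mem p hp
      exact ⟨a, b, by rw [Function.update_apply]; split_ifs with h1 <;> [subst h1; skip] <;> lia, e⟩
    · exact ⟨i, r i, by simp, heq⟩
  · intro a b hab hab'
    by_cases hnew : a = i ∧ b = r i
    · obtain ⟨rfl, rfl⟩ := hnew
      exact ⟨n, by lia, heq, fun _ q _ _ => by lia, fun _ q _ _ => by lia⟩
    have h1 : b < r a := by
      rw [Function.update_apply] at hab
      split_ifs at hab with h1
      · subst h1; lia
      · exact hab
    have h2 : r (a + 1) ≤ Function.update r i (r i + 1) (a + 1) := by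
      rw [Function.update_apply]; split_ifs with h1 <;> [rw [← h1]; skip] <;> lia
    have h3 : r a ≤ Function.update r i (r i + 1) a := by
      rw [Function.update_apply]; split_ifs with h1 <;> [rw [← h1]; skip] <;> lia
    obtain ⟨p, hp, hcp, hl1, hl2⟩ := h.last a b h1 (by lia)
    refine ⟨p, by lia, hcp, fun hr q hpq hq => ?_, fun hr q hpq hq => ?_⟩
    · rcases (Nat.lt_succ_iff_lt_or_eq.1 hq) with hq | rfl
      · exact hl1 (by lia) q hpq hq
      · intro hcq
        rw [Function.update_apply] at hr
        split_ifs at hr with hai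
        · subst hai; lia
        rcases lt_trichotomy a i with hlt | heq' | hgt
        · have : r i ≤ r (a + 1) := h.anti (by lia)
          lia
        · exact hai heq'
        · have : r a ≤ r i := h.anti (by lia)
          lia
    · rcases (Nat.lt_succ_iff_lt_or_eq.1 hq) with hq | rfl
      · exact hl2 (by lia) q hpq hq
      · intro hcq
        rw [Function.update_apply] at hr
        split_ifs at hr with hai
        · subst hai; lia
        rcases lt_trichotomy (a + 1) i with hlt | heq' | hgt
        · have h4 : r i ≤ r (a + 1) := h.anti (by lia)
          have h5 : r (i - 1) ≤ r (a + 1) := h.anti (by lia)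
          lia
        · exact hai heq'
        · have : r a ≤ r i := h.anti (by lia)
          lia
  · intro a ha
    rw [Function.update_apply]
    split_ifs with hai
    · subst hai
      have := hi2 n (by lia)
      rw [h.zero n le_rfl] at this
      rw [h.zero a (by lia)] at heq
      have := h.zero (a - 1) (by lia)
      rw [h.zero a (by lia)] at hcor
      lia
    · exact h.zero a (by lia)

/-- `FillsByDominoes c n R`: the entries `c 0, …, c (n - 1)` are the contents of the left cells of
horizontal dominoes successively stacked into the diagram with row lengths `2 * R i`. -/
inductive FillsByDominoes (c : ℕ → ℤ) : ℕ → (ℕ → ℕ) → Prop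
  | zero : FillsByDominoes c 0 0
  | succ {n : ℕ} {R : ℕ → ℕ} (i : ℕ) (h : FillsByDominoes c n R)
      (hi : i = 0 ∨ R i < R (i - 1)) (hc : c n = 2 * R i - i) :
      FillsByDominoes c (n + 1) (Function.update R i (R i + 1))

theorem IsContentVector.fillsByDominoes {N : ℕ} {c : ℕ → ℤ} (hc : IsContentVector N c) {k : ℕ}
    (hk : 2 * k ≤ N) (hd : ∀ j < k, c (2 * j + 1) = c (2 * j) + 1) :
    ∃ R, FillsByDominoes (fun j => c (2 * j)) k R ∧ FillsDiagram c (2 * k) (fun i => 2 * R i) := by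
  induction k with
  | zero => exact ⟨0, .zero, fillsDiagram_zero c⟩
  | succ k ih =>
    obtain ⟨R, hR, hF⟩ := ih (by lia) fun j hj => hd j (by lia)
    obtain ⟨i, hi, hci, hF1⟩ := hF.grow hc (by lia)
    obtain ⟨i', hi', hci', hF2⟩ := hF1.grow hc (by lia)
    have hii : i' = i := by
      rw [hd k (by lia), hci] at hci'
      rcases lt_trichotomy i' i with hlt | heq | hgt
      · have := hF1.anti hlt.le
        simp only [Function.update_self, Function.update_of_ne hlt.ne] at this hci'
        lia
      · exact heq
      · have := hF1.anti hgt.le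
        simp only [Function.update_self, Function.update_of_ne hgt.ne'] at this hci'
        lia
    subst hii
    refine ⟨_, hR.succ i' (by lia) (by rw [hci]; push_cast; ring), ?_⟩
    rw [show 2 * (k + 1) = 2 * k + 1 + 1 by lia]
    convert hF2 using 1
    funext a
    simp only [Function.update_apply]
    split_ifs <;> lia

open scoped InnerProductSpace in
/-- A decomposition of `v` into orthogonal joint eigenvectors of the Jucys–Murphy elements. -/
structure JMDecomp {V : Type*} [NormedAddCommGroup V] [InnerProductSpace ℝ V] {N : ℕ} [NeZero N]
    (ρ : Equiv.Perm (Fin N) →* Module.End ℝ V) (v : V) (ι : Type*) [Fintype ι] where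
  /-- the components of `v` -/
  u : ι → V
  /-- the content vectors of the components -/
  c : ι → ℕ → ℝ
  sum_u : ∑ T, u T = v
  ne_zero : ∀ T, u T ≠ 0
  eigen : ∀ T, ∀ i < N, jm ρ i (u T) = c T i • u T
  orth : ∀ T T', T ≠ T' → ⟪u T, u T'⟫_ℝ = 0

section Decomposition

open scoped InnerProductSpace

variable {V : Type*} [NormedAddCommGroup V] [InnerProductSpace ℝ V] {N : ℕ} [NeZero N]
  {ρ : Equiv.Perm (Fin N) →* Module.End ℝ V}

theorem exists_jmDecomp [FiniteDimensional ℝ V] (hρ : ∀ g x y, ⟪ρ g x, ρ g y⟫_ℝ = ⟪x, y⟫_ℝ)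
    (v : V) : ∃ (ι : Type) (_ : Fintype ι), Nonempty (JMDecomp ρ v ι) := by
  classical
  have hsym : ∀ i : Fin N, (jm ρ i).IsSymmetric := fun i x y => jm_symm hρ i x y
  have hcomm : Pairwise (Function.onFun Commute fun i : Fin N => jm ρ i) :=
    fun i j _ => jm_commute ρ i.2 j.2
  have hinternal := LinearMap.IsSymmetric.directSum_isInternal_of_pairwise_commute hsym hcomm
  have hv : v ∈ ⨆ χ : Fin N → ℝ, ⨅ j : Fin N, Module.End.eigenspace (jm ρ j) (χ j) := by
    rw [hinternal.submodule_iSup_eq_top]; trivial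
  obtain ⟨f, hf, hsum⟩ := (Submodule.mem_iSup_iff_exists_finsupp _ _).1 hv
  have horth : ∀ χ χ' : Fin N → ℝ, χ ≠ χ' → ⟪f χ, f χ'⟫_ℝ = 0 := fun χ χ' hne => by
    obtain ⟨i, hi⟩ := Function.ne_iff.1 hne
    have h1 := Module.End.mem_eigenspace_iff.1 ((Submodule.mem_iInf _).1 (hf χ) i)
    have h2 := Module.End.mem_eigenspace_iff.1 ((Submodule.mem_iInf _).1 (hf χ') i)
    have h3 := jm_symm hρ i (f χ) (f χ')
    rw [h1, h2, inner_smul_left, inner_smul_right, conj_trivial] at h3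
    exact (mul_eq_zero.1 (show (χ i - χ' i) * ⟪f χ, f χ'⟫_ℝ = 0 by linarith)).resolve_left
      (sub_ne_zero.2 hi)
  refine ⟨Fin f.support.card, inferInstance, ⟨{
    u := fun T => f (f.support.equivFin.symm T).1
    c := fun T n => if h : n < N then (f.support.equivFin.symm T).1 ⟨n, h⟩ else 0
    sum_u := ?_, ne_zero := ?_, eigen := ?_, orth := ?_ }⟩⟩
  · rw [Equiv.sum_comp f.support.equivFin.symm (fun x => f x.1), ← hsum, Finsupp.sum,
      Finset.sum_coe_sort]
  · exact fun T => Finsupp.mem_support_iff.1 (f.support.equivFin.symm T).2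
  · intro T i hi
    rw [dif_pos hi]
    exact Module.End.mem_eigenspace_iff.1 ((Submodule.mem_iInf _).1 (hf _) ⟨i, hi⟩)
  · intro T T' hne
    exact horth _ _ fun h => hne (f.support.equivFin.symm.injective (Subtype.ext h))

namespace JMDecomp

variable {v : V} {ι : Type*} [Fintype ι] (D : JMDecomp ρ v ι)

/-- The weighted sum of a function of the components, with weights their squared norms. -/
noncomputable def E (φ : ι → ℝ) : ℝ := ∑ T, φ T * ⟪D.u T, D.u T⟫_ℝ

/-- The combination of the components of `v` with coefficients `φ`. -/
noncomputable def comb (φ : ι → ℝ) : V := ∑ T, φ T • D.u T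

theorem comb_one : D.comb 1 = v := by simp [comb, D.sum_u]

theorem inner_comb (φ ψ : ι → ℝ) : ⟪D.comb φ, D.comb ψ⟫_ℝ = D.E (φ * ψ) := by
  classical
  simp only [comb, E, sum_inner, inner_sum, inner_smul_left, inner_smul_right, conj_trivial]
  refine Finset.sum_congr rfl fun T _ => ?_
  rw [Finset.sum_eq_single T]
  · simp; ring
  · intro T' _ hne
    rw [D.orth T' T hne]; ring
  · simp

theorem jm_comb (φ : ι → ℝ) {i : ℕ} (hi : i < N) :
    jm ρ i (D.comb φ) = D.comb (fun T => D.c T i * φ T) := by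
  simp only [comb, map_sum, map_smul, D.eigen _ i hi, smul_smul, mul_comm]

theorem inner_self_pos (T : ι) : 0 < ⟪D.u T, D.u T⟫_ℝ :=
  real_inner_self_pos.2 (D.ne_zero T)

/-- Combinations whose coefficients depend only on the contents with indices in `I` inherit the
symmetries of `v` that commute with the corresponding Jucys–Murphy elements. -/
theorem apply_comb (hρ : ∀ g x y, ⟪ρ g x, ρ g y⟫_ℝ = ⟪x, y⟫_ℝ) {I : Set ℕ}
    (hI : ∀ i ∈ I, i < N) {g : Equiv.Perm (Fin N)} (hg : ∀ i ∈ I, Commute (ρ g) (jm ρ i))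
    (hv : ρ g v = v) {φ : ι → ℝ} (hφ : ∀ T T', (∀ i ∈ I, D.c T i = D.c T' i) → φ T = φ T') :
    ρ g (D.comb φ) = D.comb φ := by
  have key : ∀ T T', φ T' * ⟪ρ g (D.u T), D.u T'⟫_ℝ = φ T * ⟪ρ g (D.u T), D.u T'⟫_ℝ := by
    intro T T'
    by_cases h : ∀ i ∈ I, D.c T i = D.c T' i
    · rw [hφ T T' h]
    push Not at h
    obtain ⟨i, hi, hne⟩ := h
    have h1 := jm_symm hρ i (ρ g (D.u T)) (D.u T')
    have h2 : jm ρ i (ρ g (D.u T)) = ρ g (jm ρ i (D.u T)) :=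
      (congrArg (fun f => f (D.u T)) (hg i hi).eq).symm
    rw [h2, D.eigen T i (hI i hi), D.eigen T' i (hI i hi), map_smul, inner_smul_left,
      inner_smul_right, conj_trivial] at h1
    have h3 : ⟪ρ g (D.u T), D.u T'⟫_ℝ = 0 :=
      (mul_eq_zero.1 (show (D.c T i - D.c T' i) * ⟪ρ g (D.u T), D.u T'⟫_ℝ = 0 by
        linarith)).resolve_left (sub_ne_zero.2 hne)
    rw [h3]; ring
  have hT : ∀ T, ⟪D.u T, v⟫_ℝ = ⟪D.u T, D.u T⟫_ℝ := fun T => by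
    have h : ⟪D.u T, v⟫_ℝ = ⟪D.u T, ∑ T', D.u T'⟫_ℝ := by rw [D.sum_u]
    rw [h, inner_sum]
    exact Finset.sum_eq_single T (fun T' _ hne => D.orth T T' hne.symm) (by simp)
  have h4 : ⟪ρ g (D.comb φ), D.comb φ⟫_ℝ = ⟪D.comb φ, D.comb φ⟫_ℝ := by
    rw [inner_comb]
    simp only [comb, map_sum, map_smul, sum_inner, inner_sum, inner_smul_left, inner_smul_right,
      conj_trivial, E]
    refine Finset.sum_congr rfl fun T _ => ?_
    rw [Finset.sum_congr rfl fun x _ => (key x T).symm]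
    rw [← Finset.mul_sum, ← sum_inner, ← map_sum, D.sum_u, hv, real_inner_comm, hT]
    simp [mul_assoc]
  rw [← sub_eq_zero, ← inner_self_eq_zero (𝕜 := ℝ), inner_sub_left, inner_sub_right,
    inner_sub_right, hρ, real_inner_comm (ρ g (D.comb φ)) (D.comb φ), h4]
  ring

/-- Over an irreducible representation all content vectors have the same power sums. -/
theorem sum_content_eq
    (hirr : ∀ U : Submodule ℝ V, (∀ g, ∀ x ∈ U, ρ g x ∈ U) → U = ⊥ ∨ U = ⊤)
    (T T' : ι) (f : ℝ → ℝ) :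
    ∑ i ∈ Finset.range N, f (D.c T i) = ∑ i ∈ Finset.range N, f (D.c T' i) := by
  have hZ : ∀ (z : ℝ) (T : ι),
      ((List.range N).map fun i => algebraMap ℝ (Module.End ℝ V) z - jm ρ i).prod (D.u T) =
        (((List.range N).map fun i => z - D.c T i).prod) • D.u T := by
    intro z T
    have : ∀ l : List ℕ, (∀ i ∈ l, i < N) →
        (l.map fun i => algebraMap ℝ (Module.End ℝ V) z - jm ρ i).prod (D.u T) =
        ((l.map fun i => z - D.c T i).prod) • D.u T := by
      intro l
      induction l with
      | nil => simp
      | cons a l ih =>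
        intro hl
        rw [List.map_cons, List.prod_cons, Module.End.mul_apply, ih fun i hi => hl i (by simp [hi]),
          map_smul, LinearMap.sub_apply, Module.algebraMap_end_apply, D.eigen T a (hl a (by simp)),
          ← sub_smul, smul_smul, List.map_cons, List.prod_cons, mul_comm]
    exact this _ fun i hi => List.mem_range.1 hi
  have hprod : ∀ z : ℝ, ((List.range N).map fun i => z - D.c T i).prod =
      ((List.range N).map fun i => z - D.c T' i).prod := by
    intro z
    set P := ((List.range N).map fun i => algebraMap ℝ (Module.End ℝ V) z - jm ρ i).prod with hP
    set ζ := ((List.range N).map fun i => z - D.c T i).prod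
    have hmem : D.u T ∈ Module.End.eigenspace P ζ := Module.End.mem_eigenspace_iff.2 (hZ z T)
    rcases hirr (Module.End.eigenspace P ζ) fun g x hx => by
      rw [Module.End.mem_eigenspace_iff] at hx ⊢
      rw [← Module.End.mul_apply, ← (prod_sub_jm_central ρ z g P hP).eq, Module.End.mul_apply, hx,
        map_smul] with h | h
    · rw [h] at hmem
      exact absurd ((Submodule.mem_bot ℝ).1 hmem) (D.ne_zero T)
    · have h2 : D.u T' ∈ Module.End.eigenspace P ζ := by rw [h]; trivial
      rw [Module.End.mem_eigenspace_iff, hZ z T', ← sub_eq_zero, ← sub_smul] at h2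
      exact (sub_eq_zero.1 ((smul_eq_zero.1 h2).resolve_right (D.ne_zero T'))).symm
  have hpoly : ∀ T : ι, ∀ z : ℝ, (((Multiset.range N).map fun i => D.c T i).map
      fun a => Polynomial.X - Polynomial.C a).prod.eval z =
        ((List.range N).map fun i => z - D.c T i).prod := by
    intro T z
    rw [Polynomial.eval_multiset_prod, Multiset.map_map, Multiset.map_map]
    simp [Multiset.range, Function.comp_def]
  have hm : (Multiset.range N).map (fun i => D.c T i) =
      (Multiset.range N).map fun i => D.c T' i := by
    rw [← Polynomial.roots_multiset_prod_X_sub_C ((Multiset.range N).map fun i => D.c T i),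
      ← Polynomial.roots_multiset_prod_X_sub_C ((Multiset.range N).map fun i => D.c T' i)]
    congr 1
    exact Polynomial.funext fun z => by rw [hpoly, hpoly, hprod]
  have := congrArg (fun m => (m.map f).sum) hm
  simpa [Multiset.map_map, Finset.sum] using this

end JMDecomp

end Decomposition

/-- The exchange of the `p`-th and the `q`-th edge of the base matching, acting through `ρ`. -/
def edgeSwap {V : Type*} [AddCommGroup V] [Module ℝ V] {N : ℕ} [NeZero N]
    (ρ : Equiv.Perm (Fin N) →* Module.End ℝ V) (p q : ℕ) : Module.End ℝ V :=
  transp ρ (2 * p) (2 * q) * transp ρ (2 * p + 1) (2 * q + 1)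

/-- The vector `w` is fixed by the flips and the exchanges of the edges of the base matching with
index in `S`. -/
structure IsEdgeInvariant {V : Type*} [AddCommGroup V] [Module ℝ V] {N : ℕ} [NeZero N]
    (ρ : Equiv.Perm (Fin N) →* Module.End ℝ V) (S : Set ℕ) (w : V) : Prop where
  flip : ∀ p ∈ S, transp ρ (2 * p) (2 * p + 1) w = w
  swap : ∀ p ∈ S, ∀ q ∈ S, edgeSwap ρ p q w = w

theorem IsEdgeInvariant.mono {V : Type*} [AddCommGroup V] [Module ℝ V] {N : ℕ} [NeZero N]
    {ρ : Equiv.Perm (Fin N) →* Module.End ℝ V} {S S' : Set ℕ} {w : V}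
    (h : IsEdgeInvariant ρ S w) (hS : S' ⊆ S) : IsEdgeInvariant ρ S' w :=
  ⟨fun p hp => h.flip p (hS hp), fun p hp q hq => h.swap p (hS hp) q (hS hq)⟩

theorem sum_range_two_mul {M : Type*} [AddCommMonoid M] (f : ℕ → M) (j : ℕ) :
    ∑ i ∈ Finset.range (2 * j), f i = ∑ p ∈ Finset.range j, (f (2 * p) + f (2 * p + 1)) := by
  induction j with
  | zero => simp
  | succ j ih =>
    rw [show 2 * (j + 1) = 2 * j + 1 + 1 by ring, Finset.sum_range_succ, Finset.sum_range_succ, ih,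
      Finset.sum_range_succ, add_assoc]

theorem eq_of_swap_invariant₂ {n : ℕ} (F : ℕ → ℕ → ℝ)
    (hF : ∀ a < n, ∀ b < n, ∀ p < n, ∀ q < n, F (Equiv.swap a b p) (Equiv.swap a b q) = F p q)
    {p q : ℕ} (hp : p < n) (hq : q < n) (hpq : p ≠ q) : F p q = F 0 1 := by
  have h0 : Equiv.swap 0 p q < n := swap_nat_lt (by lia) hp hq
  have h1 : Equiv.swap 0 p q ≠ 0 := fun h => hpq <| by
    rw [Equiv.swap_apply_eq_iff, Equiv.swap_apply_left] at h; exact h.symm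
  rw [← hF 0 (by lia) p hp p hp q hq, Equiv.swap_apply_right,
    ← hF 1 (by lia) _ h0 0 (by lia) _ h0, Equiv.swap_apply_right,
    Equiv.swap_apply_of_ne_of_ne (by lia) h1.symm]

theorem eq_of_swap_invariant₃ {n : ℕ} (F : ℕ → ℕ → ℕ → ℝ)
    (hF : ∀ a < n, ∀ b < n, ∀ p < n, ∀ q < n, ∀ r < n,
      F (Equiv.swap a b p) (Equiv.swap a b q) (Equiv.swap a b r) = F p q r)
    {p q r : ℕ} (hp : p < n) (hq : q < n) (hr : r < n) (hpq : p ≠ q) (hpr : p ≠ r) (hqr : q ≠ r) :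
    F p q r = F 0 1 2 := by
  set q₁ := Equiv.swap 0 p q with hq₁
  set r₁ := Equiv.swap 0 p r with hr₁
  have hq₁n : q₁ < n := swap_nat_lt (by lia) hp hq
  have hr₁n : r₁ < n := swap_nat_lt (by lia) hp hr
  have hq₁0 : q₁ ≠ 0 := fun h => hpq <| by
    rw [hq₁, Equiv.swap_apply_eq_iff, Equiv.swap_apply_left] at h; exact h.symm
  have hr₁0 : r₁ ≠ 0 := fun h => hpr <| by
    rw [hr₁, Equiv.swap_apply_eq_iff, Equiv.swap_apply_left] at h; exact h.symm
  have hqr₁ : q₁ ≠ r₁ := fun h => hqr ((Equiv.swap 0 p).injective h)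
  set r₂ := Equiv.swap 1 q₁ r₁ with hr₂
  have hr₂n : r₂ < n := swap_nat_lt (by lia) hq₁n hr₁n
  have hr₂0 : r₂ ≠ 0 := fun h => hr₁0 <| by
    rwa [hr₂, Equiv.swap_apply_eq_iff, Equiv.swap_apply_of_ne_of_ne (by lia) hq₁0.symm] at h
  have hr₂1 : r₂ ≠ 1 := fun h => hqr₁ <| by
    rw [hr₂, Equiv.swap_apply_eq_iff, Equiv.swap_apply_left] at h; exact h.symm
  rw [← hF 0 (by lia) p hp p hp q hq r hr, Equiv.swap_apply_right, ← hq₁, ← hr₁,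
    ← hF 1 (by lia) q₁ hq₁n 0 (by lia) q₁ hq₁n r₁ hr₁n, Equiv.swap_apply_right, ← hr₂,
    Equiv.swap_apply_of_ne_of_ne (by lia) hq₁0.symm,
    ← hF 2 (by lia) r₂ hr₂n 0 (by lia) 1 (by lia) r₂ hr₂n, Equiv.swap_apply_right,
    Equiv.swap_apply_of_ne_of_ne (by lia) (by lia), Equiv.swap_apply_of_ne_of_ne (by lia) (by lia)]

section Relations

open scoped InnerProductSpace

variable {V : Type*} [NormedAddCommGroup V] [InnerProductSpace ℝ V] {N : ℕ} [NeZero N]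
  {ρ : Equiv.Perm (Fin N) →* Module.End ℝ V}

theorem transp_isometry (hρ : ∀ g x y, ⟪ρ g x, ρ g y⟫_ℝ = ⟪x, y⟫_ℝ) (i j : ℕ) (x y : V) :
    ⟪transp ρ i j x, transp ρ i j y⟫_ℝ = ⟪x, y⟫_ℝ := hρ _ x y

theorem edgeSwap_isometry (hρ : ∀ g x y, ⟪ρ g x, ρ g y⟫_ℝ = ⟪x, y⟫_ℝ) (i j : ℕ) (x y : V) :
    ⟪edgeSwap ρ i j x, edgeSwap ρ i j y⟫_ℝ = ⟪x, y⟫_ℝ := by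
  simp only [edgeSwap, Module.End.mul_apply, transp_isometry hρ]

theorem edgeSwap_mul_transp {p q a b : ℕ} (hp : 2 * p + 1 < N) (hq : 2 * q + 1 < N)
    (ha : 2 * a < N) (hb : 2 * b < N) :
    edgeSwap ρ p q * transp ρ (2 * a) (2 * b) =
      transp ρ (2 * Equiv.swap p q a) (2 * Equiv.swap p q b) * edgeSwap ρ p q := by
  have h : ∀ x, Equiv.swap (2 * p) (2 * q) (2 * x) = 2 * Equiv.swap p q x := fun x => by
    simp only [Equiv.swap_apply_def]; split_ifs <;> lia
  have h' : ∀ x, Equiv.swap (2 * p + 1) (2 * q + 1) (2 * x) = 2 * x := fun x =>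
    Equiv.swap_apply_of_ne_of_ne (by lia) (by lia)
  rw [edgeSwap, mul_assoc, transp_mul_transp ρ hp hq ha hb, h', h', ← mul_assoc,
    transp_mul_transp ρ (by lia) (by lia) ha hb, h, h, mul_assoc]

theorem inner_apply_eq {w w' : V} {h A A' B B' : Module.End ℝ V}
    (hiso : ∀ x y, ⟪h x, h y⟫_ℝ = ⟪x, y⟫_ℝ) (hw : h w = w) (hw' : h w' = w')
    (hA : h * A = A' * h) (hB : h * B = B' * h) : ⟪A w, B w'⟫_ℝ = ⟪A' w, B' w'⟫_ℝ := by
  have e1 := congrArg (fun f => f w) hA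
  have e2 := congrArg (fun f => f w') hB
  simp only [Module.End.mul_apply, hw, hw'] at e1 e2
  rw [← hiso, e1, e2]

variable {n : ℕ} {w w' : V}

theorem inner_transp_const (hρ : ∀ g x y, ⟪ρ g x, ρ g y⟫_ℝ = ⟪x, y⟫_ℝ) (hn : 2 * n ≤ N)
    (hw : IsEdgeInvariant ρ {p | p < n} w) (hw' : IsEdgeInvariant ρ {p | p < n} w') {p q : ℕ}
    (hp : p < n) (hq : q < n) (hpq : p ≠ q) :
    ⟪w, transp ρ (2 * p) (2 * q) w'⟫_ℝ = ⟪w, transp ρ 0 2 w'⟫_ℝ :=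
  eq_of_swap_invariant₂ (fun p q => ⟪w, transp ρ (2 * p) (2 * q) w'⟫_ℝ)
    (fun a ha b hb p hp q hq => (inner_apply_eq (A := 1) (A' := 1) (edgeSwap_isometry hρ a b)
      (hw.swap a ha b hb) (hw'.swap a ha b hb) (by simp)
      (edgeSwap_mul_transp (by lia) (by lia) (by lia) (by lia))).symm) hp hq hpq

theorem inner_transp_transp_const (hρ : ∀ g x y, ⟪ρ g x, ρ g y⟫_ℝ = ⟪x, y⟫_ℝ) (hn : 2 * n ≤ N)
    (hw : IsEdgeInvariant ρ {p | p < n} w) (hw' : IsEdgeInvariant ρ {p | p < n} w') {p q r : ℕ}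
    (hp : p < n) (hq : q < n) (hr : r < n) (hpq : p ≠ q) (hpr : p ≠ r) (hqr : q ≠ r) :
    ⟪transp ρ (2 * p) (2 * r) w, transp ρ (2 * q) (2 * r) w'⟫_ℝ =
      ⟪transp ρ 0 4 w, transp ρ 2 4 w'⟫_ℝ :=
  eq_of_swap_invariant₃
    (fun p q r => ⟪transp ρ (2 * p) (2 * r) w, transp ρ (2 * q) (2 * r) w'⟫_ℝ)
    (fun a ha b hb p hp q hq r hr => (inner_apply_eq (edgeSwap_isometry hρ a b)
      (hw.swap a ha b hb) (hw'.swap a ha b hb)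
      (edgeSwap_mul_transp (by lia) (by lia) (by lia) (by lia))
      (edgeSwap_mul_transp (by lia) (by lia) (by lia) (by lia))).symm) hp hq hr hpq hpr hqr

theorem flip_mul_transp {p i j : ℕ} (hp : 2 * p + 1 < N) (hi : i < N) (hj : j < N)
    (hj1 : j ≠ 2 * p) (hj2 : j ≠ 2 * p + 1) :
    transp ρ (2 * p) (2 * p + 1) * transp ρ i j =
      transp ρ (Equiv.swap (2 * p) (2 * p + 1) i) j * transp ρ (2 * p) (2 * p + 1) := by
  rw [transp_mul_transp ρ (by lia) hp hi hj, Equiv.swap_apply_of_ne_of_ne hj1 hj2]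

theorem inner_transp_flip (hρ : ∀ g x y, ⟪ρ g x, ρ g y⟫_ℝ = ⟪x, y⟫_ℝ) (hn : 2 * n ≤ N)
    {S : Set ℕ} (hw : IsEdgeInvariant ρ S w) (hw' : IsEdgeInvariant ρ S w') {p m : ℕ}
    (hp : p ∈ S) (hpn : p < n) (hm : m < N) (hm1 : m ≠ 2 * p) (hm2 : m ≠ 2 * p + 1) :
    ⟪w, transp ρ (2 * p + 1) m w'⟫_ℝ = ⟪w, transp ρ (2 * p) m w'⟫_ℝ :=
  inner_apply_eq (A := 1) (A' := 1) (transp_isometry hρ _ _) (hw.flip p hp) (hw'.flip p hp)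
    (by simp) (by rw [flip_mul_transp (by lia) (by lia) hm hm1 hm2, Equiv.swap_apply_right])

theorem inner_transp_mul_transp_flip (hρ : ∀ g x y, ⟪ρ g x, ρ g y⟫_ℝ = ⟪x, y⟫_ℝ)
    (hn : 2 * n ≤ N) (hw : IsEdgeInvariant ρ {p | p < n} w) {p m : ℕ} (hp : p < n) (hm : m < N)
    (hm2 : m ≠ 2 * p + 1) :
    ⟪transp ρ (2 * p) m w, transp ρ (2 * p + 1) m w'⟫_ℝ = ⟪w, transp ρ (2 * p) m w'⟫_ℝ := by
  rw [transp_symm hρ, ← Module.End.mul_apply,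
    transp_mul_transp ρ (by lia) hm (by lia) hm, Equiv.swap_apply_right,
    Equiv.swap_apply_of_ne_of_ne (by lia) hm2.symm, Module.End.mul_apply,
    transp_comm ρ (2 * p + 1), ← transp_symm hρ, hw.flip p hp]

theorem inner_transp_mul_transp (hρ : ∀ g x y, ⟪ρ g x, ρ g y⟫_ℝ = ⟪x, y⟫_ℝ)
    (hn : 2 * n ≤ N) (hw : IsEdgeInvariant ρ {p | p < n} w)
    (hw' : IsEdgeInvariant ρ {p | p < n} w') {p q r a b : ℕ} (hp : p < n) (hq : q < n)
    (hr : r < n) (hpq : p ≠ q) (hpr : p ≠ r) (hqr : q ≠ r) (ha : a = 2 * p ∨ a = 2 * p + 1)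
    (hb : b = 2 * q ∨ b = 2 * q + 1) :
    ⟪transp ρ a (2 * r) w, transp ρ b (2 * r) w'⟫_ℝ =
      ⟪transp ρ 0 4 w, transp ρ 2 4 w'⟫_ℝ := by
  have hb' : b < N := by lia
  have hbp : b ≠ 2 * p ∧ b ≠ 2 * p + 1 := by lia
  have h1 : ⟪transp ρ a (2 * r) w, transp ρ b (2 * r) w'⟫_ℝ =
      ⟪transp ρ (2 * p) (2 * r) w, transp ρ b (2 * r) w'⟫_ℝ := by
    rcases ha with rfl | rfl
    · rfl
    · refine inner_apply_eq (transp_isometry hρ _ _) (hw.flip p hp) (hw'.flip p hp)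
        (by rw [flip_mul_transp (by lia) (by lia) (by lia) (by lia) (by lia),
          Equiv.swap_apply_right])
        (by rw [flip_mul_transp (by lia) (by lia) (by lia) (by lia) (by lia),
          Equiv.swap_apply_of_ne_of_ne hbp.1 hbp.2])
  have h2 : ⟪transp ρ (2 * p) (2 * r) w, transp ρ b (2 * r) w'⟫_ℝ =
      ⟪transp ρ (2 * p) (2 * r) w, transp ρ (2 * q) (2 * r) w'⟫_ℝ := by
    rcases hb with rfl | rfl
    · rfl
    · refine inner_apply_eq (transp_isometry hρ _ _) (hw.flip q hq) (hw'.flip q hq)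
        (by rw [flip_mul_transp (by lia) (by lia) (by lia) (by lia) (by lia),
          Equiv.swap_apply_of_ne_of_ne (by lia) (by lia)])
        (by rw [flip_mul_transp (by lia) (by lia) (by lia) (by lia) (by lia),
          Equiv.swap_apply_right])
  rw [h1, h2, inner_transp_transp_const hρ hn hw hw' hp hq hr hpq hpr hqr]

/-- The first two moments of the Jucys–Murphy elements between edge-invariant vectors. -/
theorem inner_jm_eq (hρ : ∀ g x y, ⟪ρ g x, ρ g y⟫_ℝ = ⟪x, y⟫_ℝ) (hn : 2 * n ≤ N)
    (hw : IsEdgeInvariant ρ {p | p < n} w) (hw' : IsEdgeInvariant ρ {p | p < n} w') {j : ℕ}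
    (hj : j < n) :
    ⟪w, jm ρ (2 * j) w'⟫_ℝ = 2 * j * ⟪w, transp ρ 0 2 w'⟫_ℝ ∧
    ⟪jm ρ (2 * j) w, jm ρ (2 * j) w'⟫_ℝ = 2 * j * (⟪w, w'⟫_ℝ + ⟪w, transp ρ 0 2 w'⟫_ℝ) +
      2 * j * (2 * j - 2) * ⟪transp ρ 0 4 w, transp ρ 2 4 w'⟫_ℝ := by
  have h2j : 2 * j < N := by lia
  set τ := ⟪w, transp ρ 0 2 w'⟫_ℝ with hτ
  have ht : ∀ p < j, ⟪w, transp ρ (2 * p) (2 * j) w'⟫_ℝ = τ := fun p hp =>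
    inner_transp_const hρ hn hw hw' (by lia) hj hp.ne
  constructor
  · rw [jm, sum_range_two_mul, LinearMap.sum_apply, inner_sum, Finset.sum_congr rfl
      (g := fun _ => 2 * τ), Finset.sum_const, Finset.card_range]
    · simp; ring
    · intro p hp
      have hp := Finset.mem_range.1 hp
      rw [LinearMap.add_apply, inner_add_right, inner_transp_flip hρ hn hw hw' (p := p)
        (by simp; lia) (by lia) h2j (by lia) (by lia), ht p hp]
      ring
  · rw [jm, sum_range_two_mul, LinearMap.sum_apply, LinearMap.sum_apply, sum_inner]
    have : ∀ p ∈ Finset.range j, ⟪(transp ρ (2 * p) (2 * j) + transp ρ (2 * p + 1) (2 * j)) w,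
        ∑ q ∈ Finset.range j, (transp ρ (2 * q) (2 * j) + transp ρ (2 * q + 1) (2 * j)) w'⟫_ℝ =
        2 * (⟪w, w'⟫_ℝ + τ) + (2 * (2 * j - 2)) * ⟪transp ρ 0 4 w, transp ρ 2 4 w'⟫_ℝ := by
      intro p hp
      have hpj := Finset.mem_range.1 hp
      rw [inner_sum, ← Finset.add_sum_erase _ _ hp]
      congr 1
      · simp only [LinearMap.add_apply, inner_add_left, inner_add_right]
        rw [transp_isometry hρ, transp_isometry hρ,
          real_inner_comm (transp ρ (2 * p) (2 * j) w') (transp ρ (2 * p + 1) (2 * j) w),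
          inner_transp_mul_transp_flip hρ hn hw (by lia) h2j (by lia),
          inner_transp_mul_transp_flip hρ hn hw' (by lia) h2j (by lia),
          ← transp_symm hρ, real_inner_comm w, ht p hpj]
        ring
      · rw [Finset.sum_congr rfl (g := fun _ => 4 * ⟪transp ρ 0 4 w, transp ρ 2 4 w'⟫_ℝ),
          Finset.sum_const, Finset.card_erase_of_mem hp, Finset.card_range]
        · rw [nsmul_eq_mul, Nat.cast_sub (by lia)]; push_cast; ring
        · intro q hq
          have hqp := (Finset.mem_erase.1 hq).1
          have hqj := Finset.mem_range.1 (Finset.mem_erase.1 hq).2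
          simp only [LinearMap.add_apply, inner_add_left, inner_add_right]
          rw [inner_transp_mul_transp hρ hn hw hw' (p := p) (q := q) (by lia) (by lia) hj
              (by lia) (by lia) (by lia) (by lia) (by lia),
            inner_transp_mul_transp hρ hn hw hw' (p := p) (q := q) (by lia) (by lia) hj
              (by lia) (by lia) (by lia) (by lia) (by lia),
            inner_transp_mul_transp hρ hn hw hw' (p := p) (q := q) (by lia) (by lia) hj
              (by lia) (by lia) (by lia) (by lia) (by lia),
            inner_transp_mul_transp hρ hn hw hw' (p := p) (q := q) (by lia) (by lia) hj
              (by lia) (by lia) (by lia) (by lia) (by lia)]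
          ring
    rw [Finset.sum_congr rfl this, Finset.sum_const, Finset.card_range, nsmul_eq_mul]
    ring

/-- On vectors fixed by all flips, `jm (2 * j + 1)` acts as `jm (2 * j) + 1`. -/
theorem jm_odd_apply {w : V} (hw : IsEdgeInvariant ρ {p | p < n} w) (hn : 2 * n ≤ N) {j : ℕ}
    (hj : j < n) : jm ρ (2 * j + 1) w = jm ρ (2 * j) w + w := by
  rw [jm, Finset.sum_range_succ, jm, LinearMap.add_apply, hw.flip j hj, sum_range_two_mul,
    sum_range_two_mul, LinearMap.sum_apply, LinearMap.sum_apply]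
  congr 1
  refine Finset.sum_congr rfl fun p hp => ?_
  have hp := Finset.mem_range.1 hp
  set f := transp ρ (2 * j) (2 * j + 1) with hf
  have hfw : f w = w := hw.flip j hj
  have hcross : (transp ρ (2 * p) (2 * j + 1) * transp ρ (2 * p + 1) (2 * j)) w = w := by
    have e : f * edgeSwap ρ p j =
        transp ρ (2 * p) (2 * j + 1) * transp ρ (2 * p + 1) (2 * j) * f := by
      rw [edgeSwap, ← mul_assoc, hf,
        transp_mul_transp ρ (by lia) (by lia) (i := 2 * p) (j := 2 * j) (by lia) (by lia),
        mul_assoc,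
        transp_mul_transp ρ (by lia) (by lia) (i := 2 * p + 1) (j := 2 * j + 1) (by lia) (by lia),
        Equiv.swap_apply_left, Equiv.swap_apply_right,
        Equiv.swap_apply_of_ne_of_ne (by lia) (by lia),
        Equiv.swap_apply_of_ne_of_ne (by lia) (by lia), mul_assoc]
    have e1 := congrArg (fun g => g w) e
    simp only [Module.End.mul_apply, hfw, hw.swap p (show p < n by lia) j hj] at e1
    exact e1.symm
  have h1 : transp ρ (2 * p) (2 * j + 1) w = transp ρ (2 * p + 1) (2 * j) w := by
    have := congrArg (transp ρ (2 * p) (2 * j + 1)) hcross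
    rwa [Module.End.mul_apply, transp_transp_apply, eq_comm] at this
  have h2 : transp ρ (2 * p + 1) (2 * j + 1) w = transp ρ (2 * p) (2 * j) w := by
    have := congrArg (transp ρ (2 * p) (2 * j)) (hw.swap p (show p < n by lia) j hj)
    rwa [edgeSwap, Module.End.mul_apply, transp_transp_apply] at this
  rw [LinearMap.add_apply, LinearMap.add_apply, h1, h2, add_comm]

theorem jm_edgeSwap_succ (p : ℕ) (hp : 2 * p + 3 < N) :
    jm ρ (2 * p + 2) * edgeSwap ρ p (p + 1) = edgeSwap ρ p (p + 1) * jm ρ (2 * p) +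
      (transp ρ (2 * p) (2 * p + 2) + transp ρ (2 * p + 1) (2 * p + 2)) * edgeSwap ρ p (p + 1) := by
  rw [jm, Finset.sum_range_succ, Finset.sum_range_succ, add_assoc, add_mul, jm, Finset.mul_sum,
    Finset.sum_mul]
  congr 1
  refine Finset.sum_congr rfl fun i hi => ?_
  have hi := Finset.mem_range.1 hi
  rw [edgeSwap, mul_assoc,
    transp_mul_transp ρ (a := 2 * p + 1) (by lia) (by lia) (by lia) (by lia), ← mul_assoc,
    ← mul_assoc, transp_mul_transp ρ (a := 2 * p) (by lia) (by lia) _ _,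
    Equiv.swap_apply_of_ne_of_ne (a := 2 * p + 1) (by lia) (by lia),
    Equiv.swap_apply_of_ne_of_ne (a := 2 * p + 1) (by lia) (by lia),
    Equiv.swap_apply_of_ne_of_ne (a := 2 * p) (by lia) (by lia), Equiv.swap_apply_left]
  · rfl
  · rw [Equiv.swap_apply_of_ne_of_ne] <;> lia
  · rw [Equiv.swap_apply_of_ne_of_ne] <;> lia

theorem inner_jm_sub_jm (hρ : ∀ g x y, ⟪ρ g x, ρ g y⟫_ℝ = ⟪x, y⟫_ℝ) {p : ℕ}
    (hp : 2 * p + 3 < N) (hw : edgeSwap ρ p (p + 1) w = w) (hw' : edgeSwap ρ p (p + 1) w' = w') :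
    ⟪w, transp ρ (2 * p) (2 * p + 2) w'⟫_ℝ + ⟪w, transp ρ (2 * p + 1) (2 * p + 2) w'⟫_ℝ =
      ⟪w, jm ρ (2 * p + 2) w'⟫_ℝ - ⟪w, jm ρ (2 * p) w'⟫_ℝ := by
  have h := congrArg (fun f => ⟪w, f w'⟫_ℝ) (jm_edgeSwap_succ (ρ := ρ) p hp)
  simp only [Module.End.mul_apply, hw', LinearMap.add_apply, inner_add_right] at h
  have h1 := edgeSwap_isometry hρ p (p + 1) w (jm ρ (2 * p) w')
  rw [hw] at h1
  linarith

theorem jm_sub_jm_bounds (hρ : ∀ g x y, ⟪ρ g x, ρ g y⟫_ℝ = ⟪x, y⟫_ℝ) {p : ℕ}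
    (hp : 2 * p + 4 ≤ N) (hw : IsEdgeInvariant ρ {p, p + 1} w) :
    -⟪w, w⟫_ℝ ≤ ⟪w, jm ρ (2 * p + 2) w⟫_ℝ - ⟪w, jm ρ (2 * p) w⟫_ℝ ∧
      ⟪w, jm ρ (2 * p + 2) w⟫_ℝ - ⟪w, jm ρ (2 * p) w⟫_ℝ ≤ 2 * ⟪w, w⟫_ℝ := by
  have hsw := hw.swap p (by simp) (p + 1) (by simp)
  rw [← inner_jm_sub_jm hρ (by lia) hsw hsw]
  set s₁ := transp ρ (2 * p) (2 * p + 2) with hs₁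
  set s₂ := transp ρ (2 * p + 1) (2 * p + 2) with hs₂
  have h12 : ⟪w, s₂ w⟫_ℝ = ⟪w, s₁ w⟫_ℝ :=
    inner_transp_flip hρ (n := p + 1) (by lia) hw hw (by simp) (by lia) (by lia) (by lia) (by lia)
  have h3 : ⟪s₁ w, s₂ w⟫_ℝ = ⟪w, s₁ w⟫_ℝ := by
    rw [hs₁, transp_symm hρ, ← Module.End.mul_apply,
      transp_mul_transp ρ (by lia) (by lia) (by lia) (by lia), Equiv.swap_apply_right,
      Equiv.swap_apply_of_ne_of_ne (by lia) (by lia), Module.End.mul_apply,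
      transp_comm ρ (2 * p + 1), ← transp_symm hρ, hw.flip p (by simp)]
  have hn1 : ⟪s₁ w, s₁ w⟫_ℝ = ⟪w, w⟫_ℝ := transp_isometry hρ _ _ _ _
  have hn2 : ⟪s₂ w, s₂ w⟫_ℝ = ⟪w, w⟫_ℝ := transp_isometry hρ _ _ _ _
  have hA := real_inner_self_nonneg (x := w + s₁ w + s₂ w)
  have hB := real_inner_self_nonneg (x := w - s₁ w)
  simp only [inner_add_left, inner_add_right, inner_sub_left, inner_sub_right] at hA hB
  rw [real_inner_comm w (s₁ w), real_inner_comm w (s₂ w), real_inner_comm (s₁ w) (s₂ w)] at hA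
  rw [real_inner_comm w (s₁ w)] at hB
  constructor <;> linarith

end Relations

/-- The numerical data attached to the decomposition into joint eigenvectors of a vector fixed by
the stabiliser of the base matching: squared norms `m`, contents `c` of the dominoes, and the
common shape, whose `i`-th row consists of `R i` dominoes. -/
structure DominoModel (k : ℕ) (θ : ℝ) (ι : Type*) [Fintype ι] where
  /-- the squared norms of the components -/
  m : ι → ℝ
  /-- the contents of the dominoes -/
  c : ι → ℕ → ℤ
  /-- half of the row lengths of the shape -/
  R : ℕ → ℕ
  m_pos : ∀ T, 0 < m T
  fills : ∀ T, FillsByDominoes (c T) k R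
  moments : ∀ n ≤ k, ∀ φ : ι → ℝ,
    (∀ T T', (∀ j, n ≤ j → j < k → c T j = c T' j) → φ T = φ T') →
    ∃ τ σ : ℝ, ∀ j < n, ∑ T, c T j * φ T * m T = 2 * j * τ ∧
      ∑ T, (c T j : ℝ) ^ 2 * φ T * m T =
        2 * j * (∑ T, φ T * m T + τ) + 2 * j * (2 * j - 2) * σ
  exchange : ∀ φ : ι → ℝ, (∀ T T', (∀ j < k - 2, c T j = c T' j) → φ T = φ T') →
    -∑ T, φ T ^ 2 * m T ≤ ∑ T, ((c T (k - 1) : ℝ) - c T (k - 2)) * φ T ^ 2 * m T ∧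
      ∑ T, ((c T (k - 1) : ℝ) - c T (k - 2)) * φ T ^ 2 * m T ≤ 2 * ∑ T, φ T ^ 2 * m T
  eigenvalue : θ * (2 * k - 6).doubleFactorial * ∑ T, m T =
    ∑ T, (∏ j ∈ Finset.range (k - 3), (c T (j + 1) : ℝ)) *
      (c T (k - 2) * c T (k - 1) / 4 + k * c T (k - 2) +
        k * (k - 1) / 2 * (c T (k - 1) - c T (k - 2))) * m T

theorem FillsByDominoes.antitone {c : ℕ → ℤ} {n : ℕ} {R : ℕ → ℕ} (h : FillsByDominoes c n R) :
    Antitone R := by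
  induction h with
  | zero => exact fun _ _ _ => le_rfl
  | @succ n R i h hi hc ih =>
    refine antitone_nat_of_succ_le fun q => ?_
    have := ih (Nat.le_add_right q 1)
    simp only [Function.update_apply]
    split_ifs with h1 h2 h2
    · lia
    · subst h1
      simpa using hi
    · lia
    · exact this

theorem FillsByDominoes.eq_zero {c : ℕ → ℤ} {n : ℕ} {R : ℕ → ℕ} (h : FillsByDominoes c n R) :
    ∀ i, n ≤ i → R i = 0 := by
  induction h with
  | zero => exact fun _ _ => rfl
  | @succ n R i h hi hc ih =>
    intro q hq
    have hiq : q ≠ i := by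
      rintro rfl
      have := ih (q - 1) (by lia)
      lia
    rw [Function.update_of_ne hiq]
    exact ih q (by lia)

theorem FillsByDominoes.lt_of_eq_zero {c : ℕ → ℤ} {n : ℕ} {R : ℕ → ℕ} {i L : ℕ}
    (h : FillsByDominoes c n R) (hi : i = 0 ∨ R i < R (i - 1))
    (hL : Function.update R i (R i + 1) L = 0) : i < L ∧ R L = 0 := by
  have hne : L ≠ i := by
    rintro rfl
    simp at hL
  rw [Function.update_of_ne hne] at hL
  refine ⟨?_, hL⟩
  by_contra hcon
  have := h.antitone (show L ≤ i - 1 by lia)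
  lia

theorem FillsByDominoes.sum_eq {M : Type*} [AddCommMonoid M] (F : ℤ → M) {c : ℕ → ℤ} {n : ℕ}
    {R : ℕ → ℕ} (h : FillsByDominoes c n R) (L : ℕ) (hL : R L = 0) :
    ∑ j ∈ Finset.range n, F (c j) =
      ∑ i ∈ Finset.range L, ∑ j ∈ Finset.range (R i), F (2 * j - i) := by
  induction h with
  | zero => simp
  | @succ n R i h hi hc ih =>
    obtain ⟨hiL, hL⟩ := h.lt_of_eq_zero hi hL
    rw [Finset.sum_range_succ, ih hL, hc,
      ← Finset.add_sum_erase _ _ (Finset.mem_range.2 hiL),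
      ← Finset.add_sum_erase _ _ (Finset.mem_range.2 hiL), Function.update_self,
      Finset.sum_range_succ, add_right_comm]
    congr 1
    refine Finset.sum_congr rfl fun q hq => ?_
    rw [Function.update_of_ne (Finset.ne_of_mem_erase hq)]

/-- A shape filled by dominoes is determined by the multiset of contents of its cells. -/
theorem FillsByDominoes.shape_unique {c c' : ℕ → ℤ} {n : ℕ} {R R' : ℕ → ℕ}
    (h : FillsByDominoes c n R) (h' : FillsByDominoes c' n R')
    (hsum : ∀ f : ℤ → ℕ, ∑ j ∈ Finset.range n, (f (c j) + f (c j + 1)) =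
      ∑ j ∈ Finset.range n, (f (c' j) + f (c' j + 1))) : R = R' := by
  classical
  by_contra hne
  have hex : ∃ i, R i ≠ R' i := Function.ne_iff.1 hne
  wlog hlt : R (Nat.find hex) < R' (Nat.find hex) generalizing R R' c c'
  · have hex' : ∃ i, R' i ≠ R i := hex.imp fun i hi => hi.symm
    have heq : Nat.find hex' = Nat.find hex := by
      congr 1; ext i; exact ne_comm
    refine this h' h (fun f => (hsum f).symm) (Ne.symm hne) hex' ?_
    rw [heq]
    exact lt_of_le_of_ne (not_lt.1 hlt) (Nat.find_spec hex).symm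
  set i := Nat.find hex
  have hbefore : ∀ q < i, R q = R' q := fun q hq => not_not.1 (Nat.find_min hex hq)
  have hin : i < n := by
    by_contra hcon
    have := h'.eq_zero i (by lia)
    lia
  let f : ℤ → ℕ := fun y => if y = 2 * R' i - 1 - i then 1 else 0
  have h1 := h.sum_eq (fun y => f y + f (y + 1)) n (h.eq_zero n le_rfl)
  have h2 := h'.sum_eq (fun y => f y + f (y + 1)) n (h'.eq_zero n le_rfl)
  rw [hsum, h2] at h1
  have hsplit : ∀ S : ℕ → ℕ, ∑ q ∈ Finset.range n, S q =
      ∑ q ∈ Finset.range i, S q + S i + ∑ q ∈ Finset.Ico (i + 1) n, S q := fun S => by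
    rw [← Finset.sum_range_succ, Finset.sum_range_add_sum_Ico _ (by lia)]
  rw [hsplit, hsplit] at h1
  have e1 : ∑ q ∈ Finset.range i, ∑ j ∈ Finset.range (R q), (f (2 * j - q) + f (2 * j - q + 1)) =
      ∑ q ∈ Finset.range i, ∑ j ∈ Finset.range (R' q), (f (2 * j - q) + f (2 * j - q + 1)) :=
    Finset.sum_congr rfl fun q hq => by rw [hbefore q (Finset.mem_range.1 hq)]
  have e2 : ∑ j ∈ Finset.range (R i), (f (2 * j - i) + f (2 * j - i + 1)) = 0 := by
    refine Finset.sum_eq_zero fun j hj => ?_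
    have := Finset.mem_range.1 hj
    simp only [f]
    rw [if_neg (by lia), if_neg (by lia), add_zero]
  have e3 : ∑ q ∈ Finset.Ico (i + 1) n,
      ∑ j ∈ Finset.range (R q), (f (2 * j - q) + f (2 * j - q + 1)) = 0 := by
    refine Finset.sum_eq_zero fun q hq => Finset.sum_eq_zero fun j hj => ?_
    have := Finset.mem_range.1 hj
    have hq := Finset.mem_Ico.1 hq
    have := h.antitone (show i ≤ q by lia)
    simp only [f]
    rw [if_neg (by lia), if_neg (by lia), add_zero]
  have e4 : 1 ≤ ∑ j ∈ Finset.range (R' i), (f (2 * j - i) + f (2 * j - i + 1)) := by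
    refine le_trans ?_ (Finset.single_le_sum (f := fun j : ℕ => f (2 * j - i) + f (2 * j - i + 1))
      (fun _ _ => Nat.zero_le _) (Finset.mem_range.2 (show R' i - 1 < R' i by lia)))
    have : f (2 * ((R' i - 1 : ℕ) : ℤ) - i + 1) = 1 := by
      simp only [f]; rw [if_pos (by push_cast [show 1 ≤ R' i by lia]; ring)]
    simp only [this]; lia
  lia

section

open scoped InnerProductSpace

variable {V : Type*} [NormedAddCommGroup V] [InnerProductSpace ℝ V] {N : ℕ} [NeZero N]
  {ρ : Equiv.Perm (Fin N) →* Module.End ℝ V}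

/-- The product of the Jucys–Murphy elements of index `2, 4, …, 2 * n`. -/
def jmProd {V : Type*} [AddCommGroup V] [Module ℝ V] {N : ℕ} [NeZero N]
    (ρ : Equiv.Perm (Fin N) →* Module.End ℝ V) : ℕ → Module.End ℝ V
  | 0 => 1
  | n + 1 => jm ρ (2 * (n + 1)) * jmProd ρ n

namespace JMDecomp

variable {v : V} {ι : Type*} [Fintype ι] (D : JMDecomp ρ v ι)

theorem jmProd_apply (n : ℕ) (hn : 2 * n < N) :
    jmProd ρ n v = D.comb (fun T => ∏ j ∈ Finset.range n, D.c T (2 * (j + 1))) := by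
  induction n with
  | zero => rw [jmProd, Module.End.one_apply]; exact D.comb_one.symm
  | succ n ih =>
    rw [jmProd, Module.End.mul_apply, ih (by lia), D.jm_comb _ hn]
    simp only [Finset.prod_range_succ, mul_comm]

theorem inner_v_comb (φ : ι → ℝ) : ⟪v, D.comb φ⟫_ℝ = D.E φ := by
  have h := D.inner_comb 1 φ
  rwa [D.comb_one, one_mul] at h

theorem c_odd {k : ℕ} (hk : 2 * k ≤ N) (hv : IsEdgeInvariant ρ {p | p < k} v) (T : ι) {j : ℕ}
    (hj : j < k) : D.c T (2 * j + 1) = D.c T (2 * j) + 1 := by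
  have h := jm_odd_apply hv hk hj
  rw [← D.comb_one, D.jm_comb _ (by lia), D.jm_comb _ (by lia)] at h
  set φ : ι → ℝ := fun T => D.c T (2 * j + 1) - (D.c T (2 * j) + 1) with hφ
  have h0 : D.comb φ = 0 := by
    rw [← sub_eq_zero.2 h]
    simp only [comb, hφ, Pi.one_apply, ← Finset.sum_add_distrib, ← Finset.sum_sub_distrib]
    exact Finset.sum_congr rfl fun T _ => by module
  have h1 : D.E (φ * φ) = 0 := by rw [← inner_comb, h0, inner_zero_left]
  have h2 := (Finset.sum_eq_zero_iff_of_nonneg fun T _ =>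
    mul_nonneg (mul_self_nonneg (φ T)) (D.inner_self_pos T).le).1 h1 T (Finset.mem_univ T)
  have h3 := mul_self_eq_zero.1 ((mul_eq_zero.1 h2).resolve_right (D.inner_self_pos T).ne')
  exact sub_eq_zero.1 h3

theorem isEdgeInvariant_comb (hρ : ∀ g x y, ⟪ρ g x, ρ g y⟫_ℝ = ⟪x, y⟫_ℝ) {S I : Set ℕ}
    (hv : IsEdgeInvariant ρ S v) (hS : ∀ p ∈ S, 2 * p + 1 < N)
    (hI : ∀ i ∈ I, i < N ∧ ((∀ p ∈ S, i < 2 * p) ∨ (∀ p ∈ S, 2 * p + 1 < i))) {φ : ι → ℝ}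
    (hφ : ∀ T T', (∀ i ∈ I, D.c T i = D.c T' i) → φ T = φ T') :
    IsEdgeInvariant ρ S (D.comb φ) := by
  have hcomm : ∀ p ∈ S, ∀ q ∈ S, ∀ a b : ℕ, (a = 2 * p ∨ a = 2 * p + 1) →
      (b = 2 * q ∨ b = 2 * q + 1) → ∀ i ∈ I, Commute (transp ρ a b) (jm ρ i) := by
    intro p hp q hq a b ha hb i hi
    have h1 := hS p hp
    have h2 := hS q hq
    rcases (hI i hi).2 with h | h
    · have := h p hp
      have := h q hq
      exact transp_mul_jm_of_gt ρ (by lia) (by lia) (by lia) (by lia)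
    · have := h p hp
      have := h q hq
      exact transp_mul_jm ρ (by lia) (by lia) (hI i hi).1
  refine ⟨fun p hp => ?_, fun p hp q hq => ?_⟩
  · exact D.apply_comb hρ (fun i hi => (hI i hi).1)
      (hcomm p hp p hp _ _ (Or.inl rfl) (Or.inr rfl)) (hv.flip p hp) hφ
  · have he : edgeSwap ρ p q = ρ (Equiv.swap (Fin.ofNat N (2 * p)) (Fin.ofNat N (2 * q)) *
        Equiv.swap (Fin.ofNat N (2 * p + 1)) (Fin.ofNat N (2 * q + 1))) := by
      rw [map_mul]; rfl
    have hs := hv.swap p hp q hq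
    rw [he] at hs ⊢
    refine D.apply_comb hρ (fun i hi => (hI i hi).1) (fun i hi => ?_) hs hφ
    rw [map_mul]
    exact (hcomm p hp q hq _ _ (Or.inl rfl) (Or.inl rfl) i hi).mul_left
      (hcomm p hp q hq _ _ (Or.inr rfl) (Or.inr rfl) i hi)

theorem exists_dominoModel (hρ : ∀ g x y, ⟪ρ g x, ρ g y⟫_ℝ = ⟪x, y⟫_ℝ)
    (hirr : ∀ U : Submodule ℝ V, (∀ g, ∀ x ∈ U, ρ g x ∈ U) → U = ⊥ ∨ U = ⊤) {k : ℕ} (hk : 3 ≤ k)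
    (hN : 2 * k = N) (hv : IsEdgeInvariant ρ {p | p < k} v) [Nonempty ι] {θ : ℝ}
    (hθ : θ * (2 * k - 6).doubleFactorial * ⟪v, v⟫_ℝ =
      1 / 4 * ⟪v, jmProd ρ (k - 1) v⟫_ℝ + k * ⟪v, jmProd ρ (k - 2) v⟫_ℝ + k * (k - 1) / 2 *
        (⟪v, transp ρ (2 * (k - 2)) (2 * (k - 2) + 2) (jmProd ρ (k - 3) v)⟫_ℝ +
          ⟪v, transp ρ (2 * (k - 2) + 1) (2 * (k - 2) + 2) (jmProd ρ (k - 3) v)⟫_ℝ)) :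
    ∃ Mo : DominoModel k θ ι, ∀ T, ∀ j < k, D.c T (2 * j) = Mo.c T j ∧
      D.c T (2 * j + 1) = Mo.c T j + 1 := by
  have hz : ∀ T, ∃ z : ℕ → ℤ, (∀ q < N, D.c T q = z q) ∧ IsContentVector N z := fun T =>
    IsJMSpec.isContentVector hρ ⟨D.u T, D.ne_zero T, D.eigen T⟩
  choose z hz hzc using hz
  have hodd : ∀ T, ∀ j < k, z T (2 * j + 1) = z T (2 * j) + 1 := fun T j hj => by
    have := D.c_odd hN.le hv T hj
    rw [hz T _ (by lia), hz T _ (by lia)] at this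
    exact_mod_cast this
  have hR := fun T => (hzc T).fillsByDominoes hN.le (hodd T)
  choose R hR _ using hR
  have hsame : ∀ T T', R T = R T' := fun T T' => by
    refine (hR T).shape_unique (hR T') fun f => ?_
    have h := D.sum_content_eq hirr T T' (fun y => (f ⌊y⌋ : ℝ))
    have hs : ∀ T, ∑ i ∈ Finset.range N, (f ⌊D.c T i⌋ : ℝ) =
        ((∑ j ∈ Finset.range k, (f (z T (2 * j)) + f (z T (2 * j) + 1)) : ℕ) : ℝ) := fun T => by
      have h2 := sum_range_two_mul (fun i => (f ⌊D.c T i⌋ : ℝ)) k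
      rw [hN] at h2
      rw [h2]
      push_cast
      refine Finset.sum_congr rfl fun j hj => ?_
      have hj := Finset.mem_range.1 hj
      rw [hz T _ (by lia), hz T _ (by lia), Int.floor_intCast, Int.floor_intCast, hodd T j hj]
    rw [hs, hs] at h
    exact_mod_cast h
  have hc : ∀ T, ∀ j < k, D.c T (2 * j) = z T (2 * j) := fun T j hj => hz T _ (by lia)
  have hE : ∀ φ : ι → ℝ, D.E φ = ∑ T, φ T * ⟪D.u T, D.u T⟫_ℝ := fun _ => rfl
  refine ⟨{
    m := fun T => ⟪D.u T, D.u T⟫_ℝ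
    c := fun T j => z T (2 * j)
    R := R (Classical.arbitrary ι)
    m_pos := D.inner_self_pos
    fills := fun T => by rw [hsame _ T]; exact hR T
    moments := ?_, exchange := ?_, eigenvalue := ?_ }, fun T j hj => ⟨hc T j hj, ?_⟩⟩
  · intro n hn φ hφ
    have hw := D.isEdgeInvariant_comb hρ (S := {p | p < n})
      (I := {i | ∃ j, n ≤ j ∧ j < k ∧ i = 2 * j})
      (φ := φ) (hv.mono fun p hp => lt_of_lt_of_le hp hn)
      (fun p hp => by have : p < n := hp; lia)
      (by
        rintro i ⟨j, hj, hjk, rfl⟩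
        exact ⟨by lia, Or.inr fun p hp => by have : p < n := hp; lia⟩)
      (fun T T' h => hφ T T' fun j hj hjk => by
        have := h (2 * j) ⟨j, hj, hjk, rfl⟩
        rw [hc T j hjk, hc T' j hjk] at this
        exact_mod_cast this)
    refine ⟨⟪v, transp ρ 0 2 (D.comb φ)⟫_ℝ,
      ⟪transp ρ 0 4 v, transp ρ 2 4 (D.comb φ)⟫_ℝ, fun j hj => ?_⟩
    obtain ⟨e1, e2⟩ := inner_jm_eq hρ (by lia : 2 * n ≤ N)
      (hv.mono fun p (hp : p < n) => lt_of_lt_of_le hp hn) hw hj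
    rw [← jm_symm hρ] at e1
    rw [D.inner_v_comb] at e2
    have hjv : jm ρ (2 * j) v = D.comb (fun T => D.c T (2 * j)) := by
      have h := D.jm_comb 1 (show 2 * j < N by lia)
      rw [D.comb_one] at h
      rw [h]; simp
    rw [hjv, D.inner_comb, hE] at e1
    rw [hjv, D.jm_comb _ (by lia), D.inner_comb, hE, hE] at e2
    constructor
    · rw [← e1]
      exact Finset.sum_congr rfl fun T _ => by simp [hc T j (by lia)]
    · rw [← e2]
      exact Finset.sum_congr rfl fun T _ => by simp only [hc T j (by lia), Pi.mul_apply]; ring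
  · intro φ hφ
    have hS : ∀ p ∈ ({k - 2, k - 2 + 1} : Set ℕ), p = k - 2 ∨ p = k - 1 := fun p hp => by
      rcases hp with h | h
      · exact Or.inl h
      · rw [Set.mem_singleton_iff] at h; lia
    have hw := D.isEdgeInvariant_comb hρ (S := {k - 2, k - 2 + 1})
      (I := {i | ∃ j < k - 2, i = 2 * j}) (φ := φ)
      (hv.mono fun p hp => by have := hS p hp; simp only [Set.mem_ofPred_eq]; lia)
      (fun p hp => by have := hS p hp; lia)
      (by
        rintro i ⟨j, hj, rfl⟩
        exact ⟨by lia, Or.inl fun p hp => by have := hS p hp; lia⟩)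
      (fun T T' h => hφ T T' fun j hj => by
        have := h (2 * j) ⟨j, hj, rfl⟩
        rw [hc T j (by lia), hc T' j (by lia)] at this
        exact_mod_cast this)
    have hb := jm_sub_jm_bounds hρ (by lia) hw
    rw [D.jm_comb _ (by lia), D.jm_comb _ (by lia), D.inner_comb, D.inner_comb, D.inner_comb, hE,
      hE, hE, ← Finset.sum_sub_distrib] at hb
    have e1 : ∑ T, φ T ^ 2 * ⟪D.u T, D.u T⟫_ℝ = ∑ T, (φ * φ) T * ⟪D.u T, D.u T⟫_ℝ :=
      Finset.sum_congr rfl fun T _ => by simp only [Pi.mul_apply]; ring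
    rw [e1]
    convert hb using 2 <;>
    · refine Finset.sum_congr rfl fun T _ => ?_
      simp only [Pi.mul_apply]
      rw [show 2 * (k - 2) + 2 = 2 * (k - 1) by lia, hc T _ (by lia), hc T _ (by lia)]
      ring
  · have hX : IsEdgeInvariant ρ {k - 2, k - 2 + 1} (jmProd ρ (k - 3) v) := by
      have hS : ∀ p ∈ ({k - 2, k - 2 + 1} : Set ℕ), p = k - 2 ∨ p = k - 1 := fun p hp => by
        rcases hp with h | h
        · exact Or.inl h
        · rw [Set.mem_singleton_iff] at h; lia
      rw [D.jmProd_apply _ (by lia)]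
      refine D.isEdgeInvariant_comb hρ (I := {i | i < 2 * (k - 2)})
        (hv.mono fun p hp => by have := hS p hp; simp only [Set.mem_ofPred_eq]; lia)
        (fun p hp => by have := hS p hp; lia)
        (fun i (hi : i < 2 * (k - 2)) => ⟨by lia, Or.inl fun p hp => by have := hS p hp; lia⟩)
        (fun T T' h => Finset.prod_congr rfl fun j hj => h _ ?_)
      have := Finset.mem_range.1 hj
      simp only [Set.mem_ofPred_eq]; lia
    rw [inner_jm_sub_jm hρ (by lia)
      (hv.swap _ (by simp only [Set.mem_ofPred_eq]; lia) _ (by simp only [Set.mem_ofPred_eq]; lia))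
      (hX.swap _ (by simp) _ (by simp)),
      D.jmProd_apply _ (by lia), D.jmProd_apply _ (by lia), D.jmProd_apply _ (by lia),
      D.jm_comb _ (by lia), D.jm_comb _ (by lia), D.inner_v_comb, D.inner_v_comb, D.inner_v_comb,
      D.inner_v_comb, hE, hE, hE, hE] at hθ
    have hvv : ⟪v, v⟫_ℝ = ∑ T, ⟪D.u T, D.u T⟫_ℝ := by
      have h := D.inner_comb 1 1
      rw [D.comb_one, hE] at h
      rw [h]; simp
    rw [← hvv, hθ, Finset.mul_sum, Finset.mul_sum, ← Finset.sum_sub_distrib, Finset.mul_sum,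
      ← Finset.sum_add_distrib, ← Finset.sum_add_distrib]
    refine Finset.sum_congr rfl fun T _ => ?_
    have hp : ∏ j ∈ Finset.range (k - 3), D.c T (2 * (j + 1)) =
        ∏ j ∈ Finset.range (k - 3), (z T (2 * (j + 1)) : ℝ) :=
      Finset.prod_congr rfl fun j hj => hc T _ (by have := Finset.mem_range.1 hj; lia)
    rw [show k - 1 = k - 3 + 1 + 1 by lia, show k - 2 = k - 3 + 1 by lia,
      Finset.prod_range_succ, Finset.prod_range_succ, hp, hc T _ (by lia), hc T _ (by lia),
      show 2 * (k - 3 + 1) + 2 = 2 * (k - 3 + 1 + 1) by ring, hc T _ (by lia)]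
    ring
  · rw [hz T _ (by lia), hodd T j hj]; push_cast; ring

end JMDecomp

end

namespace FillsByDominoes

variable {c : ℕ → ℤ} {n : ℕ} {R : ℕ → ℕ}

theorem prod_eq (h : FillsByDominoes c n R) (L : ℕ) (hL : R (L + 1) = 0) :
    ∏ j ∈ Finset.Ico 1 n, (c j : ℝ) = (2 * (R 0 - 1)).doubleFactorial *
      ∏ i ∈ Finset.range L, ∏ j ∈ Finset.range (R (i + 1)), (2 * (j : ℝ) - (i + 1)) := by
  induction h with
  | zero => simp
  | @succ n R i h hi hc ih =>
    obtain ⟨hiL, hL⟩ := h.lt_of_eq_zero hi hL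
    rcases Nat.eq_zero_or_pos n with rfl | hn
    · have h0 : R = 0 := by cases h; rfl
      subst h0
      have : i = 0 := by simpa using hi
      subst this
      simp
    have hR0 : 1 ≤ R 0 := by
      by_contra hcon
      have h1 := h.sum_eq (fun _ => (1 : ℕ)) 0 (by lia)
      simp at h1; lia
    rw [Finset.prod_Ico_succ_top hn, ih hL, hc]
    rcases Nat.eq_zero_or_pos i with rfl | hi0
    · rw [Function.update_self, Nat.add_sub_cancel]
      obtain ⟨r, hr⟩ : ∃ r, R 0 = r + 1 := ⟨R 0 - 1, by lia⟩
      rw [hr, show 2 * (r + 1 - 1) = 2 * r by lia, show 2 * (r + 1) = 2 * r + 2 by ring,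
        Nat.doubleFactorial_add_two]
      simp only [Function.update_of_ne (Nat.succ_ne_zero _)]
      push_cast; ring
    · obtain ⟨q, rfl⟩ : ∃ q, i = q + 1 := ⟨i - 1, by lia⟩
      rw [Function.update_of_ne (by lia), mul_assoc]
      congr 1
      have hqL : q ∈ Finset.range L := Finset.mem_range.2 (by lia)
      rw [← Finset.mul_prod_erase _ _ hqL, ← Finset.mul_prod_erase _ _ hqL, Function.update_self,
        Finset.prod_range_succ, mul_right_comm]
      push_cast
      congr 1
      refine Finset.prod_congr rfl fun p hp => ?_
      rw [Function.update_of_ne (by have := Finset.ne_of_mem_erase hp; lia)]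

theorem pred (h : FillsByDominoes c (n + 1) R) :
    ∃ i, 1 ≤ R i ∧ R (i + 1) < R i ∧ c n = 2 * (R i - 1 : ℤ) - i ∧
      FillsByDominoes c n (Function.update R i (R i - 1)) := by
  have hanti := h.antitone
  cases h with
  | @succ _ R i h hi hc =>
    refine ⟨i, by simp, ?_, by simp [hc], by simpa using h⟩
    have := h.antitone (Nat.le_add_right i 1)
    simp; lia

theorem sum_rows (h : FillsByDominoes c n R) (L : ℕ) (hL : R L = 0) :
    ∑ i ∈ Finset.range L, R i = n := by
  simpa using (h.sum_eq (fun _ => (1 : ℕ)) L hL).symm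

theorem row_zero_add_index_le (h : FillsByDominoes c n R) : ∀ i, 1 ≤ R i → R 0 + i ≤ n := by
  induction h with
  | zero => simp
  | @succ n R i h hi hc ih =>
    intro q hq
    have h0 := ih 0
    have hq' := ih q
    have hi' := ih (i - 1)
    simp only [Function.update_apply] at hq ⊢
    split_ifs at hq ⊢ <;> lia

theorem row_zero_add_row_le (h : FillsByDominoes c n R) : ∀ i, 1 ≤ i → R 0 + R i ≤ n := by
  intro i hi
  have h1 := h.sum_rows (i + 1 + n) (h.eq_zero _ (by lia))
  have h2 : ∑ q ∈ ({0, i} : Finset ℕ), R q ≤ ∑ q ∈ Finset.range (i + 1 + n), R q :=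
    Finset.sum_le_sum_of_subset (by
      intro q hq
      simp only [Finset.mem_insert, Finset.mem_singleton] at hq
      rw [Finset.mem_range]; lia)
  rw [Finset.sum_pair (by lia)] at h2
  lia

theorem row_four_eq_zero (h : FillsByDominoes c n R) (hR : n ≤ R 0 + 3) : R 4 = 0 := by
  by_contra hcon
  have := h.row_zero_add_index_le 4 (by lia)
  lia

end FillsByDominoes

namespace DominoModel

variable {k : ℕ} {θ : ℝ} {ι : Type*} [Fintype ι] (D : DominoModel k θ ι)

theorem sum_m_pos [Nonempty ι] : 0 < ∑ T, D.m T :=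
  Finset.sum_pos (fun T _ => D.m_pos T) Finset.univ_nonempty

theorem sum_linear {κ : Type*} (s : Finset κ) (φ : ι → ℝ) (f : κ → ι → ℝ) :
    ∑ T, (∑ j ∈ s, f j T) * φ T * D.m T = ∑ j ∈ s, ∑ T, f j T * φ T * D.m T := by
  rw [Finset.sum_comm]
  simp only [Finset.sum_mul]

theorem sum_two_mul_range (n : ℕ) : ∑ j ∈ Finset.range n, 2 * (j : ℝ) = n * (n - 1) := by
  induction n with
  | zero => simp
  | succ n ih => rw [Finset.sum_range_succ, ih]; push_cast; ring

theorem sum_two_mul_mul_range (n : ℕ) :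
    3 * ∑ j ∈ Finset.range n, 2 * (j : ℝ) * (2 * j - 2) = 4 * (n * (n - 1) * (n - 2)) := by
  induction n with
  | zero => simp
  | succ n ih => rw [Finset.sum_range_succ, mul_add, ih]; push_cast; ring

/-- The first two moments of the content of a domino, in terms of the sums of the contents and of
their squares. -/
theorem moment_relations {n : ℕ} (hn : n + 1 ≤ k) (φ : ι → ℝ)
    (hφ : ∀ T T', (∀ j, n + 1 ≤ j → j < k → D.c T j = D.c T' j) → φ T = φ T') :
    ∑ T, ((n + 1) * D.c T n - 2 * ∑ j ∈ Finset.range (n + 1), (D.c T j : ℝ)) * φ T * D.m T = 0 ∧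
    ∑ T, ((n + 1) * (D.c T n : ℝ) ^ 2 - 3 * ∑ j ∈ Finset.range (n + 1), (D.c T j : ℝ) ^ 2 +
      ∑ j ∈ Finset.range (n + 1), (D.c T j : ℝ) + (n + 1) * n) * φ T * D.m T = 0 := by
  obtain ⟨τ, σ, h⟩ := D.moments (n + 1) hn φ hφ
  have e1 := (h n (by lia)).1
  have e2 := (h n (by lia)).2
  have e3 : ∑ T, (∑ j ∈ Finset.range (n + 1), (D.c T j : ℝ)) * φ T * D.m T = (n + 1) * n * τ := by
    rw [D.sum_linear _ _ fun j T => (D.c T j : ℝ),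
      Finset.sum_congr rfl fun j hj => (h j (Finset.mem_range.1 hj)).1, ← Finset.sum_mul,
      sum_two_mul_range]
    push_cast; ring
  have e4 : 3 * ∑ T, (∑ j ∈ Finset.range (n + 1), (D.c T j : ℝ) ^ 2) * φ T * D.m T =
      3 * ((n + 1) * n * (∑ T, φ T * D.m T + τ)) + 4 * ((n + 1) * n * (n - 1) * σ) := by
    rw [D.sum_linear _ _ fun j T => (D.c T j : ℝ) ^ 2,
      Finset.sum_congr rfl fun j hj => (h j (Finset.mem_range.1 hj)).2, Finset.sum_add_distrib,
      ← Finset.sum_mul, ← Finset.sum_mul, sum_two_mul_range, mul_add, ← mul_assoc 3 _ σ,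
      sum_two_mul_mul_range]
    push_cast; ring
  constructor
  · have : ∀ T, ((n + 1) * D.c T n - 2 * ∑ j ∈ Finset.range (n + 1), (D.c T j : ℝ)) * φ T * D.m T =
        (n + 1) * (D.c T n * φ T * D.m T) -
          2 * ((∑ j ∈ Finset.range (n + 1), (D.c T j : ℝ)) * φ T * D.m T) := fun T => by ring
    simp only [this, Finset.sum_sub_distrib, ← Finset.mul_sum]
    rw [e1, e3]; ring
  · have : ∀ T, ((n + 1) * (D.c T n : ℝ) ^ 2 - 3 * ∑ j ∈ Finset.range (n + 1), (D.c T j : ℝ) ^ 2 +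
        ∑ j ∈ Finset.range (n + 1), (D.c T j : ℝ) + (n + 1) * n) * φ T * D.m T =
        (n + 1) * ((D.c T n : ℝ) ^ 2 * φ T * D.m T) -
          3 * ((∑ j ∈ Finset.range (n + 1), (D.c T j : ℝ) ^ 2) * φ T * D.m T) +
          ((∑ j ∈ Finset.range (n + 1), (D.c T j : ℝ)) * φ T * D.m T) +
          (n + 1) * n * (φ T * D.m T) := fun T => by ring
    simp only [this, Finset.sum_sub_distrib, Finset.sum_add_distrib, ← Finset.mul_sum]
    rw [e2, e3, e4]; ring

/-- The eigenvalue is determined by any expression of the summand as a constant plus a combination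
of the moment relations. -/
theorem eigenvalue_eq [Nonempty ι] (hk : 3 ≤ k) {α C₁ C₂ t u₀ u₁ u₂ u₃ u₄ : ℝ}
    (hC₁ : ∀ T, ∑ j ∈ Finset.range k, (D.c T j : ℝ) = C₁)
    (hC₂ : ∀ T, ∑ j ∈ Finset.range k, (D.c T j : ℝ) ^ 2 = C₂)
    (hα : ∀ T, ∏ j ∈ Finset.Ico 1 k, (D.c T j : ℝ) = α * (2 * k - 6).doubleFactorial)
    (h : ∀ T, ∀ a b : ℝ, a = D.c T (k - 2) → b = D.c T (k - 1) → a ≠ 0 ∧ b ≠ 0 ∧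
      α * (1 / 4 + k / b + k * (k - 1) / 2 * (1 / a - 1 / b)) = t + u₀ * (k * b - 2 * C₁) +
        u₁ * ((k - 1) * a - 2 * (C₁ - b)) + u₂ * (((k - 1) * a - 2 * (C₁ - b)) * b) +
        u₃ * (k * b ^ 2 - 3 * C₂ + C₁ + k * (k - 1)) +
        u₄ * ((k - 1) * a ^ 2 - 3 * (C₂ - b ^ 2) + (C₁ - b) + (k - 1) * (k - 2))) : θ = t := by
  obtain ⟨p, rfl⟩ : ∃ p, k = p + 3 := ⟨k - 3, by lia⟩
  simp only [show p + 3 - 2 = p + 1 by lia, show p + 3 - 1 = p + 2 by lia] at h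
  have hE := D.eigenvalue
  simp only [show p + 3 - 2 = p + 1 by lia, show p + 3 - 1 = p + 2 by lia,
    show p + 3 - 3 = p by lia] at hE
  obtain ⟨r1, r4⟩ := D.moment_relations (n := p + 2) (by lia) (fun _ => 1) (fun _ _ _ => rfl)
  obtain ⟨r2, r5⟩ := D.moment_relations (n := p + 1) (by lia) (fun _ => 1) (fun _ _ _ => rfl)
  obtain ⟨r3, -⟩ := D.moment_relations (n := p + 1) (by lia) (fun T => D.c T (p + 2))
    (fun T T' h => by exact_mod_cast h (p + 2) (by lia) (by lia))
  set w : ℝ := ((2 * (p + 3) - 6).doubleFactorial : ℝ) with hw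
  have hw0 : w ≠ 0 := by rw [hw]; exact_mod_cast (Nat.doubleFactorial_pos _).ne'
  have key : ∀ T, (∏ j ∈ Finset.range p, (D.c T (j + 1) : ℝ)) *
      (D.c T (p + 1) * D.c T (p + 2) / 4 + (p + 3 : ℕ) * D.c T (p + 1) +
        (p + 3 : ℕ) * ((p + 3 : ℕ) - 1) / 2 * (D.c T (p + 2) - D.c T (p + 1))) * D.m T =
      t * w * D.m T + w * (
        u₀ * ((((p + 2 : ℕ) + 1) * D.c T (p + 2) -
          2 * ∑ j ∈ Finset.range (p + 2 + 1), (D.c T j : ℝ)) * 1 * D.m T) +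
        u₁ * ((((p + 1 : ℕ) + 1) * D.c T (p + 1) -
          2 * ∑ j ∈ Finset.range (p + 1 + 1), (D.c T j : ℝ)) * 1 * D.m T) +
        u₂ * ((((p + 1 : ℕ) + 1) * D.c T (p + 1) -
          2 * ∑ j ∈ Finset.range (p + 1 + 1), (D.c T j : ℝ)) * D.c T (p + 2) * D.m T) +
        u₃ * ((((p + 2 : ℕ) + 1) * (D.c T (p + 2) : ℝ) ^ 2 -
          3 * ∑ j ∈ Finset.range (p + 2 + 1), (D.c T j : ℝ) ^ 2 +
          ∑ j ∈ Finset.range (p + 2 + 1), (D.c T j : ℝ) + ((p + 2 : ℕ) + 1) * (p + 2 : ℕ)) *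
            1 * D.m T) +
        u₄ * ((((p + 1 : ℕ) + 1) * (D.c T (p + 1) : ℝ) ^ 2 -
          3 * ∑ j ∈ Finset.range (p + 1 + 1), (D.c T j : ℝ) ^ 2 +
          ∑ j ∈ Finset.range (p + 1 + 1), (D.c T j : ℝ) + ((p + 1 : ℕ) + 1) * (p + 1 : ℕ)) *
            1 * D.m T)) := by
    intro T
    obtain ⟨ha, hb, hT⟩ := h T _ _ rfl rfl
    have h1 := hC₁ T
    have h2 := hC₂ T
    have h3 := hα T
    rw [Finset.prod_Ico_eq_prod_range, show p + 3 - 1 = p + 1 + 1 by lia, Finset.prod_range_succ,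
      Finset.prod_range_succ] at h3
    simp only [add_comm 1] at h3
    rw [Finset.sum_range_succ] at h1 h2
    simp only [show p + 2 + 1 = p + 3 by ring, hC₁, hC₂, show p + 1 + 1 = p + 2 by ring] at h3 ⊢
    rw [eq_sub_of_add_eq h1, eq_sub_of_add_eq h2]
    set a : ℝ := (D.c T (p + 1) : ℝ)
    set b : ℝ := (D.c T (p + 2) : ℝ)
    set X : ℝ := ∏ j ∈ Finset.range p, (D.c T (j + 1) : ℝ)
    have h4 : X * (a * b / 4 + (p + 3 : ℕ) * a + (p + 3 : ℕ) * ((p + 3 : ℕ) - 1) / 2 * (b - a)) =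
        (X * a * b) * (1 / 4 + (p + 3 : ℕ) / b +
          (p + 3 : ℕ) * ((p + 3 : ℕ) - 1) / 2 * (1 / a - 1 / b)) := by
      field_simp
    rw [h4, h3, mul_right_comm α, hT]
    push_cast
    ring
  rw [Finset.sum_congr rfl fun T _ => key T, Finset.sum_add_distrib, ← Finset.mul_sum,
    ← Finset.mul_sum] at hE
  simp only [Finset.sum_add_distrib, ← Finset.mul_sum] at hE
  rw [r1, r2, r3, r4, r5] at hE
  have hm := D.sum_m_pos
  simp only [mul_zero, add_zero] at hE
  exact mul_right_cancel₀ hw0 (mul_right_cancel₀ hm.ne' hE)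

end DominoModel

theorem sum_two_mul_sq_range (n : ℕ) :
    ∑ j ∈ Finset.range n, (2 * (j : ℝ)) ^ 2 = 2 / 3 * ((n : ℝ) * (n - 1) * (2 * n - 1)) := by
  induction n with
  | zero => simp
  | succ n ih => rw [Finset.sum_range_succ, ih]; push_cast; ring

theorem FillsByDominoes.last_two {c : ℕ → ℤ} {n : ℕ} {R : ℕ → ℕ}
    (h : FillsByDominoes c (n + 2) R) (hR : R 4 = 0) :
    ∃ i < 4, ∃ i' < 4, R (i + 1) < R i ∧ c (n + 1) = 2 * (R i - 1 : ℤ) - i ∧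
      Function.update R i (R i - 1) (i' + 1) < Function.update R i (R i - 1) i' ∧
      c n = 2 * (Function.update R i (R i - 1) i' - 1 : ℤ) - i' := by
  obtain ⟨i, h1, h2, h3, h4⟩ := h.pred
  obtain ⟨i', h1', h2', h3', h4'⟩ := h4.pred
  have hR' : Function.update R i (R i - 1) 4 = 0 := by
    rw [Function.update_apply]; split_ifs with h <;> simp_all
  refine ⟨i, ?_, i', ?_, h2, h3, h2', h3'⟩
  · by_contra hcon
    have := h.antitone (show 4 ≤ i by lia)
    lia
  · by_contra hcon
    have := h4.antitone (show 4 ≤ i' by lia)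
    lia

namespace DominoModel

variable {k : ℕ} {θ : ℝ} {ι : Type*} [Fintype ι] (D : DominoModel k θ ι)

theorem eigenvalue_of_shape [Nonempty ι] (hk : 3 ≤ k) {r r₁ r₂ r₃ : ℕ} (h0 : D.R 0 = r)
    (h1 : D.R 1 = r₁) (h2 : D.R 2 = r₂) (h3 : D.R 3 = r₃) (h4 : D.R 4 = 0)
    {β α C₁ C₂ t u₀ u₁ u₂ u₃ u₄ : ℝ}
    (hC₁ : C₁ = (r : ℝ) * (r - 1) + (∑ j ∈ Finset.range r₁, (2 * (j : ℝ) - 1) +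
      (∑ j ∈ Finset.range r₂, (2 * (j : ℝ) - 2) + ∑ j ∈ Finset.range r₃, (2 * (j : ℝ) - 3))))
    (hC₂ : C₂ = 2 / 3 * ((r : ℝ) * (r - 1) * (2 * r - 1)) +
      (∑ j ∈ Finset.range r₁, (2 * (j : ℝ) - 1) ^ 2 +
      (∑ j ∈ Finset.range r₂, (2 * (j : ℝ) - 2) ^ 2 +
        ∑ j ∈ Finset.range r₃, (2 * (j : ℝ) - 3) ^ 2)))
    (hβ : β = (∏ j ∈ Finset.range r₁, (2 * (j : ℝ) - 1)) *
      ((∏ j ∈ Finset.range r₂, (2 * (j : ℝ) - 2)) * ∏ j ∈ Finset.range r₃, (2 * (j : ℝ) - 3)))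
    (hα : (2 * (r - 1)).doubleFactorial * β = α * (2 * k - 6).doubleFactorial)
    (h : ∀ R : ℕ → ℕ, R 0 = r → R 1 = r₁ → R 2 = r₂ → R 3 = r₃ → R 4 = 0 →
      ∀ i < 4, ∀ i' < 4, R (i + 1) < R i →
      Function.update R i (R i - 1) (i' + 1) < Function.update R i (R i - 1) i' → ∀ a b : ℝ,
      a = 2 * (Function.update R i (R i - 1) i' - 1 : ℝ) - i' → b = 2 * (R i - 1 : ℝ) - i →
      a ≠ 0 ∧ b ≠ 0 ∧
      α * (1 / 4 + k / b + k * (k - 1) / 2 * (1 / a - 1 / b)) = t + u₀ * (k * b - 2 * C₁) +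
        u₁ * ((k - 1) * a - 2 * (C₁ - b)) + u₂ * (((k - 1) * a - 2 * (C₁ - b)) * b) +
        u₃ * (k * b ^ 2 - 3 * C₂ + C₁ + k * (k - 1)) +
        u₄ * ((k - 1) * a ^ 2 - 3 * (C₂ - b ^ 2) + (C₁ - b) + (k - 1) * (k - 2))) : θ = t := by
  refine D.eigenvalue_eq hk (α := α) (C₁ := C₁) (C₂ := C₂) (u₀ := u₀) (u₁ := u₁) (u₂ := u₂)
    (u₃ := u₃) (u₄ := u₄) ?_ ?_ ?_ ?_
  · intro T
    rw [(D.fills T).sum_eq (fun y => (y : ℝ)) 4 h4, Finset.sum_range_succ', Finset.sum_range_succ',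
      Finset.sum_range_succ', Finset.sum_range_succ', hC₁, ← sum_two_mul_range]
    simp [h0, h1, h2, h3, -Finset.sum_sub_distrib]
    ring
  · intro T
    rw [(D.fills T).sum_eq (fun y => (y : ℝ) ^ 2) 4 h4, Finset.sum_range_succ',
      Finset.sum_range_succ', Finset.sum_range_succ', Finset.sum_range_succ', hC₂,
      ← sum_two_mul_sq_range]
    simp [h0, h1, h2, h3, -Finset.sum_sub_distrib]
    ring
  · intro T
    rw [(D.fills T).prod_eq 3 h4, ← hα, h0, hβ, Finset.prod_range_succ', Finset.prod_range_succ',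
      Finset.prod_range_succ']
    simp only [Finset.range_zero, Finset.prod_empty, h1, h2, h3]
    refine congrArg _ ?_
    norm_num
    ring
  · rintro T a b rfl rfl
    obtain ⟨n, rfl⟩ : ∃ n, k = n + 2 := ⟨k - 2, by lia⟩
    obtain ⟨i, hi, i', hi', e1, e2, e3, e4⟩ := (D.fills T).last_two h4
    refine h D.R h0 h1 h2 h3 h4 i hi i' hi' e1 e3 _ _ ?_ ?_
    · rw [Nat.add_sub_cancel, e4]; push_cast; ring
    · rw [show n + 2 - 1 = n + 1 by lia, e2]; push_cast; ring

theorem eigenvalue_depth_one [Nonempty ι] (hk : 10 ≤ k) (hR : D.R 0 + 1 = k)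
    (h1 : D.R 1 = 1) (h2 : D.R 2 = 0) (h3 : D.R 3 = 0) (h4 : D.R 4 = 0) : θ = -1 := by
  obtain ⟨r, rfl⟩ : ∃ r, k = r + 3 := ⟨k - 3, by lia⟩
  have hr : (7 : ℝ) ≤ r := by exact_mod_cast (show 7 ≤ r by lia)
  refine D.eigenvalue_of_shape (by lia) (show D.R 0 = r + 2 by lia) h1 h2 h3 h4
    (C₁ := ((r + 2) * (r + 1) - 1 : ℝ))
    (C₂ := (2 / 3 * ((r + 2) * (r + 1) * (2 * r + 3)) + 1 : ℝ))
    (α := -2 * (r + 1))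
    (u₀ := (r + 1) / 2)
    (u₁ := -(r + 3) * (r + 1) / (2 * r))
    (u₂ := 0)
    (u₃ := 0)
    (u₄ := 0)
    (t := -1)
    (by simp only [Finset.sum_range_succ, Finset.range_zero, Finset.sum_empty]; push_cast; ring)
    (by simp only [Finset.sum_range_succ, Finset.range_zero, Finset.sum_empty]; push_cast; ring)
    rfl ?_ ?_
  · rw [show 2 * (r + 2 - 1) = 2 * r + 2 by lia, show 2 * (r + 3) - 6 = 2 * r by lia]
    try simp only [Nat.doubleFactorial_add_two]
    simp only [Finset.prod_range_succ, Finset.range_zero, Finset.prod_empty]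
    push_cast
    field_simp
    ring
  · intro R e0 e1 e2 e3 e4 i hi i' hi' d1 d2 a b ha hb
    interval_cases i <;> interval_cases i' <;>
      simp [e0, e1, e2, e3, e4, add_sub_assoc] at d1 d2 ha hb
    all_goals
      norm_num at ha hb
      subst ha hb
      refine ⟨by positivity, by positivity, ?_⟩
      push_cast
      field_simp
      ring

theorem eigenvalue_depth_zero [Nonempty ι] (hk : 10 ≤ k) (hR : D.R 0 = k)
    (h1 : D.R 1 = 0) (h2 : D.R 2 = 0) (h3 : D.R 3 = 0) (h4 : D.R 4 = 0) :
    θ = (2 * k - 1) * (2 * k - 3) - 1 := by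
  obtain ⟨r, rfl⟩ : ∃ r, k = r + 3 := ⟨k - 3, by lia⟩
  have hr : (7 : ℝ) ≤ r := by exact_mod_cast (show 7 ≤ r by lia)
  refine D.eigenvalue_of_shape (by lia) (show D.R 0 = r + 3 by lia) h1 h2 h3 h4
    (C₁ := ((r + 3) * (r + 2) + 0 : ℝ))
    (C₂ := (2 / 3 * ((r + 3) * (r + 2) * (2 * r + 5)) + 0 : ℝ))
    (α := (2 * r + 4) * (2 * r + 2))
    (u₀ := 0)
    (u₁ := 0)
    (u₂ := 0)
    (u₃ := 0)
    (u₄ := 0)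
    (t := (2 * (r + 3 : ℕ) - 1) * (2 * (r + 3 : ℕ) - 3) - 1)
    (by simp only [Finset.range_zero, Finset.sum_empty]; push_cast; ring)
    (by simp only [Finset.range_zero, Finset.sum_empty]; push_cast; ring)
    rfl ?_ ?_
  · rw [show 2 * (r + 3 - 1) = 2 * r + 4 by lia, show 2 * (r + 3) - 6 = 2 * r by lia]
    simp only [Nat.doubleFactorial_add_two]
    simp only [Finset.range_zero, Finset.prod_empty]
    push_cast
    field_simp
    ring
  · intro R e0 e1 e2 e3 e4 i hi i' hi' d1 d2 a b ha hb
    interval_cases i <;> interval_cases i' <;>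
      simp [e0, e1, e2, e3, e4, add_sub_assoc] at d1 d2 ha hb
    all_goals
      norm_num at ha hb
      subst ha hb
      refine ⟨by positivity, by positivity, ?_⟩
      push_cast
      field_simp
      ring

theorem eigenvalue_two [Nonempty ι] (hk : 10 ≤ k) (hR : D.R 0 + 2 = k)
    (h1 : D.R 1 = 2) (h2 : D.R 2 = 0) (h3 : D.R 3 = 0) (h4 : D.R 4 = 0) : θ = -1 := by
  obtain ⟨r, rfl⟩ : ∃ r, k = r + 4 := ⟨k - 4, by lia⟩
  have hr : (6 : ℝ) ≤ r := by exact_mod_cast (show 6 ≤ r by lia)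
  refine D.eigenvalue_of_shape (by lia) (show D.R 0 = r + 2 by lia) h1 h2 h3 h4
    (C₁ := ((r + 2) * (r + 1) + 0 : ℝ))
    (C₂ := (2 / 3 * ((r + 2) * (r + 1) * (2 * r + 3)) + 2 : ℝ))
    (α := -1)
    (u₀ := -(r + 3) / (4 * r))
    (u₁ := -(r + 4) / (4 * r))
    (u₂ := (r + 4) / (4 * (r + 1) * r))
    (u₃ := 0)
    (u₄ := 0)
    (t := -1)
    (by simp only [Finset.sum_range_succ, Finset.range_zero, Finset.sum_empty]; push_cast; ring)
    (by simp only [Finset.sum_range_succ, Finset.range_zero, Finset.sum_empty]; push_cast; ring)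
    rfl ?_ ?_
  · rw [show 2 * (r + 2 - 1) = 2 * r + 2 by lia, show 2 * (r + 4) - 6 = 2 * r + 2 by lia]
    try simp only [Nat.doubleFactorial_add_two]
    simp only [Finset.prod_range_succ, Finset.range_zero, Finset.prod_empty]
    push_cast
    field_simp
    ring
  · intro R e0 e1 e2 e3 e4 i hi i' hi' d1 d2 a b ha hb
    interval_cases i <;> interval_cases i' <;>
      simp [e0, e1, e2, e3, e4, add_sub_assoc] at d1 d2 ha hb
    all_goals
      norm_num at ha hb
      subst ha hb
      refine ⟨by positivity, by positivity, ?_⟩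
      push_cast
      field_simp
      ring

theorem eigenvalue_one_one [Nonempty ι] (hk : 10 ≤ k) (hR : D.R 0 + 2 = k)
    (h1 : D.R 1 = 1) (h2 : D.R 2 = 1) (h3 : D.R 3 = 0) (h4 : D.R 4 = 0) : θ = -1 := by
  obtain ⟨r, rfl⟩ : ∃ r, k = r + 4 := ⟨k - 4, by lia⟩
  have hr : (6 : ℝ) ≤ r := by exact_mod_cast (show 6 ≤ r by lia)
  refine D.eigenvalue_of_shape (by lia) (show D.R 0 = r + 2 by lia) h1 h2 h3 h4
    (C₁ := ((r + 2) * (r + 1) - 3 : ℝ))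
    (C₂ := (2 / 3 * ((r + 2) * (r + 1) * (2 * r + 3)) + 5 : ℝ))
    (α := 2)
    (u₀ := -1 / 4)
    (u₁ := (r + 4) * (r + 1 / 2) / (2 * (r + 2) * r))
    (u₂ := -(r + 4) * (r - 1) / (8 * (r + 2) * (r + 1) * r))
    (u₃ := 0)
    (u₄ := 0)
    (t := -1)
    (by simp only [Finset.sum_range_succ, Finset.range_zero, Finset.sum_empty]; push_cast; ring)
    (by simp only [Finset.sum_range_succ, Finset.range_zero, Finset.sum_empty]; push_cast; ring)
    rfl ?_ ?_
  · rw [show 2 * (r + 2 - 1) = 2 * r + 2 by lia, show 2 * (r + 4) - 6 = 2 * r + 2 by lia]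
    try simp only [Nat.doubleFactorial_add_two]
    simp only [Finset.prod_range_succ, Finset.range_zero, Finset.prod_empty]
    push_cast
    field_simp
    ring
  · intro R e0 e1 e2 e3 e4 i hi i' hi' d1 d2 a b ha hb
    interval_cases i <;> interval_cases i' <;>
      simp [e0, e1, e2, e3, e4, add_sub_assoc] at d1 d2 ha hb
    all_goals
      norm_num at ha hb
      subst ha hb
      refine ⟨by positivity, by positivity, ?_⟩
      push_cast
      field_simp
      ring

theorem eigenvalue_three [Nonempty ι] (hk : 10 ≤ k) (hR : D.R 0 + 3 = k)
    (h1 : D.R 1 = 3) (h2 : D.R 2 = 0) (h3 : D.R 3 = 0) (h4 : D.R 4 = 0) : -1 ≤ θ := by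
  obtain ⟨r, rfl⟩ : ∃ r, k = r + 5 := ⟨k - 5, by lia⟩
  have hr : (5 : ℝ) ≤ r := by exact_mod_cast (show 5 ≤ r by lia)
  suffices hθ : θ = -6 * (r ^ 2 + 15 / 8 * r + 5 / 8) / ((r + 2) * (r + 1) * r) by
    rw [hθ]
    rw [le_div_iff₀ (by positivity)]
    nlinarith [mul_nonneg (sub_nonneg.2 hr) (show (0 : ℝ) ≤ r ^ 2 + 2 * r + 3 / 4 by positivity)]
  refine D.eigenvalue_of_shape (by lia) (show D.R 0 = r + 2 by lia) h1 h2 h3 h4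
    (C₁ := ((r + 2) * (r + 1) + 3 : ℝ))
    (C₂ := (2 / 3 * ((r + 2) * (r + 1) * (2 * r + 3)) + 11 : ℝ))
    (α := -3 / (2 * (r + 2)))
    (u₀ := -(r - 3) / (8 * (r + 1) * r))
    (u₁ := 3 * (r + 5) / (8 * (r + 2) * r))
    (u₂ := -(r + 5) / (8 * (r + 2) * (r + 1) * r))
    (u₃ := 0)
    (u₄ := 0)
    (t := -6 * (r ^ 2 + 15 / 8 * r + 5 / 8) / ((r + 2) * (r + 1) * r))
    (by simp only [Finset.sum_range_succ, Finset.range_zero, Finset.sum_empty]; push_cast; ring)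
    (by simp only [Finset.sum_range_succ, Finset.range_zero, Finset.sum_empty]; push_cast; ring)
    rfl ?_ ?_
  · rw [show 2 * (r + 2 - 1) = 2 * r + 2 by lia, show 2 * (r + 5) - 6 = 2 * r + 4 by lia]
    try simp only [Nat.doubleFactorial_add_two]
    simp only [Finset.prod_range_succ, Finset.range_zero, Finset.prod_empty]
    push_cast
    field_simp
    ring
  · intro R e0 e1 e2 e3 e4 i hi i' hi' d1 d2 a b ha hb
    interval_cases i <;> interval_cases i' <;>
      simp [e0, e1, e2, e3, e4, add_sub_assoc] at d1 d2 ha hb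
    all_goals
      norm_num at ha hb
      subst ha hb
      refine ⟨by positivity, by positivity, ?_⟩
      push_cast
      field_simp
      ring

theorem eigenvalue_two_one [Nonempty ι] (hk : 10 ≤ k) (hR : D.R 0 + 3 = k)
    (h1 : D.R 1 = 2) (h2 : D.R 2 = 1) (h3 : D.R 3 = 0) (h4 : D.R 4 = 0) : -1 ≤ θ := by
  obtain ⟨r, rfl⟩ : ∃ r, k = r + 5 := ⟨k - 5, by lia⟩
  have hr : (5 : ℝ) ≤ r := by exact_mod_cast (show 5 ≤ r by lia)
  suffices hθ : θ = 3 / 2 * (r + 5 / 3) / ((r + 2) * (r + 1)) by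
    rw [hθ]
    exact le_trans (by norm_num) (show (0 : ℝ) ≤ _ by positivity)
  refine D.eigenvalue_of_shape (by lia) (show D.R 0 = r + 2 by lia) h1 h2 h3 h4
    (C₁ := ((r + 2) * (r + 1) - 2 : ℝ))
    (C₂ := (2 / 3 * ((r + 2) * (r + 1) * (2 * r + 3)) + 6 : ℝ))
    (α := 1 / (r + 2))
    (u₀ := -(r ^ 2 + 7 / 2 * r - 1 / 2) / (4 * (r + 2) * r))
    (u₁ := (r + 5) * (r + 1 / 2) / (4 * (r + 2) * r))
    (u₂ := -(r + 5) / (8 * (r + 2) * (r + 1) * r))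
    (u₃ := (r ^ 2 + 4 * r + 1) / (8 * (r + 2) * (r + 1) * r))
    (u₄ := -(r + 5) / (8 * (r + 2) * r))
    (t := 3 / 2 * (r + 5 / 3) / ((r + 2) * (r + 1)))
    (by simp only [Finset.sum_range_succ, Finset.range_zero, Finset.sum_empty]; push_cast; ring)
    (by simp only [Finset.sum_range_succ, Finset.range_zero, Finset.sum_empty]; push_cast; ring)
    rfl ?_ ?_
  · rw [show 2 * (r + 2 - 1) = 2 * r + 2 by lia, show 2 * (r + 5) - 6 = 2 * r + 4 by lia]
    try simp only [Nat.doubleFactorial_add_two]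
    simp only [Finset.prod_range_succ, Finset.range_zero, Finset.prod_empty]
    push_cast
    field_simp
    ring
  · intro R e0 e1 e2 e3 e4 i hi i' hi' d1 d2 a b ha hb
    interval_cases i <;> interval_cases i' <;>
      simp [e0, e1, e2, e3, e4, add_sub_assoc] at d1 d2 ha hb
    all_goals
      norm_num at ha hb
      subst ha hb
      refine ⟨by positivity, by positivity, ?_⟩
      push_cast
      field_simp
      ring

theorem eigenvalue_one_one_one [Nonempty ι] (hk : 10 ≤ k) (hR : D.R 0 + 3 = k)
    (h1 : D.R 1 = 1) (h2 : D.R 2 = 1) (h3 : D.R 3 = 1) (h4 : D.R 4 = 0) : -1 ≤ θ := by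
  obtain ⟨r, rfl⟩ : ∃ r, k = r + 5 := ⟨k - 5, by lia⟩
  have hr : (5 : ℝ) ≤ r := by exact_mod_cast (show 5 ≤ r by lia)
  suffices hθ : θ = 3 / (2 * (r + 2)) by
    rw [hθ]
    exact le_trans (by norm_num) (show (0 : ℝ) ≤ _ by positivity)
  refine D.eigenvalue_of_shape (by lia) (show D.R 0 = r + 2 by lia) h1 h2 h3 h4
    (C₁ := ((r + 2) * (r + 1) - 6 : ℝ))
    (C₂ := (2 / 3 * ((r + 2) * (r + 1) * (2 * r + 3)) + 14 : ℝ))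
    (α := -3 / (r + 2))
    (u₀ := 1 / (4 * (r + 1)))
    (u₁ := -3 * (r + 5) * (r + 1) / (8 * (r + 2) * r * (r + 5 / 2)))
    (u₂ := (r + 5) * (r - 2) / (16 * (r + 2) * (r + 1) * r * (r + 5 / 2)))
    (u₃ := 0)
    (u₄ := 0)
    (t := 3 / (2 * (r + 2)))
    (by simp only [Finset.sum_range_succ, Finset.range_zero, Finset.sum_empty]; push_cast; ring)
    (by simp only [Finset.sum_range_succ, Finset.range_zero, Finset.sum_empty]; push_cast; ring)
    rfl ?_ ?_
  · rw [show 2 * (r + 2 - 1) = 2 * r + 2 by lia, show 2 * (r + 5) - 6 = 2 * r + 4 by lia]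
    try simp only [Nat.doubleFactorial_add_two]
    simp only [Finset.prod_range_succ, Finset.range_zero, Finset.prod_empty]
    push_cast
    field_simp
    ring
  · intro R e0 e1 e2 e3 e4 i hi i' hi' d1 d2 a b ha hb
    interval_cases i <;> interval_cases i' <;>
      simp [e0, e1, e2, e3, e4, add_sub_assoc] at d1 d2 ha hb
    all_goals
      norm_num at ha hb
      subst ha hb
      refine ⟨by positivity, by positivity, ?_⟩
      push_cast
      field_simp
      ring


end DominoModel

namespace DominoModel

variable {k : ℕ} {θ : ℝ} {ι : Type*} [Fintype ι] (D : DominoModel k θ ι)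

theorem eigenvalue_of_row_zero_add_one [Nonempty ι] (hk : 10 ≤ k) (hR : D.R 0 + 1 = k) :
    θ = -1 := by
  have hT := D.fills (Classical.arbitrary ι)
  have h4 := hT.row_four_eq_zero (by lia)
  have hs := hT.sum_rows 4 h4
  have ha := hT.antitone
  simp only [Finset.sum_range_succ, Finset.range_zero, Finset.sum_empty] at hs
  have := ha (show 1 ≤ 2 by lia)
  have := ha (show 2 ≤ 3 by lia)
  exact D.eigenvalue_depth_one hk hR (by lia) (by lia) (by lia) h4

theorem neg_one_le_of_row_zero_add_three [Nonempty ι] (hk : 10 ≤ k) (hR : k ≤ D.R 0 + 3) :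
    -1 ≤ θ := by
  have hT := D.fills (Classical.arbitrary ι)
  have h4 := hT.row_four_eq_zero hR
  have hs := hT.sum_rows 4 h4
  have ha := hT.antitone
  simp only [Finset.sum_range_succ, Finset.range_zero, Finset.sum_empty] at hs
  have h12 := ha (show 1 ≤ 2 by lia)
  have h23 := ha (show 2 ≤ 3 by lia)
  obtain h | h | h | h : D.R 0 = k ∨ D.R 0 + 1 = k ∨ D.R 0 + 2 = k ∨ D.R 0 + 3 = k := by lia
  · rw [D.eigenvalue_depth_zero hk h (by lia) (by lia) (by lia) h4]
    have : (10 : ℝ) ≤ k := by exact_mod_cast hk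
    nlinarith
  · exact (D.eigenvalue_of_row_zero_add_one hk h).ge
  · obtain h1 | h1 : D.R 1 = 2 ∨ D.R 1 = 1 := by lia
    · exact (D.eigenvalue_two hk h h1 (by lia) (by lia) h4).ge
    · exact (D.eigenvalue_one_one hk h h1 (by lia) (by lia) h4).ge
  · obtain h1 | h1 | h1 : D.R 1 = 3 ∨ D.R 1 = 2 ∨ D.R 1 = 1 := by lia
    · exact D.eigenvalue_three hk h h1 (by lia) (by lia) h4
    · exact D.eigenvalue_two_one hk h h1 (by lia) (by lia) h4
    · exact D.eigenvalue_one_one_one hk h h1 (by lia) (by lia) h4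

end DominoModel

namespace FillsByDominoes

variable {c : ℕ → ℤ} {n : ℕ} {R : ℕ → ℕ}

theorem column (h : FillsByDominoes c n R) (hR : R 0 ≤ 1) :
    (∀ i, R i = if i < n then 1 else 0) ∧ ∀ j < n, c j = -j := by
  induction h with
  | zero => simp
  | @succ n R i h hi hc ih =>
    have hRi : Function.update R i (R i + 1) i ≤ 1 :=
      ((h.succ i hi hc).antitone (Nat.zero_le i)).trans hR
    have hR0 : R 0 ≤ 1 := by
      rw [Function.update_apply] at hR
      split_ifs at hR with h0
      · subst h0; lia
      · exact hR
    obtain ⟨ih1, ih2⟩ := ih hR0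
    have hRi0 : R i = 0 := by simpa using hRi
    have hin : i = n := by
      have e1 := ih1 i
      have e2 := ih1 (i - 1)
      split_ifs at e1 e2 <;> lia
    subst hin
    constructor
    · intro j
      rw [Function.update_apply]
      split_ifs with h1 h2 h2
      · lia
      · lia
      · rw [ih1, if_pos (by lia)]
      · rw [ih1, if_neg (by lia)]
    · intro j hj
      rcases Nat.lt_succ_iff_lt_or_eq.1 hj with hj | rfl
      · exact ih2 j hj
      · rw [hc, hRi0]; ring

theorem prod_of_column (h : FillsByDominoes c (n + 1) R) (hR : R 0 ≤ 1) :
    ∏ j ∈ Finset.range n, c (j + 1) = (-1) ^ n * n.factorial := by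
  have hc := (h.column hR).2
  clear h hR
  induction n with
  | zero => simp
  | succ n ih =>
    rw [Finset.prod_range_succ, ih fun j hj => hc j (by lia), hc _ (by lia), Nat.factorial_succ]
    push_cast
    ring

theorem prod_eq_of_row_zero_add_two (h : FillsByDominoes c (n + 1) R) (hR : R 0 + 2 = n + 1)
    (hn : 3 ≤ n) :
    ∏ j ∈ Finset.range n, c (j + 1) = -(2 * n - 4).doubleFactorial ∨
    ∏ j ∈ Finset.range n, c (j + 1) = 2 * (2 * n - 4).doubleFactorial := by
  have h3 : R 3 = 0 := by
    by_contra hcon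
    have := h.row_zero_add_index_le 3 (by lia)
    lia
  have hs := h.sum_rows 3 h3
  simp only [Finset.sum_range_succ, Finset.range_zero, Finset.sum_empty] at hs
  have hp := h.prod_eq 2 h3
  rw [Finset.prod_Ico_eq_prod_range, Nat.add_sub_cancel,
    show 2 * (R 0 - 1) = 2 * n - 4 by lia] at hp
  have h12 := h.antitone (show 1 ≤ 2 by lia)
  obtain ⟨h1, h2⟩ | ⟨h1, h2⟩ : (R 1 = 2 ∧ R 2 = 0) ∨ (R 1 = 1 ∧ R 2 = 1) := by lia
  · left
    have : ∏ j ∈ Finset.range n, (c (1 + j) : ℝ) = -((2 * n - 4).doubleFactorial : ℝ) := by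
      rw [hp]; simp [Finset.prod_range_succ, h1, h2]; norm_num
    simp_rw [add_comm 1] at this
    exact_mod_cast this
  · right
    have : ∏ j ∈ Finset.range n, (c (1 + j) : ℝ) = 2 * ((2 * n - 4).doubleFactorial : ℝ) := by
      rw [hp]; simp [Finset.prod_range_succ, h1, h2]; norm_num; ring
    simp_rw [add_comm 1] at this
    exact_mod_cast this

theorem factorial_le_doubleFactorial (hn : 4 ≤ n) :
    (2 * (n - 1).factorial : ℤ) ≤ 6 * (2 * n - 6).doubleFactorial := by
  have key : ∀ m : ℕ, (m + 3) * (m + 2) ≤ 3 * 2 ^ (m + 1) := by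
    intro m
    induction m with
    | zero => norm_num
    | succ m ih =>
      rcases Nat.lt_or_ge m 1 with hm | hm
      · interval_cases m; norm_num
      · rw [pow_succ]; nlinarith
  obtain ⟨m, rfl⟩ := Nat.exists_eq_add_of_le' hn
  rw [show m + 4 - 1 = m + 1 + 1 + 1 by lia, show 2 * (m + 4) - 6 = 2 * (m + 1) by lia,
    Nat.doubleFactorial_two_mul, Nat.factorial_succ, Nat.factorial_succ]
  have := Nat.mul_le_mul_right (m + 1).factorial (key m)
  push_cast
  nlinarith [(by exact_mod_cast this : ((m + 3) * (m + 2) * (m + 1).factorial : ℤ) ≤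
    3 * 2 ^ (m + 1) * (m + 1).factorial)]

theorem abs_prod_le (h : FillsByDominoes c (n + 1) R) (h2 : 2 ≤ R 0) (hR : R 0 + 3 ≤ n + 1) :
    |∏ j ∈ Finset.range n, c (j + 1)| ≤ 6 * (2 * n - 6).doubleFactorial := by
  induction n generalizing R with
  | zero => lia
  | succ n ih =>
    obtain ⟨i, hi1, hi2, hc, h'⟩ := h.pred
    rw [Finset.prod_range_succ, abs_mul]
    have hle := h.antitone (Nat.zero_le i)
    have hR' : 1 ≤ i ∧ Function.update R i (R i - 1) 0 = R 0 ∨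
        i = 0 ∧ Function.update R i (R i - 1) 0 = R 0 - 1 := by
      rcases Nat.eq_zero_or_pos i with rfl | hi
      · right; simp
      · left; exact ⟨hi, Function.update_of_ne hi.ne _ _⟩
    have hb := h.row_zero_add_index_le i hi1
    have hi0 : 1 ≤ i → R 0 + R i ≤ n + 1 + 1 := h.row_zero_add_row_le i
    rcases Nat.lt_or_ge (Function.update R i (R i - 1) 0) 2 with h0 | h0
    · have : R 0 = 2 ∧ i = 0 := by lia
      obtain ⟨e1, rfl⟩ := this
      rw [h'.prod_of_column (by lia), hc, e1, abs_mul, abs_pow]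
      have := factorial_le_doubleFactorial (n := n + 1) (by lia)
      simp at this ⊢
      linarith
    · rcases Nat.lt_or_ge n (Function.update R i (R i - 1) 0 + 2) with h1 | h1
      · have e1 : Function.update R i (R i - 1) 0 + 2 = n + 1 := by lia
        have hX : |∏ j ∈ Finset.range n, c (j + 1)| ≤ 2 * (2 * n - 4).doubleFactorial := by
          rcases h'.prod_eq_of_row_zero_add_two e1 (by lia) with e | e <;> rw [e, abs_le] <;>
            constructor <;> linarith [Int.natCast_nonneg (2 * n - 4).doubleFactorial]
        have hc3 : |c (n + 1)| ≤ 3 := by rw [abs_le]; lia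
        have := mul_le_mul hX hc3 (abs_nonneg _) (by positivity)
        rw [show 2 * (n + 1) - 6 = 2 * n - 4 by lia]
        linarith
      · have hcn : |c (n + 1)| ≤ 2 * n - 4 := by rw [abs_le]; lia
        have := mul_le_mul (ih h' h0 (by lia)) hcn (abs_nonneg _) (by positivity)
        obtain ⟨m, rfl⟩ : ∃ m, n = m + 3 := ⟨n - 3, by lia⟩
        rw [show 2 * (m + 3 + 1) - 6 = 2 * m + 2 by lia, Nat.doubleFactorial_add_two]
        rw [show 2 * (m + 3) - 6 = 2 * m by lia] at this
        refine this.trans (le_of_eq ?_)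
        push_cast
        ring

end FillsByDominoes

namespace DominoModel

variable {k : ℕ} {θ : ℝ} {ι : Type*} [Fintype ι] (D : DominoModel k θ ι)

theorem neg_one_le_of_pointwise [Nonempty ι]
    (hpos : ∀ T, ∀ X a b : ℝ, X = ∏ j ∈ Finset.range (k - 3), (D.c T (j + 1) : ℝ) →
      a = D.c T (k - 2) → b = D.c T (k - 1) → 0 ≤ X →
      -((2 * k - 6).doubleFactorial : ℝ) ≤ X * (a * b / 4 + k * a - k * (k - 1) / 2))
    (hneg : ∀ T, ∀ X a b : ℝ, X = ∏ j ∈ Finset.range (k - 3), (D.c T (j + 1) : ℝ) →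
      a = D.c T (k - 2) → b = D.c T (k - 1) → X ≤ 0 →
      -((2 * k - 6).doubleFactorial : ℝ) ≤ X * (a * b / 4 + k * a + k * (k - 1))) :
    -1 ≤ θ := by
  set w : ℝ := Nat.cast (2 * k - 6).doubleFactorial with hw
  have hwpos : 0 < w := by simpa [hw] using Nat.doubleFactorial_pos _
  set X : ι → ℝ := fun T => ∏ j ∈ Finset.range (k - 3), (D.c T (j + 1) : ℝ) with hX
  have hXdep : ∀ T T', (∀ j < k - 2, D.c T j = D.c T' j) → X T = X T' := fun T T' h =>
    Finset.prod_congr rfl fun j hj => by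
      rw [h]
      have := Finset.mem_range.1 hj
      lia
  have e1 := (D.exchange (fun T => √(max (X T) 0)) fun T T' h => by
    simp only [hXdep T T' h]).1
  have e2 := (D.exchange (fun T => √(max (-X T) 0)) fun T T' h => by
    simp only [hXdep T T' h]).2
  simp only [Real.sq_sqrt (le_max_right _ (0 : ℝ))] at e1 e2
  have key : ∑ T, -w * D.m T ≤ ∑ T, (X T * (D.c T (k - 2) * D.c T (k - 1) / 4 + k * D.c T (k - 2)) -
      k * (k - 1) / 2 * max (X T) 0 - k * (k - 1) * max (-X T) 0) * D.m T := by
    refine Finset.sum_le_sum fun T _ => mul_le_mul_of_nonneg_right ?_ (D.m_pos T).le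
    rcases le_total 0 (X T) with h | h
    · rw [max_eq_left h, max_eq_right (by linarith)]
      linarith [hpos T (X T) _ _ rfl rfl rfl h]
    · rw [max_eq_right h, max_eq_left (by linarith)]
      linarith [hneg T (X T) _ _ rfl rfl rfl h]
  have hk0 : (0 : ℝ) ≤ k * (k - 1) / 2 := by
    rcases Nat.eq_zero_or_pos k with rfl | h
    · simp
    · have : (1 : ℝ) ≤ k := by exact_mod_cast h
      have := sub_nonneg.2 this
      positivity
  have e : θ * w * ∑ T, D.m T = ∑ T, (X T * (D.c T (k - 2) * D.c T (k - 1) / 4 +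
      k * D.c T (k - 2)) - k * (k - 1) / 2 * max (X T) 0 - k * (k - 1) * max (-X T) 0) * D.m T +
      k * (k - 1) / 2 * (∑ T, ((D.c T (k - 1) : ℝ) - D.c T (k - 2)) * max (X T) 0 * D.m T +
        ∑ T, max (X T) 0 * D.m T) +
      k * (k - 1) / 2 * (2 * ∑ T, max (-X T) 0 * D.m T -
        ∑ T, ((D.c T (k - 1) : ℝ) - D.c T (k - 2)) * max (-X T) 0 * D.m T) := by
    rw [D.eigenvalue]
    simp only [Finset.mul_sum, ← Finset.sum_add_distrib, ← Finset.sum_sub_distrib]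
    refine Finset.sum_congr rfl fun T _ => ?_
    have : X T = max (X T) 0 - max (-X T) 0 := (posPart_sub_negPart (X T)).symm
    rw [show (∏ j ∈ Finset.range (k - 3), (D.c T (j + 1) : ℝ)) = X T from rfl]
    linear_combination (k * (k - 1) / 2 * ((D.c T (k - 1) : ℝ) - D.c T (k - 2)) * D.m T) * this
  rw [← Finset.mul_sum] at key
  have h1 := mul_nonneg hk0 (show 0 ≤ ∑ T, ((D.c T (k - 1) : ℝ) - D.c T (k - 2)) * max (X T) 0 *
    D.m T + ∑ T, max (X T) 0 * D.m T by linarith)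
  have h2 := mul_nonneg hk0 (show 0 ≤ 2 * ∑ T, max (-X T) 0 * D.m T -
    ∑ T, ((D.c T (k - 1) : ℝ) - D.c T (k - 2)) * max (-X T) 0 * D.m T by linarith)
  have hm := D.sum_m_pos
  by_contra hcon
  nlinarith [mul_pos (mul_pos (show 0 < -1 - θ by linarith) hwpos) hm]

end DominoModel

theorem neg_le_mul_of_abs_le {X Y Z W w : ℝ} (hX : |X| ≤ Y) (hZ : |Z| ≤ W) (h : Y * W ≤ w) :
    -w ≤ X * Z := by
  have := mul_le_mul hX hZ (abs_nonneg _) ((abs_nonneg _).trans hX)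
  rw [← abs_mul] at this
  linarith [neg_abs_le (X * Z)]

theorem eigenvalue_summand_bounds {X Y a b A B κ w : ℝ} (hκ : 1 ≤ κ) (hX : |X| ≤ Y) (ha : |a| ≤ A)
    (hb : |b| ≤ B) (h : Y * (A * B / 4 + κ * A + κ * (κ - 1)) ≤ w) :
    -w ≤ X * (a * b / 4 + κ * a - κ * (κ - 1) / 2) ∧
      -w ≤ X * (a * b / 4 + κ * a + κ * (κ - 1)) := by
  have h1 := mul_le_mul ha hb (abs_nonneg _) ((abs_nonneg _).trans ha)
  rw [← abs_mul] at h1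
  obtain ⟨h2, h3⟩ := abs_le.1 h1
  obtain ⟨h4, h5⟩ := abs_le.1 ha
  have h6 : 0 ≤ κ * (κ - 1) := mul_nonneg (by linarith) (by linarith)
  constructor <;> refine neg_le_mul_of_abs_le hX (abs_le.2 ⟨?_, ?_⟩) h <;> nlinarith

namespace FillsByDominoes

variable {c : ℕ → ℤ} {m : ℕ} {R : ℕ → ℕ}

theorem four_mul_two_pow_ge (m : ℕ) (hm : 8 ≤ m) :
    9 * (m + 3) ^ 2 + 2 ≤ 4 * 2 ^ m + 15 * (m + 3) := by
  induction m, hm using Nat.le_induction with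
  | base => norm_num
  | succ m hm ih => have := pow_succ 2 m; nlinarith

theorem eigenvalue_summand_bounds (h : FillsByDominoes c (m + 3) R) (hm : 7 ≤ m)
    (hR : R 0 + 4 ≤ m + 3) {X a b w κ : ℝ} (hX : X = ∏ j ∈ Finset.range m, (c (j + 1) : ℝ))
    (ha : a = c (m + 1)) (hb : b = c (m + 2)) (hw : w = (2 * m).doubleFactorial) (hκ : κ = m + 3) :
    (0 ≤ X → -w ≤ X * (a * b / 4 + κ * a - κ * (κ - 1) / 2)) ∧
      (X ≤ 0 → -w ≤ X * (a * b / 4 + κ * a + κ * (κ - 1))) := by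
  obtain ⟨i, hi1, -, hci, h'⟩ := h.pred
  obtain ⟨i', hi1', -, hci', h''⟩ := h'.pred
  have l1 := h.antitone (Nat.zero_le i)
  have l2 := h'.antitone (Nat.zero_le i')
  have l3 := h.row_zero_add_index_le i hi1
  have l4 := h'.row_zero_add_index_le i' hi1'
  have l5 := h.row_zero_add_row_le i
  have l6 := h'.row_zero_add_row_le i'
  set R' := Function.update R i (R i - 1) with hR'
  set R'' := Function.update R' i' (R' i' - 1) with hR''
  have r1 : 1 ≤ i ∧ R' 0 = R 0 ∨ i = 0 ∧ R' 0 = R 0 - 1 := by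
    rcases Nat.eq_zero_or_pos i with rfl | hi
    · right; simp [hR']
    · left; exact ⟨hi, Function.update_of_ne hi.ne _ _⟩
  have r2 : 1 ≤ i' ∧ R'' 0 = R' 0 ∨ i' = 0 ∧ R'' 0 = R' 0 - 1 := by
    rcases Nat.eq_zero_or_pos i' with rfl | hi
    · right; simp [hR'']
    · left; exact ⟨hi, Function.update_of_ne hi.ne _ _⟩
  have hXc : X = ((∏ j ∈ Finset.range m, c (j + 1) : ℤ) : ℝ) := by rw [hX]; push_cast; rfl
  have hmr : (7 : ℝ) ≤ m := by exact_mod_cast hm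
  have hκ1 : 1 ≤ κ := by linarith
  subst hκ
  rcases Nat.lt_or_ge 1 (R'' 0) with h1 | h1
  · rcases Nat.lt_or_ge (R'' 0 + 2) (m + 1) with h2 | h2
    · have hP := h''.abs_prod_le h1 (by lia)
      have hac : |c (m + 1)| ≤ 2 * m - 4 := by rw [abs_le]; lia
      have hbc : |c (m + 2)| ≤ 2 * m - 4 := by rw [abs_le]; lia
      obtain ⟨q, rfl⟩ : ∃ q, m = q + 3 := ⟨m - 3, by lia⟩
      have hPr : |X| ≤ 6 * (2 * q).doubleFactorial := by
        rw [hXc]; rw [show 2 * (q + 3) - 6 = 2 * q by lia] at hP; exact_mod_cast hP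
      have har : |a| ≤ 2 * q + 2 := by
        rw [ha]; push_cast at hac; exact_mod_cast hac.trans (by lia)
      have hbr : |b| ≤ 2 * q + 2 := by
        rw [hb]; push_cast at hbc; exact_mod_cast hbc.trans (by lia)
      have hwq : w = (2 * q + 6) * (2 * q + 4) * (2 * q + 2) * (2 * q).doubleFactorial := by
        rw [hw, show 2 * (q + 3) = 2 * q + 2 + 2 + 2 by lia]
        simp only [Nat.doubleFactorial_add_two]; push_cast; ring
      push_cast at hmr hκ1 ⊢
      obtain ⟨e1, e2⟩ := _root_.eigenvalue_summand_bounds (w := w) hκ1 hPr har hbr (by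
        rw [hwq]
        have : (0 : ℝ) ≤ (2 * q).doubleFactorial := by positivity
        have hq : (4 : ℝ) ≤ q := by linarith
        suffices 6 * ((2 * q + 2) * (2 * q + 2) / 4 + ((q : ℝ) + 3 + 3) * (2 * q + 2) +
          (q + 3 + 3) * (q + 3 + 3 - 1)) ≤ (2 * q + 6) * (2 * q + 4) * (2 * q + 2) by nlinarith
        nlinarith [mul_nonneg (sub_nonneg.2 hq) (sub_nonneg.2 hq),
          mul_nonneg (mul_nonneg (sub_nonneg.2 hq) (sub_nonneg.2 hq)) (sub_nonneg.2 hq)])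
      exact ⟨fun _ => e1, fun _ => e2⟩
    · have e0 : R'' 0 + 2 = m + 1 := by lia
      have ha3 : -3 ≤ c (m + 1) ∧ c (m + 1) ≤ 3 := by lia
      have hb5 : -4 ≤ c (m + 2) ∧ c (m + 2) ≤ 5 := by lia
      have ha3' : -3 ≤ a ∧ a ≤ 3 := by rw [ha]; exact_mod_cast ha3
      have hb5' : -4 ≤ b ∧ b ≤ 5 := by rw [hb]; exact_mod_cast hb5
      obtain ⟨q, rfl⟩ : ∃ q, m = q + 2 := ⟨m - 2, by lia⟩
      have hwq : w = (2 * q + 4) * (2 * q + 2) * (2 * q).doubleFactorial := by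
        rw [hw, show 2 * (q + 2) = 2 * q + 2 + 2 by lia]
        simp only [Nat.doubleFactorial_add_two]; push_cast; ring
      have hpos : (0 : ℝ) < (2 * q).doubleFactorial := by
        exact_mod_cast Nat.doubleFactorial_pos _
      have hab1 : -15 ≤ a * b := by nlinarith
      have hab2 : a * b ≤ 15 := by nlinarith
      have hP := h''.prod_eq_of_row_zero_add_two e0 (by lia)
      rw [show 2 * (q + 2) - 4 = 2 * q by lia] at hP
      push_cast at hmr ⊢
      have hq : (5 : ℝ) ≤ q := by linarith
      rcases hP with hP | hP
      · have hXq : X = -((2 * q).doubleFactorial : ℝ) := by rw [hXc, hP]; push_cast; ring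
        refine ⟨fun h => by linarith, fun _ => ?_⟩
        rw [hXq, hwq]
        suffices a * b / 4 + ((q : ℝ) + 2 + 3) * a + (q + 2 + 3) * (q + 2 + 3 - 1) ≤
          (2 * q + 4) * (2 * q + 2) by nlinarith
        nlinarith
      · have hXq : X = 2 * ((2 * q).doubleFactorial : ℝ) := by rw [hXc, hP]; push_cast; ring
        refine ⟨fun _ => ?_, fun h => by linarith⟩
        rw [hXq, hwq]
        suffices -((2 * q + 4) * (2 * q + 2) : ℝ) ≤
          2 * (a * b / 4 + (q + 2 + 3) * a - (q + 2 + 3) * (q + 2 + 3 - 1) / 2) by nlinarith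
        nlinarith
  · have hP := h''.prod_of_column h1
    have hXf : X = (-1) ^ m * m.factorial := by rw [hXc, hP]; push_cast; ring
    have hfpos : (0 : ℝ) < m.factorial := by exact_mod_cast Nat.factorial_pos m
    have hwq : w = 2 ^ m * m.factorial := by
      rw [hw, Nat.doubleFactorial_two_mul]; push_cast; ring
    have hcol := (h''.column h1).1
    have hRi : 1 ≤ i' → R' i' ≤ 1 := fun hi => by
      have := h'.antitone (Nat.zero_le i'); lia
    have hac : (c (m + 1) ≤ 2 ∧ -(m + 1) ≤ c (m + 1)) := by lia
    have hbc : (c (m + 2) ≤ 4 ∧ -(m + 2) ≤ c (m + 2)) := by lia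
    rcases Nat.lt_or_ge m 8 with h8 | h8
    · obtain rfl : m = 7 := by lia
      refine ⟨fun hX0 => by rw [hXf] at hX0; linarith, fun _ => ?_⟩
      have ha' : a ≤ 2 ∧ -8 ≤ a := by rw [ha]; exact_mod_cast hac
      have hb' : b ≤ 4 ∧ -9 ≤ b := by rw [hb]; exact_mod_cast hbc
      rw [hXf, hwq]
      suffices a * b / 4 + 10 * a + 90 ≤ 128 by norm_num at this ⊢; linarith
      rcases le_total 0 a with h0 | h0 <;> nlinarith
    · have har : |a| ≤ m + 1 := by
        rw [ha]; exact_mod_cast (abs_le.2 (by lia) : |c (m + 1)| ≤ ((m + 1 : ℕ) : ℤ))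
      have hbr : |b| ≤ m + 2 := by
        rw [hb]; exact_mod_cast (abs_le.2 (by lia) : |c (m + 2)| ≤ ((m + 2 : ℕ) : ℤ))
      have h2 : 9 * ((m : ℝ) + 3) ^ 2 + 2 ≤ 4 * 2 ^ m + 15 * (m + 3) := by
        exact_mod_cast four_mul_two_pow_ge m h8
      have hXr : |X| ≤ m.factorial := by rw [hXf, abs_mul, abs_pow]; simp
      obtain ⟨e1, e2⟩ := _root_.eigenvalue_summand_bounds (w := w) hκ1 hXr har hbr (by
        rw [hwq, mul_comm]; exact mul_le_mul_of_nonneg_right (by linarith) hfpos.le)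
      exact ⟨fun _ => e1, fun _ => e2⟩

end FillsByDominoes

namespace DominoModel

theorem neg_one_le {k : ℕ} {θ : ℝ} {ι : Type*} [Fintype ι] [Nonempty ι] (D : DominoModel k θ ι)
    (hk : 10 ≤ k) : -1 ≤ θ := by
  rcases Nat.lt_or_ge (D.R 0 + 3) k with h | h
  · obtain ⟨m, rfl⟩ : ∃ m, k = m + 3 := ⟨k - 3, by lia⟩
    refine D.neg_one_le_of_pointwise ?_ ?_ <;> rintro T X a b hX ha hb h0
    · exact ((D.fills T).eigenvalue_summand_bounds (by lia) (by lia) hX ha hb rfl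
        (by push_cast; rfl)).1 h0
    · exact ((D.fills T).eigenvalue_summand_bounds (by lia) (by lia) hX ha hb rfl
        (by push_cast; rfl)).2 h0
  · exact D.neg_one_le_of_row_zero_add_three hk h

end DominoModel

namespace FillsByDominoes

variable {c : ℕ → ℤ} {n : ℕ} {R : ℕ → ℕ}

theorem sum_content_le (h : FillsByDominoes c n R) :
    ∑ j ∈ Finset.range n, c j + 2 * n ≤ R 0 * (n + 1) := by
  have hL : R (n + 1) = 0 := h.eq_zero _ (by lia)
  have hs := h.sum_rows (n + 1) hL
  have hc := h.sum_eq (fun y => y) (n + 1) hL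
  rw [Finset.sum_range_succ'] at hs hc
  have hrow : ∀ i : ℕ, ∑ j ∈ Finset.range (R i), ((2 * j : ℤ) - i) = R i * (R i - 1 - i) := by
    intro i
    induction R i with
    | zero => simp
    | succ r ih => rw [Finset.sum_range_succ, ih]; push_cast; ring
  have hle : ∑ i ∈ Finset.range n, ∑ j ∈ Finset.range (R (i + 1)), ((2 * j : ℤ) - (i + 1 : ℕ)) ≤
      ∑ i ∈ Finset.range n, (R (i + 1) : ℤ) * (R 0 - 2) := by
    refine Finset.sum_le_sum fun i _ => ?_
    rw [hrow]
    have := h.antitone (Nat.zero_le (i + 1))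
    exact mul_le_mul_of_nonneg_left (by push_cast; lia) (by positivity)
  have h0 := hrow 0
  push_cast at h0
  rw [← Finset.sum_mul] at hle
  have hs' : ∑ i ∈ Finset.range n, (R (i + 1) : ℤ) = n - R 0 := by
    have : (∑ i ∈ Finset.range n, (R (i + 1) : ℤ)) + R 0 = n := by exact_mod_cast hs
    linarith
  rw [hs'] at hle
  rw [hc]
  push_cast at hle ⊢
  rw [h0]
  linarith

theorem row_zero_add_one_of_sum_content (h : FillsByDominoes c n R)
    (hc : ∑ j ∈ Finset.range n, c j = (n : ℤ) ^ 2 - 3 * n + 1) (hn : 2 ≤ n) : R 0 + 1 = n := by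
  have h1 := h.sum_content_le
  rw [hc] at h1
  have hL : R n = 0 := h.eq_zero _ le_rfl
  obtain ⟨m, rfl⟩ : ∃ m, n = m + 1 := ⟨n - 1, by lia⟩
  have hs := h.sum_rows (m + 1) hL
  rw [Finset.sum_range_succ'] at hs
  have hge : m ≤ R 0 := by
    by_contra hcon
    have : (R 0 : ℤ) ≤ m - 1 := by lia
    push_cast at h1
    nlinarith
  rcases Nat.lt_or_ge m (R 0) with hlt | hle
  · have hR0 : R 0 = m + 1 := by lia
    have h1 : R 1 = 0 := by
      have := h.row_zero_add_row_le 1 le_rfl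
      lia
    have := h.sum_eq (fun y => y) 1 h1
    rw [Finset.sum_range_one, hR0] at this
    have hg : ∀ q : ℕ, ∑ j ∈ Finset.range q, ((2 * j : ℤ) - (0 : ℕ)) = q * (q - 1) := by
      intro q
      induction q with
      | zero => simp
      | succ r ih => rw [Finset.sum_range_succ, ih]; push_cast; ring
    rw [hc, hg] at this
    push_cast at this
    nlinarith
  · lia

end FillsByDominoes

section Matchings

open Equiv

variable {n : ℕ}

theorem PM.ne_of_mem (P : PM n) {x y : Fin n} (h : s(x, y) ∈ P.1) : x ≠ y :=
  fun hxy => P.2.1 _ h (by simpa using hxy)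

theorem PM.mate_unique (P : PM n) {x y z : Fin n} (h : s(x, y) ∈ P.1) (h' : s(x, z) ∈ P.1) :
    y = z :=
  Sym2.congr_right.1 ((P.2.2 x).unique ⟨h, Sym2.mem_mk_left x y⟩ ⟨h', Sym2.mem_mk_left x z⟩)

theorem PM.exists_mate (P : PM n) (x : Fin n) : ∃ y, s(x, y) ∈ P.1 := by
  obtain ⟨e, ⟨he, y, rfl⟩, -⟩ := P.2.2 x
  exact ⟨y, he⟩

theorem isPM_of_mate {P : Finset (Sym2 (Fin n))} (h0 : ∀ x, s(x, x) ∉ P)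
    (h1 : ∀ x, ∃! y, s(x, y) ∈ P) : IsPM P := by
  refine ⟨fun e => ?_, fun v => ?_⟩
  · induction e with
    | h x y => rintro he (rfl : x = y); exact h0 _ he
  · obtain ⟨y, hy, hu⟩ := h1 v
    refine ⟨s(v, y), ⟨hy, Sym2.mem_mk_left _ _⟩, ?_⟩
    rintro _ ⟨he, z, rfl⟩
    rw [hu z he]

theorem PM.ext_iff_mk {P Q : PM n} : P = Q ↔ ∀ x y, s(x, y) ∈ P.1 ↔ s(x, y) ∈ Q.1 := by
  refine ⟨fun h => by simp [h], fun h => Subtype.ext (Finset.ext fun e => ?_)⟩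
  induction e with
  | h x y => exact h x y

theorem PM.eq_of_forall_mem {P Q : PM n} (h : ∀ x y, s(x, y) ∈ P.1 → s(x, y) ∈ Q.1) : P = Q := by
  refine PM.ext_iff_mk.2 fun x y => ⟨h x y, fun hQ => ?_⟩
  obtain ⟨z, hz⟩ := P.exists_mate x
  rwa [Q.mate_unique hQ (h _ _ hz)]

theorem mk_mem_image_map_iff (g : Perm (Fin n)) (P : Finset (Sym2 (Fin n))) (x y : Fin n) :
    s(x, y) ∈ P.image (Sym2.map g) ↔ s(g⁻¹ x, g⁻¹ y) ∈ P := by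
  rw [Finset.mem_image]
  constructor
  · rintro ⟨e, he, h⟩
    rw [show s(g⁻¹ x, g⁻¹ y) = Sym2.map (g⁻¹ : Perm (Fin n)) s(x, y) from rfl, ← h, Sym2.map_map]
    rw [show ((g⁻¹ : Perm (Fin n)) ∘ g : Fin n → Fin n) = id from funext fun i => by simp]
    simpa using he
  · intro h
    exact ⟨_, h, by simp⟩

/-- The image of a matching under a permutation of the vertices. -/
instance : MulAction (Perm (Fin n)) (PM n) where
  smul g P := ⟨P.1.image (Sym2.map g), isPM_of_mate
    (fun x h => P.ne_of_mem ((mk_mem_image_map_iff g P.1 x x).1 h) rfl) fun x => by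
      obtain ⟨y, hy⟩ := P.exists_mate (g⁻¹ x)
      refine ⟨g y, (mk_mem_image_map_iff g P.1 _ _).2 (by simpa using hy), fun z hz => ?_⟩
      rw [P.mate_unique hy ((mk_mem_image_map_iff g P.1 _ _).1 hz)]
      simp⟩
  one_smul P := PM.ext_iff_mk.2 fun x y => (mk_mem_image_map_iff 1 P.1 x y).trans (by simp)
  mul_smul g h P := PM.ext_iff_mk.2 fun x y => by
    refine (mk_mem_image_map_iff (g * h) P.1 x y).trans ?_
    refine Iff.symm ((mk_mem_image_map_iff g _ x y).trans ?_)
    exact (mk_mem_image_map_iff h P.1 _ _).trans (by simp)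

theorem PM.mk_mem_smul_iff (g : Perm (Fin n)) (P : PM n) (x y : Fin n) :
    s(x, y) ∈ (g • P).1 ↔ s(g⁻¹ x, g⁻¹ y) ∈ P.1 :=
  mk_mem_image_map_iff g P.1 x y

theorem unionGraph_adj (P Q : PM n) (x y : Fin n) :
    (unionGraph P Q).Adj x y ↔ s(x, y) ∈ P.1 ∨ s(x, y) ∈ Q.1 := by
  simp only [unionGraph, SimpleGraph.fromEdgeSet_adj, Finset.coe_union, Set.mem_union,
    Finset.mem_coe]
  exact ⟨fun h => h.1, fun h => ⟨h, h.elim P.ne_of_mem Q.ne_of_mem⟩⟩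

theorem unionGraph_comm (P Q : PM n) : unionGraph P Q = unionGraph Q P := by
  rw [unionGraph, unionGraph, Finset.union_comm]

/-- A permutation of the vertices induces an isomorphism of union graphs. -/
def unionGraphIso (g : Perm (Fin n)) (P Q : PM n) :
    unionGraph P Q ≃g unionGraph (g • P) (g • Q) where
  toEquiv := g
  map_rel_iff' := by simp [unionGraph_adj, PM.mk_mem_smul_iff]

/-- The number of connected components of the union of two matchings. -/
noncomputable def numComp (P Q : PM n) : ℕ := Nat.card (unionGraph P Q).ConnectedComponent

theorem numComp_comm (P Q : PM n) : numComp P Q = numComp Q P := by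
  rw [numComp, unionGraph_comm, numComp]

theorem numComp_smul (g : Perm (Fin n)) (P Q : PM n) : numComp (g • P) (g • Q) = numComp P Q :=
  (Nat.card_congr (unionGraphIso g P Q).connectedComponentEquiv).symm

theorem apply_eq_of_reachable {V α : Type*} {G : SimpleGraph V} {f : V → α}
    (hf : ∀ x y, G.Adj x y → f x = f y) {x y : V} (h : G.Reachable x y) : f x = f y := by
  obtain ⟨w⟩ := h
  induction w with
  | nil => rfl
  | cons hadj _ ih => exact (hf _ _ hadj).trans ih

theorem card_le_numComp {α : Type*} {P Q : PM n} (f : Fin n → α)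
    (hP : ∀ x y, s(x, y) ∈ P.1 → f x = f y) (hQ : ∀ x y, s(x, y) ∈ Q.1 → f x = f y)
    (S : Finset α) (hS : ∀ a ∈ S, ∃ x, f x = a) : S.card ≤ numComp P Q := by
  have hf : ∀ x y, (unionGraph P Q).Adj x y → f x = f y := fun x y h =>
    ((unionGraph_adj P Q x y).1 h).elim (hP x y) (hQ x y)
  choose g hg using hS
  rw [← Nat.card_eq_finsetCard, numComp]
  refine Nat.card_le_card_of_injective
    (fun a : S => (unionGraph P Q).connectedComponentMk (g a a.2)) fun a b hab => Subtype.ext ?_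
  rw [← hg a a.2, ← hg b b.2]
  exact apply_eq_of_reachable hf (SimpleGraph.ConnectedComponent.exact hab)

/-- The functions that are constant on the components of the union of two matchings. -/
def compFun (P Q : PM n) : Submodule ℝ (Fin n → ℝ) where
  carrier := {f | ∀ x y, (unionGraph P Q).Adj x y → f x = f y}
  add_mem' hf hg x y h := by simp [hf x y h, hg x y h]
  zero_mem' _ _ _ := rfl
  smul_mem' c f hf x y h := by simp [hf x y h]

theorem finrank_compFun (P Q : PM n) : Module.finrank ℝ (compFun P Q) = numComp P Q := by
  classical
  let e : ((unionGraph P Q).ConnectedComponent → ℝ) ≃ₗ[ℝ] compFun P Q :=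
    { toFun := fun F => ⟨fun x => F ((unionGraph P Q).connectedComponentMk x), fun x y h =>
        congrArg F (SimpleGraph.ConnectedComponent.connectedComponentMk_eq_of_adj h)⟩
      map_add' := fun _ _ => rfl
      map_smul' := fun _ _ => rfl
      invFun := fun f => SimpleGraph.ConnectedComponent.lift f.1 fun x y w _ =>
        apply_eq_of_reachable f.2 ⟨w⟩
      left_inv := fun F => funext fun c => by
        induction c using SimpleGraph.ConnectedComponent.ind with | h x => rfl
      right_inv := fun f => rfl }
  have : Fintype (unionGraph P Q).ConnectedComponent := Fintype.ofFinite _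
  rw [← e.finrank_eq, Module.finrank_fintype_fun_eq_card, numComp, Nat.card_eq_fintype_card]

/-- Moving one endpoint of a common edge into another component joins two components. -/
theorem numComp_swap_smul {P Q : PM n} {a b i : Fin n} (hP : s(a, b) ∈ P.1) (hQ : s(a, b) ∈ Q.1)
    (hia : i ≠ a) (hib : i ≠ b) : numComp P (swap i a • Q) + 1 = numComp P Q := by
  have hab := P.ne_of_mem hP
  have hmem : ∀ f, f ∈ compFun P (swap i a • Q) ↔ f ∈ compFun P Q ∧ f a = f i := by
    intro f
    have hfs : f a = f i → ∀ x, f (swap i a x) = f x := fun h x => by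
      rw [swap_apply_def]; split_ifs with h1 h2 <;> simp [*]
    constructor
    · intro hf
      have h1 := hf a b ((unionGraph_adj _ _ _ _).2 (Or.inl hP))
      have h2 := hf i b ((unionGraph_adj _ _ _ _).2 (Or.inr ((PM.mk_mem_smul_iff _ _ _ _).2
        (by simpa [swap_apply_of_ne_of_ne hib.symm hab.symm] using hQ))))
      have h3 : f a = f i := h1.trans h2.symm
      refine ⟨fun x y h => ?_, h3⟩
      rcases (unionGraph_adj _ _ _ _).1 h with h | h
      · exact hf x y ((unionGraph_adj _ _ _ _).2 (Or.inl h))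
      · rw [← hfs h3 x, ← hfs h3 y]
        exact hf _ _ ((unionGraph_adj _ _ _ _).2 (Or.inr ((PM.mk_mem_smul_iff _ _ _ _).2
          (by simpa using h))))
    · rintro ⟨hf, h3⟩ x y h
      rcases (unionGraph_adj _ _ _ _).1 h with h | h
      · exact hf x y ((unionGraph_adj _ _ _ _).2 (Or.inl h))
      · rw [← hfs h3 x, ← hfs h3 y]
        exact hf _ _ ((unionGraph_adj _ _ _ _).2 (Or.inr (by
          simpa using (PM.mk_mem_smul_iff _ _ _ _).1 h)))
  let L : compFun P Q →ₗ[ℝ] ℝ :=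
    (LinearMap.proj (R := ℝ) (φ := fun _ : Fin n => ℝ) a -
      LinearMap.proj (R := ℝ) (φ := fun _ : Fin n => ℝ) i) ∘ₗ (compFun P Q).subtype
  have hLsurj : LinearMap.range L = ⊤ := by
    rw [LinearMap.range_eq_top]
    refine LinearMap.surjective (f := L) fun h0 => ?_
    have hind : (fun x => if x = a ∨ x = b then (1 : ℝ) else 0) ∈ compFun P Q := by
      have key : ∀ R : PM n, s(a, b) ∈ R.1 → ∀ x y, s(x, y) ∈ R.1 →
          (x = a ∨ x = b → y = a ∨ y = b) := by
        rintro R hR x y hxy (rfl | rfl)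
        · exact Or.inr (R.mate_unique hxy hR)
        · exact Or.inl (R.mate_unique hxy (by rwa [Sym2.eq_swap]))
      intro x y h
      refine if_congr ?_ rfl rfl
      rcases (unionGraph_adj _ _ _ _).1 h with h | h
      · exact ⟨key P hP x y h, key P hP y x (by rwa [Sym2.eq_swap])⟩
      · exact ⟨key Q hQ x y h, key Q hQ y x (by rwa [Sym2.eq_swap])⟩
    have := LinearMap.congr_fun h0 ⟨_, hind⟩
    simp [L, hia, hib] at this
  have hker : (LinearMap.ker L).map (compFun P Q).subtype = compFun P (swap i a • Q) := by
    ext f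
    rw [hmem]
    simp only [Submodule.mem_map, LinearMap.mem_ker]
    constructor
    · rintro ⟨y, hy, rfl⟩
      exact ⟨y.2, by simpa [L, sub_eq_zero] using hy⟩
    · rintro ⟨hf, h3⟩
      exact ⟨⟨f, hf⟩, by simp [L, h3], rfl⟩
  have := L.finrank_range_add_finrank_ker
  rw [hLsurj, finrank_top, Module.finrank_self] at this
  rw [← finrank_compFun, ← finrank_compFun, ← hker,
    (Submodule.equivMapOfInjective _ (compFun P Q).injective_subtype _).finrank_eq.symm]
  lia

end Matchings

section BaseMatching

open Equiv Finset

theorem PM.apply_mem_smul_iff {n : ℕ} (g : Perm (Fin n)) (P : PM n) (x y : Fin n) :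
    s(g x, g y) ∈ (g • P).1 ↔ s(x, y) ∈ P.1 := by
  simp [PM.mk_mem_smul_iff]

theorem PM.smul_eq_self {n : ℕ} {g : Perm (Fin n)} {P : PM n}
    (h : ∀ x y, s(x, y) ∈ P.1 → s(g x, g y) ∈ P.1) : g • P = P :=
  PM.eq_of_forall_mem fun x y hxy => by
    simpa using h _ _ ((PM.mk_mem_smul_iff _ _ _ _).1 hxy)

open Classical in
/-- The matching whose edges join `2p` to `2p + 1`. -/
noncomputable def basePM (k : ℕ) : PM (2 * k) :=
  ⟨({e | ∃ x y : Fin (2 * k), e = s(x, y) ∧ (x : ℕ) / 2 = (y : ℕ) / 2 ∧ x ≠ y} : Finset _),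
    isPM_of_mate
    (fun x => by
      simp only [mem_filter, mem_univ, true_and, Sym2.eq_iff]
      rintro ⟨a, b, ⟨rfl, rfl⟩ | ⟨rfl, rfl⟩, -, h⟩ <;> exact h rfl) fun x => by
      refine ⟨⟨x / 2 * 2 + (1 - x % 2), by lia⟩, ?_, ?_⟩
      · simp only [mem_filter, mem_univ, true_and]
        exact ⟨_, _, rfl, by dsimp only; omega,
          fun h => by rw [Fin.ext_iff] at h; dsimp only at h; omega⟩
      · intro y hy
        simp only [mem_filter, mem_univ, true_and, Sym2.eq_iff] at hy
        obtain ⟨a, b, ⟨rfl, rfl⟩ | ⟨rfl, rfl⟩, h1, h2⟩ := hy <;>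
          (rw [Ne, Fin.ext_iff] at h2; ext; dsimp only; omega)⟩

theorem mk_mem_basePM {k : ℕ} (x y : Fin (2 * k)) :
    s(x, y) ∈ (basePM k).1 ↔ (x : ℕ) / 2 = (y : ℕ) / 2 ∧ x ≠ y := by
  simp only [basePM, mem_filter, mem_univ, true_and, Sym2.eq_iff]
  constructor
  · rintro ⟨a, b, ⟨rfl, rfl⟩ | ⟨rfl, rfl⟩, h1, h2⟩
    exacts [⟨h1, h2⟩, ⟨h1.symm, h2.symm⟩]
  · rintro ⟨h1, h2⟩
    exact ⟨x, y, Or.inl ⟨rfl, rfl⟩, h1, h2⟩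

variable {k : ℕ} [NeZero (2 * k)]

/-- The matching `Q` contains the edge joining `i` and `j`. -/
def PM.Joins (Q : PM (2 * k)) (i j : ℕ) : Prop :=
  s(Fin.ofNat (2 * k) i, Fin.ofNat (2 * k) j) ∈ Q.1

theorem val_ofNat_of_lt {i : ℕ} (hi : i < 2 * k) : (Fin.ofNat (2 * k) i : ℕ) = i :=
  Nat.mod_eq_of_lt hi

theorem ofNat_val (x : Fin (2 * k)) : Fin.ofNat (2 * k) x = x :=
  Fin.ext (val_ofNat_of_lt x.2)

theorem PM.Joins.symm {Q : PM (2 * k)} {i j : ℕ} (h : Q.Joins i j) : Q.Joins j i := by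
  rwa [PM.Joins, Sym2.eq_swap]

theorem PM.Joins.right_unique {Q : PM (2 * k)} {i j l : ℕ} (h : Q.Joins i j) (h' : Q.Joins i l)
    (hj : j < 2 * k) (hl : l < 2 * k) : j = l := by
  have := Q.mate_unique h h'
  rwa [Fin.ext_iff, val_ofNat_of_lt hj, val_ofNat_of_lt hl] at this

theorem PM.Joins.left_unique {Q : PM (2 * k)} {i j l : ℕ} (h : Q.Joins i l) (h' : Q.Joins j l)
    (hi : i < 2 * k) (hj : j < 2 * k) : i = j :=
  h.symm.right_unique h'.symm hi hj

theorem PM.Joins.ne {Q : PM (2 * k)} {i j : ℕ} (h : Q.Joins i j) : i ≠ j :=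
  fun hij => Q.ne_of_mem h (by rw [hij])

theorem PM.exists_joins (Q : PM (2 * k)) (i : ℕ) : ∃ j < 2 * k, Q.Joins i j := by
  obtain ⟨y, hy⟩ := Q.exists_mate (Fin.ofNat (2 * k) i)
  exact ⟨y, y.2, by rwa [PM.Joins, ofNat_val]⟩

theorem PM.eq_of_joins {P Q : PM (2 * k)}
    (h : ∀ i < 2 * k, ∀ j < 2 * k, P.Joins i j → Q.Joins i j) : P = Q :=
  PM.eq_of_forall_mem fun x y hxy => by
    simpa [PM.Joins, ofNat_val] using h x x.2 y y.2 (by simpa [PM.Joins, ofNat_val] using hxy)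

theorem basePM_joins {i j : ℕ} (hi : i < 2 * k) (hj : j < 2 * k) :
    (basePM k).Joins i j ↔ i / 2 = j / 2 ∧ i ≠ j := by
  rw [PM.Joins, mk_mem_basePM, val_ofNat_of_lt hi, val_ofNat_of_lt hj, Ne, Fin.ext_iff,
    val_ofNat_of_lt hi, val_ofNat_of_lt hj]

theorem basePM_joins_pair {p : ℕ} (hp : p < k) : (basePM k).Joins (2 * p) (2 * p + 1) :=
  (basePM_joins (by lia) (by lia)).2 (by lia)

theorem joins_swap_smul (Q : PM (2 * k)) {i j a b : ℕ} (hi : i < 2 * k) (hj : j < 2 * k)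
    (ha : a < 2 * k) (hb : b < 2 * k) :
    (swap (Fin.ofNat (2 * k) i) (Fin.ofNat (2 * k) j) • Q).Joins a b ↔
      Q.Joins (swap i j a) (swap i j b) := by
  rw [PM.Joins, PM.mk_mem_smul_iff, swap_inv, swap_ofNat hi hj ha, swap_ofNat hi hj hb,
    PM.Joins]

/-- The number of components is at least the number of values of an invariant function. -/
theorem card_le_numComp_basePM {α : Type*} {Q : PM (2 * k)} (f : ℕ → α)
    (hQ : ∀ i < 2 * k, ∀ j < 2 * k, Q.Joins i j → f (i / 2) = f (j / 2)) (S : Finset α)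
    (hS : ∀ a ∈ S, ∃ p < k, f p = a) : S.card ≤ numComp (basePM k) Q := by
  refine card_le_numComp (fun x => f (x / 2)) (fun x y h => by rw [((mk_mem_basePM x y).1 h).1])
    (fun x y h => hQ x x.2 y y.2 (by simpa [PM.Joins, ofNat_val] using h)) S fun a ha => ?_
  obtain ⟨p, hp, rfl⟩ := hS a ha
  refine ⟨Fin.ofNat (2 * k) (2 * p), ?_⟩
  rw [val_ofNat_of_lt (by lia), show 2 * p / 2 = p by lia]

theorem numComp_basePM_self : numComp (basePM k) (basePM k) = k := by
  refine le_antisymm ?_ ?_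
  · refine (Nat.card_le_card_of_surjective (fun p : Fin k =>
      (unionGraph (basePM k) (basePM k)).connectedComponentMk (Fin.ofNat (2 * k) (2 * p)))
      fun c => ?_).trans_eq (Nat.card_fin k)
    induction c using SimpleGraph.ConnectedComponent.ind with
    | h x =>
      refine ⟨⟨x / 2, by lia⟩, ?_⟩
      rcases eq_or_ne (Fin.ofNat (2 * k) (2 * (x / 2))) x with h | h
      · simp only [h]
      · refine SimpleGraph.ConnectedComponent.connectedComponentMk_eq_of_adj
          ((unionGraph_adj _ _ _ _).2 (Or.inl ((mk_mem_basePM _ _).2 ⟨?_, h⟩)))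
        rw [val_ofNat_of_lt (by lia)]
        lia
  · simpa using card_le_numComp_basePM (Q := basePM k) id
      (fun i hi j hj h => ((basePM_joins hi hj).1 h).1) (range k) fun a ha =>
        ⟨a, by simpa using ha, rfl⟩

/-- The matchings `Q` containing the edges `{2p, 2p + 1}` with `j ≤ p` whose remaining vertices
form a single component of `basePM k ∪ Q`. -/
def IsCycleBelow (j : ℕ) (Q : PM (2 * k)) : Prop :=
  (∀ p, j ≤ p → p < k → Q.Joins (2 * p) (2 * p + 1)) ∧ numComp (basePM k) Q + j = k + 1

theorem eq_basePM_of_joins {Q : PM (2 * k)} (h : ∀ p < k, Q.Joins (2 * p) (2 * p + 1)) :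
    Q = basePM k := by
  refine (PM.eq_of_joins fun i hi j hj hij => ?_).symm
  rw [basePM_joins hi hj] at hij
  obtain h' | h' : j = i + 1 ∨ i = j + 1 := by lia
  · have := h (i / 2) (by lia)
    rwa [show 2 * (i / 2) = i by lia, ← h'] at this
  · have := h (j / 2) (by lia)
    rw [show 2 * (j / 2) = j by lia, ← h'] at this
    exact this.symm

theorem PM.joins_le {Q : PM (2 * k)} {j m : ℕ} (hm : m < 2 * k)
    (h : ∀ p, j + 1 ≤ p → p < k → Q.Joins (2 * p) (2 * p + 1)) (hQm : Q.Joins m (2 * j + 1))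
    (hj : j < k) : m ≤ 2 * j := by
  by_contra hlt
  have hne := hQm.ne
  have h2 := h (m / 2) (by lia) (by lia)
  rcases Nat.even_or_odd' m with ⟨r, rfl | rfl⟩
  · rw [show 2 * r / 2 = r by lia] at h2
    have := hQm.right_unique h2 (by lia) (by lia)
    lia
  · rw [show (2 * r + 1) / 2 = r by lia] at h2
    have := hQm.right_unique h2.symm (by lia) (by lia)
    lia

theorem isCycleBelow_one {Q : PM (2 * k)} : IsCycleBelow 1 Q ↔ Q = basePM k := by
  constructor
  · rintro ⟨h, -⟩
    refine eq_basePM_of_joins fun p hp => ?_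
    rcases Nat.eq_zero_or_pos p with rfl | h0
    · obtain ⟨m, hm, hQm⟩ := Q.exists_joins 1
      have hle : m ≤ 2 * 0 := PM.joins_le hm h hQm.symm hp
      obtain rfl : m = 0 := by lia
      exact hQm.symm
    · exact h p h0 hp
  · rintro rfl
    exact ⟨fun p _ hp => basePM_joins_pair hp, by rw [numComp_basePM_self]⟩

/-- The symmetric group acts transitively on the perfect matchings. -/
theorem exists_smul_eq_basePM (Q : PM (2 * k)) : ∃ g : Perm (Fin (2 * k)), g • Q = basePM k := by
  have key : ∀ j ≤ k, ∀ Q : PM (2 * k), (∀ p, j ≤ p → p < k → Q.Joins (2 * p) (2 * p + 1)) →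
      ∃ g : Perm (Fin (2 * k)), g • Q = basePM k := by
    intro j
    induction j with
    | zero => exact fun _ Q h => ⟨1, by
        rw [one_smul]; exact eq_basePM_of_joins fun p hp => h p (by lia) hp⟩
    | succ j ih =>
      intro hj Q h
      obtain ⟨m, hm, hQm⟩ := Q.exists_joins (2 * j + 1)
      have hle := PM.joins_le hm h hQm.symm hj
      obtain ⟨g, hg⟩ := ih (by lia)
        (swap (Fin.ofNat (2 * k) m) (Fin.ofNat (2 * k) (2 * j)) • Q) fun p hp hpk => by
          rw [joins_swap_smul Q (by lia) (by lia) (by lia) (by lia),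
            swap_apply_of_ne_of_ne (x := 2 * p + 1) (by lia) (by lia)]
          rcases hp.eq_or_lt with rfl | hp
          · rw [swap_apply_right]; exact hQm.symm
          · rw [swap_apply_of_ne_of_ne (by lia) (by lia)]; exact h p hp hpk
      exact ⟨_, (mul_smul _ _ _).trans hg⟩
  exact key k le_rfl Q fun p hp hpk => absurd hpk (by lia)

theorem numComp_basePM_swap_smul {Q : PM (2 * k)} {a p : ℕ} (hp : p < k) (ha : a < 2 * k)
    (h1 : a ≠ 2 * p) (h2 : Q.Joins a (2 * p + 1)) :
    numComp (basePM k) (swap (Fin.ofNat (2 * k) a) (Fin.ofNat (2 * k) (2 * p)) • Q) =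
      numComp (basePM k) Q + 1 := by
  have h := numComp_swap_smul (P := basePM k)
    (Q := swap (Fin.ofNat (2 * k) a) (Fin.ofNat (2 * k) (2 * p)) • Q)
    (a := Fin.ofNat (2 * k) (2 * p)) (b := Fin.ofNat (2 * k) (2 * p + 1))
    (i := Fin.ofNat (2 * k) a) (basePM_joins_pair hp)
    ((joins_swap_smul Q ha (by lia) (by lia) (by lia)).2 (by
      rw [swap_apply_right, swap_apply_of_ne_of_ne h2.ne.symm (by lia)]
      exact h2))
    (by rwa [Ne, Fin.ext_iff, val_ofNat_of_lt ha, val_ofNat_of_lt (by lia)])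
    (by rw [Ne, Fin.ext_iff, val_ofNat_of_lt ha, val_ofNat_of_lt (by lia)]; exact h2.ne)
  rwa [← mul_smul, swap_mul_self, one_smul, eq_comm] at h

end BaseMatching

section CycleBelow

open Equiv Finset

variable {k : ℕ} [NeZero (2 * k)]

theorem PM.Joins.div_two_eq {Q : PM (2 * k)} {i j : ℕ} (h : Q.Joins i j) (hi : i < 2 * k)
    (hj : j < 2 * k) (hp : Q.Joins (2 * (i / 2)) (2 * (i / 2) + 1)) : i / 2 = j / 2 := by
  obtain h' | h' : i = 2 * (i / 2) ∨ i = 2 * (i / 2) + 1 := by lia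
  · rw [← h'] at hp
    have := h.right_unique hp hj (by lia)
    lia
  · rw [← h'] at hp
    have := h.right_unique hp.symm hj (by lia)
    lia

theorem IsCycleBelow.exists_joins {j : ℕ} {Q : PM (2 * k)} (h : IsCycleBelow (j + 1) Q)
    (h1 : 1 ≤ j) (hj : j < k) : ∃ i < 2 * j, Q.Joins i (2 * j + 1) := by
  obtain ⟨m, hm, hQm⟩ := Q.exists_joins (2 * j + 1)
  refine ⟨m, ?_, hQm.symm⟩
  by_contra hlt
  have hmj : m / 2 ≠ j := by
    intro hmj
    have hm2 : m = 2 * j := by have := hQm.ne; lia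
    have hpair : ∀ p, j ≤ p → p < k → Q.Joins (2 * p) (2 * p + 1) := fun p hp hpk => by
      rcases hp.eq_or_lt with rfl | hp
      · exact hm2 ▸ hQm.symm
      · exact h.1 p hp hpk
    have := card_le_numComp_basePM (Q := Q) (fun p => max p (j - 1)) (fun a ha b hb hab => by
      rcases lt_or_ge (a / 2) j with h2 | h2
      · rcases lt_or_ge (b / 2) j with h3 | h3
        · lia
        · rw [hab.symm.div_two_eq hb ha (hpair _ h3 (by lia))]
      · rw [hab.div_two_eq ha hb (hpair _ h2 (by lia))]) (Icc (j - 1) (k - 1)) fun a ha => by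
        rw [mem_Icc] at ha
        exact ⟨a, by lia, by lia⟩
    rw [Nat.card_Icc] at this
    have := h.2
    lia
  have := hQm.symm.div_two_eq hm (by lia) (h.1 (m / 2) (by lia) (by lia))
  lia

theorem isCycleBelow_swap_smul_iff {i j : ℕ} {Q : PM (2 * k)} (hi : i < 2 * j) (hj : j < k) :
    IsCycleBelow j (swap (Fin.ofNat (2 * k) i) (Fin.ofNat (2 * k) (2 * j)) • Q) ↔
      IsCycleBelow (j + 1) Q ∧ Q.Joins i (2 * j + 1) := by
  have hne : ∀ p, j < p → p < k →
      ((swap (Fin.ofNat (2 * k) i) (Fin.ofNat (2 * k) (2 * j)) • Q).Joins (2 * p) (2 * p + 1) ↔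
        Q.Joins (2 * p) (2 * p + 1)) := fun p hp hpk => by
    rw [joins_swap_smul Q (by lia) (by lia) (by lia) (by lia),
      swap_apply_of_ne_of_ne (by lia) (by lia), swap_apply_of_ne_of_ne (by lia) (by lia)]
  have heq : (swap (Fin.ofNat (2 * k) i) (Fin.ofNat (2 * k) (2 * j)) • Q).Joins
      (2 * j) (2 * j + 1) ↔ Q.Joins i (2 * j + 1) := by
    rw [joins_swap_smul Q (by lia) (by lia) (by lia) (by lia), swap_apply_right,
      swap_apply_of_ne_of_ne (by lia) (by lia)]
  constructor
  · rintro ⟨h1, h2⟩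
    have hQ := heq.1 (h1 j le_rfl hj)
    rw [numComp_basePM_swap_smul hj (by lia) (by lia) hQ] at h2
    exact ⟨⟨fun p hp hpk => (hne p hp hpk).1 (h1 p (by lia) hpk), by lia⟩, hQ⟩
  · rintro ⟨⟨h1, h2⟩, hQ⟩
    refine ⟨fun p hp hpk => ?_, ?_⟩
    · rcases hp.eq_or_lt with rfl | hp
      · exact heq.2 hQ
      · exact (hne p hp hpk).2 (h1 p hp hpk)
    · rw [numComp_basePM_swap_smul hj (by lia) (by lia) hQ]
      lia

open Classical in
theorem sum_isCycleBelow_swap_smul {j : ℕ} (Q : PM (2 * k)) (h1 : 1 ≤ j) (hj : j < k) :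
    (∑ i ∈ range (2 * j), if IsCycleBelow j
      (swap (Fin.ofNat (2 * k) i) (Fin.ofNat (2 * k) (2 * j)) • Q) then (1 : ℝ) else 0) =
      if IsCycleBelow (j + 1) Q then 1 else 0 := by
  by_cases h : IsCycleBelow (j + 1) Q
  · obtain ⟨m, hm, hQm⟩ := h.exists_joins h1 hj
    rw [if_pos h, sum_eq_single_of_mem m (mem_range.2 hm),
      if_pos ((isCycleBelow_swap_smul_iff hm hj).2 ⟨h, hQm⟩)]
    intro i hi him
    rw [mem_range] at hi
    refine if_neg fun h' => him ?_
    exact ((isCycleBelow_swap_smul_iff hi hj).1 h').2.left_unique hQm (by lia) (by lia)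
  · rw [if_neg h]
    refine sum_eq_zero fun i hi => if_neg fun h' => h ?_
    exact ((isCycleBelow_swap_smul_iff (mem_range.1 hi) hj).1 h').1

end CycleBelow

section PairSwap

open Equiv Finset

variable {k : ℕ} [NeZero (2 * k)]

/-- The permutation exchanging the edges `{2a, 2a + 1}` and `{2b, 2b + 1}`. -/
def pairSwap (k : ℕ) [NeZero (2 * k)] (a b : ℕ) : Perm (Fin (2 * k)) :=
  swap (Fin.ofNat (2 * k) (2 * a)) (Fin.ofNat (2 * k) (2 * b)) *
    swap (Fin.ofNat (2 * k) (2 * a + 1)) (Fin.ofNat (2 * k) (2 * b + 1))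

theorem pairSwap_apply {a b i : ℕ} (ha : a < k) (hb : b < k) (hi : i < 2 * k) :
    pairSwap k a b (Fin.ofNat (2 * k) i) = Fin.ofNat (2 * k) (2 * swap a b (i / 2) + i % 2) := by
  have hlt : swap (2 * a + 1) (2 * b + 1) i < 2 * k := by
    rw [swap_apply_def]; split_ifs <;> lia
  rw [pairSwap, Perm.mul_apply, swap_ofNat (by lia) (by lia) hi,
    swap_ofNat (by lia) (by lia) hlt]
  congr 1
  simp only [swap_apply_def]
  split_ifs <;> lia

theorem joins_pairSwap_smul (Q : PM (2 * k)) {a b i j : ℕ} (ha : a < k) (hb : b < k)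
    (hi : i < 2 * k) (hj : j < 2 * k) :
    (pairSwap k a b • Q).Joins (2 * swap a b (i / 2) + i % 2) (2 * swap a b (j / 2) + j % 2) ↔
      Q.Joins i j := by
  rw [PM.Joins, ← pairSwap_apply ha hb hi, ← pairSwap_apply ha hb hj, PM.apply_mem_smul_iff,
    PM.Joins]

theorem pairSwap_smul_basePM {a b : ℕ} (ha : a < k) (hb : b < k) :
    pairSwap k a b • basePM k = basePM k := by
  refine PM.smul_eq_self fun x y h => ?_
  rw [mk_mem_basePM] at *
  refine ⟨?_, fun h' => h.2 ((pairSwap k a b).injective h')⟩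
  rw [← ofNat_val x, ← ofNat_val y, pairSwap_apply ha hb x.2, pairSwap_apply ha hb y.2, h.1]
  have : swap a b ((y : ℕ) / 2) < k := by
    rw [swap_apply_def]; split_ifs <;> lia
  rw [val_ofNat_of_lt (by lia), val_ofNat_of_lt (by lia)]
  lia

theorem numComp_basePM_pairSwap_smul (Q : PM (2 * k)) {a b : ℕ} (ha : a < k) (hb : b < k) :
    numComp (basePM k) (pairSwap k a b • Q) = numComp (basePM k) Q := by
  rw [← numComp_smul (pairSwap k a b) (basePM k) Q, pairSwap_smul_basePM ha hb]

end PairSwap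

section Classes

open Equiv Finset

theorem exists_ne_ne {k p q : ℕ} (hk : 3 ≤ k) : ∃ r < k, r ≠ p ∧ r ≠ q := by
  by_contra! h
  have h0 := h 0
  have h1 := h 1
  have h2 := h 2
  lia

theorem numComp_eq_one_iff {n : ℕ} [NeZero n] (P Q : PM n) :
    numComp P Q = 1 ↔ (unionGraph P Q).Connected := by
  rw [numComp, Nat.card_eq_one_iff_unique]
  constructor
  · rintro ⟨h1, ⟨c⟩⟩
    exact ⟨fun x y => SimpleGraph.ConnectedComponent.exact (Subsingleton.elim _ _)⟩
  · intro h
    exact ⟨h.preconnected.subsingleton_connectedComponent,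
      ⟨(unionGraph P Q).connectedComponentMk (Fin.ofNat _ 0)⟩⟩

variable {k : ℕ} [NeZero (2 * k)]

open Classical in
theorem card_basePM_inter (Q : PM (2 * k)) :
    ((basePM k).1 ∩ Q.1).card = #{p ∈ range k | Q.Joins (2 * p) (2 * p + 1)} := by
  refine (card_bij (fun p _ => s(Fin.ofNat (2 * k) (2 * p), Fin.ofNat (2 * k) (2 * p + 1)))
    ?_ ?_ ?_).symm
  · intro p hp
    rw [mem_filter, mem_range] at hp
    exact mem_inter.2 ⟨basePM_joins_pair hp.1, hp.2⟩
  · intro p hp q hq h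
    rw [mem_filter, mem_range] at hp hq
    have h' : (basePM k).Joins (2 * p) (2 * q + 1) := by
      rcases Sym2.eq_iff.1 h with h | h
      · rw [PM.Joins, h.1]; exact basePM_joins_pair hq.1
      · rw [PM.Joins, h.1]
        rw [ofNat_inj_of_lt (by lia) (by lia)] at h
        lia
    rw [basePM_joins (by lia) (by lia)] at h'
    lia
  · intro e he
    rw [mem_inter] at he
    induction e with
    | h x y =>
      obtain ⟨h1, h2⟩ := (mk_mem_basePM x y).1 he.1
      rw [Ne, Fin.ext_iff] at h2
      have hQ : Q.Joins x y := by rw [PM.Joins, ofNat_val, ofNat_val]; exact he.2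
      obtain ⟨hx, hy⟩ | ⟨hx, hy⟩ : (x : ℕ) = 2 * (x / 2) ∧ (y : ℕ) = 2 * (x / 2) + 1 ∨
        (y : ℕ) = 2 * (x / 2) ∧ (x : ℕ) = 2 * (x / 2) + 1 := by lia
      · refine ⟨x / 2, ?_, ?_⟩
        · rw [mem_filter, mem_range, ← hy, ← hx]
          exact ⟨by lia, hQ⟩
        · rw [← hy, ← hx, ofNat_val, ofNat_val]
      · refine ⟨x / 2, ?_, ?_⟩
        · rw [mem_filter, mem_range, ← hy, ← hx]
          exact ⟨by lia, hQ.symm⟩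
        · rw [← hy, ← hx, ofNat_val, ofNat_val, Sym2.eq_swap]

theorem basePM_inter_eq_empty_iff (Q : PM (2 * k)) :
    (basePM k).1 ∩ Q.1 = ∅ ↔ ∀ p < k, ¬ Q.Joins (2 * p) (2 * p + 1) := by
  classical
  rw [← card_eq_zero, card_basePM_inter, card_eq_zero, filter_eq_empty_iff]
  simp

theorem three_le_numComp {Q : PM (2 * k)} {s t : Set ℕ} (hs : ∀ i < 2 * k, ∀ j < 2 * k,
    Q.Joins i j → i / 2 ∈ s → j / 2 ∈ s) (ht : ∀ i < 2 * k, ∀ j < 2 * k,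
    Q.Joins i j → i / 2 ∈ t → j / 2 ∈ t) {p q r : ℕ} (hp : p < k) (hq : q < k) (hr : r < k)
    (hps : p ∈ s) (hqs : q ∉ s) (hqt : q ∈ t) (hrs : r ∉ s) (hrt : r ∉ t) :
    3 ≤ numComp (basePM k) Q := by
  classical
  refine card_le_numComp_basePM (Q := Q) (fun i => if i ∈ s then 1 else if i ∈ t then 2 else 0)
    (fun i hi j hj h => ?_) {1, 2, 0} ?_
  · rw [show i / 2 ∈ s ↔ j / 2 ∈ s from ⟨hs i hi j hj h, hs j hj i hi h.symm⟩,
      show i / 2 ∈ t ↔ j / 2 ∈ t from ⟨ht i hi j hj h, ht j hj i hi h.symm⟩]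
  · intro a ha
    simp only [mem_insert, mem_singleton] at ha
    rcases ha with rfl | rfl | rfl
    exacts [⟨p, hp, by simp [hps]⟩, ⟨q, hq, by simp [hqs, hqt]⟩, ⟨r, hr, by simp [hrs, hrt]⟩]

theorem two_le_numComp {Q : PM (2 * k)} {p : ℕ} (hk : 2 ≤ k) (hp : p < k)
    (h : Q.Joins (2 * p) (2 * p + 1)) : 2 ≤ numComp (basePM k) Q := by
  refine card_le_numComp_basePM (fun i => decide (i = p)) (fun i hi j hj hij => ?_) {true, false} ?_
  · rw [decide_eq_decide]
    constructor <;> intro hp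
    · rw [← hij.div_two_eq hi hj (by rwa [hp]), hp]
    · rw [← hij.symm.div_two_eq hj hi (by rwa [hp]), hp]
  · simp only [mem_insert, mem_singleton]
    rintro a (rfl | rfl)
    · exact ⟨p, hp, by simp⟩
    · obtain ⟨q, hq, hqp⟩ : ∃ q < k, q ≠ p := by
        rcases Nat.eq_zero_or_pos p with rfl | h
        exacts [⟨1, by lia, by lia⟩, ⟨0, by lia, by lia⟩]
      exact ⟨q, hq, by simpa using hqp⟩

theorem isCycleBelow_iff_connected (Q : PM (2 * k)) (hk : 2 ≤ k) :
    (basePM k).1 ∩ Q.1 = ∅ ∧ (unionGraph (basePM k) Q).Connected ↔ IsCycleBelow k Q := by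
  rw [← numComp_eq_one_iff, IsCycleBelow, basePM_inter_eq_empty_iff]
  constructor
  · rintro ⟨-, h⟩
    exact ⟨fun p _ _ => by lia, by lia⟩
  · rintro ⟨-, h⟩
    exact ⟨fun p hp h' => by have := two_le_numComp hk hp h'; lia, by lia⟩

open Classical in
theorem sum_joins_pair (Q : PM (2 * k)) (hk : 3 ≤ k) :
    (∑ p ∈ range k, if Q.Joins (2 * p) (2 * p + 1) ∧ numComp (basePM k) Q = 2 then (1 : ℝ) else 0) =
      if ((basePM k).1 ∩ Q.1).card = 1 ∧ numComp (basePM k) Q = 2 then 1 else 0 := by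
  by_cases h2 : numComp (basePM k) Q = 2
  swap
  · simp [h2]
  simp only [h2, and_true]
  rw [sum_boole, card_basePM_inter]
  have h1 : #{p ∈ range k | Q.Joins (2 * p) (2 * p + 1)} ≤ 1 := by
    rw [card_le_one]
    intro p hp q hq
    rw [mem_filter, mem_range] at hp hq
    by_contra hpq
    obtain ⟨r, hr, hrp, hrq⟩ := exists_ne_ne (p := p) (q := q) hk
    have hclosed : ∀ p, Q.Joins (2 * p) (2 * p + 1) → ∀ i < 2 * k, ∀ j < 2 * k,
        Q.Joins i j → i / 2 ∈ ({p} : Set ℕ) → j / 2 ∈ ({p} : Set ℕ) := by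
      intro p hp i hi j hj hij h
      rw [Set.mem_singleton_iff] at *
      rw [← hij.div_two_eq hi hj (h ▸ hp), h]
    have := three_le_numComp (hclosed p hp.2) (hclosed q hq.2) hp.1 hq.1 hr rfl
      (Ne.symm hpq) rfl hrp hrq
    lia
  split_ifs with h
  · simp [h]
  · have : #{p ∈ range k | Q.Joins (2 * p) (2 * p + 1)} = 0 := by lia
    simp [this]

/-- `Q` joins the edges `{2p, 2p + 1}` and `{2q, 2q + 1}` to a four-cycle. -/
def PM.IsFourCycle (Q : PM (2 * k)) (p q : ℕ) : Prop :=
  Q.Joins (2 * p) (2 * q) ∧ Q.Joins (2 * p + 1) (2 * q + 1) ∨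
    Q.Joins (2 * p) (2 * q + 1) ∧ Q.Joins (2 * p + 1) (2 * q)

theorem PM.IsFourCycle.symm {Q : PM (2 * k)} {p q : ℕ} (h : Q.IsFourCycle p q) :
    Q.IsFourCycle q p :=
  h.imp (fun h => ⟨h.1.symm, h.2.symm⟩) fun h => ⟨h.2.symm, h.1.symm⟩

theorem PM.IsFourCycle.div_two_eq {Q : PM (2 * k)} {p q i j : ℕ} (h : Q.IsFourCycle p q)
    (hq : q < k) (hi : i < 2 * k) (hj : j < 2 * k) (hij : Q.Joins i j)
    (hip : i / 2 = p) : j / 2 = q := by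
  obtain rfl | rfl : i = 2 * p ∨ i = 2 * p + 1 := by lia
  all_goals
    rcases h with h | h
    · first
      | (have := hij.right_unique h.1 hj (by lia); lia)
      | (have := hij.right_unique h.2 hj (by lia); lia)
    · first
      | (have := hij.right_unique h.1 hj (by lia); lia)
      | (have := hij.right_unique h.2 hj (by lia); lia)

theorem PM.IsFourCycle.mem_of_mem {Q : PM (2 * k)} {p q : ℕ} (h : Q.IsFourCycle p q)
    (hp : p < k) (hq : q < k) : ∀ i < 2 * k, ∀ j < 2 * k,
      Q.Joins i j → i / 2 ∈ ({p, q} : Set ℕ) → j / 2 ∈ ({p, q} : Set ℕ) := by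
  rintro i hi j hj hij (h' | h')
  · exact Or.inr (h.div_two_eq hq hi hj hij h')
  · exact Or.inl (h.symm.div_two_eq hp hi hj hij h')

theorem PM.IsFourCycle.eq_or_eq {Q : PM (2 * k)} {p q r s : ℕ} (hk : 5 ≤ k)
    (h2 : numComp (basePM k) Q = 2) (h : Q.IsFourCycle p q) (h' : Q.IsFourCycle r s)
    (hp : p < k) (hq : q < k) (hr : r < k) (hs : s < k) : r = p ∧ s = q ∨ r = q ∧ s = p := by
  have hmate : ∀ {p q r s : ℕ}, Q.IsFourCycle p q → Q.IsFourCycle r s → p < k → q < k → r < k →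
      s < k → r = p → s = q := by
    intro p q r s h h' hp hq hr hs hrp
    obtain ⟨j, hj, hij⟩ := Q.exists_joins (2 * r)
    rw [← h'.div_two_eq hs (by lia) hj hij (by lia),
      ← h.div_two_eq hq (by lia) hj hij (by lia)]
  by_cases hrp : r = p
  · exact Or.inl ⟨hrp, hmate h h' hp hq hr hs hrp⟩
  by_cases hrq : r = q
  · exact Or.inr ⟨hrq, hmate h.symm h' hq hp hr hs hrq⟩
  exfalso
  obtain ⟨t, ht, ht1⟩ : ∃ t < k, t ≠ p ∧ t ≠ q ∧ t ≠ r ∧ t ≠ s := by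
    by_contra! h
    have h0 := h 0
    have h1 := h 1
    have h2 := h 2
    have h3 := h 3
    have h4 := h 4
    lia
  have := three_le_numComp (h.mem_of_mem hp hq) (h'.mem_of_mem hr hs) hp hr ht (Or.inl rfl)
    (by simp [hrp, hrq]) (Or.inl rfl) (by simp [ht1]) (by simp [ht1])
  lia

end Classes

section FourCycle

open Equiv Finset

variable {k : ℕ} [NeZero (2 * k)]

theorem ncard_div_two_mem {p q : ℕ} (hp : p < k) (hq : q < k) (hpq : p ≠ q) :
    {x : Fin (2 * k) | (x : ℕ) / 2 = p ∨ (x : ℕ) / 2 = q}.ncard = 4 := by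
  have hinj : Set.InjOn (Fin.ofNat (2 * k)) ({2 * p, 2 * p + 1, 2 * q, 2 * q + 1} : Finset ℕ) := by
    intro i hi j hj h
    simp only [coe_insert, coe_singleton, Set.mem_insert_iff, Set.mem_singleton_iff] at hi hj
    exact (ofNat_inj_of_lt (by lia) (by lia)).1 h
  have hcard : #({2 * p, 2 * p + 1, 2 * q, 2 * q + 1} : Finset ℕ) = 4 := by
    repeat rw [card_insert_of_notMem (by simp only [mem_insert, mem_singleton]; lia)]
    rw [card_singleton]
  rw [← hcard, ← card_image_of_injOn hinj, ← Set.ncard_coe_finset]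
  congr 1
  ext x
  simp only [Set.mem_ofPred_eq, coe_image, Set.mem_image, mem_coe, mem_insert, mem_singleton]
  constructor
  · intro h
    exact ⟨x, by lia, ofNat_val x⟩
  · rintro ⟨i, hi, rfl⟩
    rw [val_ofNat_of_lt (by lia)]
    lia

theorem connectedComponentMk_eq_of_joins {Q : PM (2 * k)} {i j : ℕ}
    (h : (basePM k).Joins i j ∨ Q.Joins i j) :
    (unionGraph (basePM k) Q).connectedComponentMk (Fin.ofNat (2 * k) i) =
      (unionGraph (basePM k) Q).connectedComponentMk (Fin.ofNat (2 * k) j) :=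
  SimpleGraph.ConnectedComponent.connectedComponentMk_eq_of_adj ((unionGraph_adj _ _ _ _).2 h)

theorem connectedComponentMk_eq_of_div_two_eq {Q : PM (2 * k)} {i j : ℕ} (hi : i < 2 * k)
    (hj : j < 2 * k) (h : i / 2 = j / 2) :
    (unionGraph (basePM k) Q).connectedComponentMk (Fin.ofNat (2 * k) i) =
      (unionGraph (basePM k) Q).connectedComponentMk (Fin.ofNat (2 * k) j) := by
  rcases eq_or_ne i j with rfl | hij
  · rfl
  · exact connectedComponentMk_eq_of_joins (Or.inl ((basePM_joins hi hj).2 ⟨h, hij⟩))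

theorem PM.IsFourCycle.exists_component {Q : PM (2 * k)} {p q : ℕ} (h : Q.IsFourCycle p q)
    (hp : p < k) (hq : q < k) (hpq : p ≠ q) :
    ∃ c : (unionGraph (basePM k) Q).ConnectedComponent, c.supp.ncard = 4 := by
  refine ⟨(unionGraph (basePM k) Q).connectedComponentMk (Fin.ofNat (2 * k) (2 * p)), ?_⟩
  rw [← ncard_div_two_mem hp hq hpq]
  congr 1
  ext x
  simp only [SimpleGraph.ConnectedComponent.mem_supp_iff, Set.mem_ofPred_eq]
  constructor
  · intro hx
    have := apply_eq_of_reachable (f := fun x : Fin (2 * k) => (x : ℕ) / 2 ∈ ({p, q} : Set ℕ))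
      (fun x y hxy => propext ?_) (SimpleGraph.ConnectedComponent.exact hx)
    · simp only [Set.mem_insert_iff, Set.mem_singleton_iff] at this
      rw [this, val_ofNat_of_lt (by lia)]
      lia
    · rcases (unionGraph_adj _ _ _ _).1 hxy with h' | h'
      · rw [((mk_mem_basePM x y).1 h').1]
      · have hQ : Q.Joins x y := by rwa [PM.Joins, ofNat_val, ofNat_val]
        exact ⟨h.mem_of_mem hp hq x x.2 y y.2 hQ, h.mem_of_mem hp hq y y.2 x x.2 hQ.symm⟩
  · intro hx
    rw [← ofNat_val x]
    rcases hx with hx | hx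
    · exact connectedComponentMk_eq_of_div_two_eq x.2 (by lia) (by lia)
    · obtain ⟨j, hj, hxj⟩ := Q.exists_joins x
      rw [connectedComponentMk_eq_of_joins (Or.inr hxj)]
      have := h.symm.div_two_eq hp x.2 hj hxj hx
      exact connectedComponentMk_eq_of_div_two_eq hj (by lia) (by lia)

theorem PM.IsFourCycle.inter_eq_empty {Q : PM (2 * k)} {p q : ℕ} (h : Q.IsFourCycle p q)
    (hp : p < k) (hq : q < k) (hpq : p ≠ q) (hk : 4 ≤ k) (h2 : numComp (basePM k) Q = 2) :
    (basePM k).1 ∩ Q.1 = ∅ := by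
  rw [basePM_inter_eq_empty_iff]
  intro r hr hQ
  by_cases hrp : r = p
  · have := h.div_two_eq hq (by lia) (by lia) hQ (by lia)
    lia
  by_cases hrq : r = q
  · have := h.symm.div_two_eq hp (by lia) (by lia) hQ (by lia)
    lia
  obtain ⟨t, ht, ht1⟩ : ∃ t < k, t ≠ p ∧ t ≠ q ∧ t ≠ r := by
    by_contra! h
    have h0 := h 0
    have h1 := h 1
    have h2 := h 2
    have h3 := h 3
    lia
  have := three_le_numComp (Q := Q) (t := {r}) (h.mem_of_mem hp hq)
    (fun i hi j hj hij hir => by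
      rw [Set.mem_singleton_iff] at *
      rw [← hij.div_two_eq hi hj (hir ▸ hQ), hir]) hp hr ht (Or.inl rfl)
    (by simp [hrp, hrq]) rfl (by simp [ht1]) (by simp [ht1])
  lia

theorem exists_isFourCycle {Q : PM (2 * k)} (h0 : (basePM k).1 ∩ Q.1 = ∅)
    (hc : ∃ c : (unionGraph (basePM k) Q).ConnectedComponent, c.supp.ncard = 4) :
    ∃ p < k, ∃ q < k, p ≠ q ∧ Q.IsFourCycle p q := by
  rw [basePM_inter_eq_empty_iff] at h0
  obtain ⟨c, hc⟩ := hc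
  have hblock : ∀ x y : Fin (2 * k), (x : ℕ) / 2 = (y : ℕ) / 2 → x ∈ c.supp → y ∈ c.supp := by
    intro x y hxy hx
    rw [SimpleGraph.ConnectedComponent.mem_supp_iff] at *
    rw [← hx, ← ofNat_val x, ← ofNat_val y, connectedComponentMk_eq_of_div_two_eq x.2 y.2 hxy]
  obtain ⟨x, hx⟩ := c.nonempty_supp
  obtain ⟨y, hy, hyx⟩ : ∃ y ∈ c.supp, (y : ℕ) / 2 ≠ (x : ℕ) / 2 := by
    by_contra! h
    have hk : 1 < k := by
      have := Set.ncard_le_card c.supp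
      rw [hc, Nat.card_eq_fintype_card, Fintype.card_fin] at this
      lia
    obtain ⟨r, hr, hrx⟩ : ∃ r < k, r ≠ (x : ℕ) / 2 := by
      by_contra! h
      have h0 := h 0
      have h1 := h 1
      lia
    have hsub : insert (Fin.ofNat (2 * k) (2 * r)) c.supp ⊆
        {z : Fin (2 * k) | (z : ℕ) / 2 = (x : ℕ) / 2 ∨ (z : ℕ) / 2 = r} := by
      rintro z (rfl | hz)
      · right
        rw [val_ofNat_of_lt (by lia)]
        lia
      · exact Or.inl (h z hz)
    have h1 := Set.ncard_le_ncard hsub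
    rw [ncard_div_two_mem (by lia) hr hrx.symm, Set.ncard_insert_of_notMem fun h' => ?_, hc] at h1
    · lia
    · have := h _ h'
      rw [val_ofNat_of_lt (by lia)] at this
      lia
  have hsupp : {z : Fin (2 * k) | (z : ℕ) / 2 = (x : ℕ) / 2 ∨ (z : ℕ) / 2 = (y : ℕ) / 2} =
      c.supp := by
    refine Set.eq_of_subset_of_ncard_le ?_ ?_
    · rintro z (hz | hz)
      · exact hblock x z hz.symm hx
      · exact hblock y z hz.symm hy
    · rw [hc, ncard_div_two_mem (by lia) (by lia) hyx.symm]
  have hmate : ∀ i < 2 * k, i / 2 = (x : ℕ) / 2 →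
      ∃ j < 2 * k, j / 2 = (y : ℕ) / 2 ∧ Q.Joins i j := by
    intro i hi hix
    obtain ⟨j, hj, hij⟩ := Q.exists_joins i
    refine ⟨j, hj, ?_, hij⟩
    have hmem : Fin.ofNat (2 * k) j ∈ c.supp := by
      have hi' : Fin.ofNat (2 * k) i ∈ c.supp := by
        rw [← hsupp]
        exact Or.inl (by rw [val_ofNat_of_lt hi, hix])
      rw [SimpleGraph.ConnectedComponent.mem_supp_iff] at *
      rw [← hi', connectedComponentMk_eq_of_joins (Or.inr hij)]
    rw [← hsupp, Set.mem_ofPred_eq, val_ofNat_of_lt hj] at hmem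
    refine hmem.resolve_left fun hjx => h0 (x / 2) (by lia) ?_
    have := hij.ne
    obtain ⟨h3, h4⟩ | ⟨h3, h4⟩ : i = 2 * (x / 2) ∧ j = 2 * (x / 2) + 1 ∨
      j = 2 * (x / 2) ∧ i = 2 * (x / 2) + 1 := by lia
    · rwa [h3, h4] at hij
    · rw [h3, h4] at hij
      exact hij.symm
  refine ⟨x / 2, by lia, y / 2, by lia, hyx.symm, ?_⟩
  obtain ⟨a, ha, hay, hQa⟩ := hmate (2 * (x / 2)) (by lia) (by lia)
  obtain ⟨b, hb, hby, hQb⟩ := hmate (2 * (x / 2) + 1) (by lia) (by lia)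
  have hab : a ≠ b := by
    rintro rfl
    have := hQa.left_unique hQb (by lia) (by lia)
    lia
  obtain ⟨h3, h4⟩ | ⟨h3, h4⟩ : a = 2 * (y / 2) ∧ b = 2 * (y / 2) + 1 ∨
    a = 2 * (y / 2) + 1 ∧ b = 2 * (y / 2) := by lia
  · rw [h3] at hQa; rw [h4] at hQb
    exact Or.inl ⟨hQa, hQb⟩
  · rw [h3] at hQa; rw [h4] at hQb
    exact Or.inr ⟨hQa, hQb⟩

open Classical in
theorem sum_isFourCycle (Q : PM (2 * k)) (hk : 5 ≤ k) :
    (∑ p ∈ (range k).offDiag,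
      if Q.IsFourCycle p.1 p.2 ∧ numComp (basePM k) Q = 2 then (1 : ℝ) else 0) =
      2 * if (basePM k).1 ∩ Q.1 = ∅ ∧ numComp (basePM k) Q = 2 ∧
        ∃ c : (unionGraph (basePM k) Q).ConnectedComponent, c.supp.ncard = 4 then 1 else 0 := by
  by_cases h2 : numComp (basePM k) Q = 2
  swap
  · simp [h2]
  simp only [h2, and_true, true_and]
  split_ifs with h
  · obtain ⟨p, hp, q, hq, hpq, hQ⟩ := exists_isFourCycle h.1 h.2
    have : {r ∈ (range k).offDiag | Q.IsFourCycle r.1 r.2} = {(p, q), (q, p)} := by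
      ext ⟨r, s⟩
      simp only [mem_filter, mem_offDiag, mem_range, mem_insert, mem_singleton, Prod.mk.injEq]
      constructor
      · rintro ⟨⟨hr, hs, -⟩, h⟩
        exact hQ.eq_or_eq hk h2 h hp hq hr hs
      · rintro (⟨rfl, rfl⟩ | ⟨rfl, rfl⟩)
        exacts [⟨⟨hp, hq, hpq⟩, hQ⟩, ⟨⟨hq, hp, hpq.symm⟩, hQ.symm⟩]
    rw [sum_boole, this, card_pair fun h => hpq (Prod.mk.inj h).1]
    norm_num
  · rw [mul_zero]
    refine sum_eq_zero fun p hp => if_neg fun hQ => h ?_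
    rw [mem_offDiag, mem_range, mem_range] at hp
    exact ⟨hQ.inter_eq_empty hp.1 hp.2.1 hp.2.2 (by lia) h2,
      hQ.exists_component hp.1 hp.2.1 hp.2.2⟩

end FourCycle

section Weight

open Equiv Finset

open Classical in
/-- The entries of the weighted adjacency matrix, multiplied by `(2k - 6)!!`. -/
noncomputable def pmWeight {n : ℕ} (P Q : PM n) : ℝ :=
  1 / 4 * (if P.1 ∩ Q.1 = ∅ ∧ (unionGraph P Q).Connected then 1 else 0) +
    (if (P.1 ∩ Q.1).card = 1 ∧ numComp P Q = 2 then 1 else 0) +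
    (if P.1 ∩ Q.1 = ∅ ∧ numComp P Q = 2 ∧
      ∃ c : (unionGraph P Q).ConnectedComponent, c.supp.ncard = 4 then 1 else 0)

theorem pmWeight_comm {n : ℕ} (P Q : PM n) : pmWeight P Q = pmWeight Q P := by
  rw [pmWeight, pmWeight, unionGraph_comm, numComp_comm, Finset.inter_comm]

theorem inter_smul {n : ℕ} (g : Perm (Fin n)) (P Q : PM n) :
    (g • P).1 ∩ (g • Q).1 = (P.1 ∩ Q.1).image (Sym2.map g) :=
  (image_inter _ _ (Sym2.map.injective g.injective)).symm

theorem exists_component_iff_of_iso {V W : Type} {G : SimpleGraph V} {H : SimpleGraph W}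
    (φ : G ≃g H) (m : ℕ) : (∃ c : G.ConnectedComponent, c.supp.ncard = m) ↔
      ∃ c : H.ConnectedComponent, c.supp.ncard = m := by
  have key : ∀ {V W : Type} {G : SimpleGraph V} {H : SimpleGraph W} (_ : G ≃g H),
      (∃ c : G.ConnectedComponent, c.supp.ncard = m) →
        ∃ c : H.ConnectedComponent, c.supp.ncard = m := by
    rintro V W G H φ ⟨c, rfl⟩
    refine ⟨φ.connectedComponentEquiv c, ?_⟩
    rw [← Set.ncard_image_of_injective c.supp φ.injective]
    congr 1
    ext x
    rw [← φ.apply_symm_apply x, φ.injective.mem_set_image]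
    simp [SimpleGraph.ConnectedComponent.mem_supp_iff]
  exact ⟨key φ, key φ.symm⟩

open Classical in
theorem pmWeight_smul {n : ℕ} (g : Perm (Fin n)) (P Q : PM n) :
    pmWeight (g • P) (g • Q) = pmWeight P Q := by
  have h0 : (g • P).1 ∩ (g • Q).1 = ∅ ↔ P.1 ∩ Q.1 = ∅ := by rw [inter_smul, image_eq_empty]
  rw [pmWeight, pmWeight, numComp_smul, inter_smul,
    card_image_of_injective _ (Sym2.map.injective g.injective), ← inter_smul,
    if_congr (and_congr h0 (unionGraphIso g P Q).connected_iff.symm) rfl rfl,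
    if_congr (and_congr h0 (and_congr_right' (exists_component_iff_of_iso
      (unionGraphIso g P Q) 4).symm)) rfl rfl]

variable {k : ℕ} [NeZero (2 * k)]

theorem isCycleBelow_pred_iff {Q : PM (2 * k)} (hk : 1 ≤ k) :
    IsCycleBelow (k - 1) Q ↔
      Q.Joins (2 * (k - 1)) (2 * (k - 1) + 1) ∧ numComp (basePM k) Q = 2 := by
  constructor
  · rintro ⟨h1, h2⟩
    exact ⟨h1 _ le_rfl (by lia), by lia⟩
  · rintro ⟨h1, h2⟩
    refine ⟨fun p hp hpk => ?_, by lia⟩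
    rwa [show p = k - 1 by lia]

open Classical in
theorem isFourCycle_eq_add (Q : PM (2 * k)) (hk : 3 ≤ k) :
    (if Q.IsFourCycle (k - 2) (k - 1) ∧ numComp (basePM k) Q = 2 then (1 : ℝ) else 0) =
      (if IsCycleBelow (k - 2) (swap (Fin.ofNat (2 * k) (2 * (k - 2)))
        (Fin.ofNat (2 * k) (2 * (k - 2) + 2)) • Q) then 1 else 0) +
      (if IsCycleBelow (k - 2) (swap (Fin.ofNat (2 * k) (2 * (k - 2) + 1))
        (Fin.ofNat (2 * k) (2 * (k - 2) + 2)) • Q) then 1 else 0) := by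
  obtain ⟨m, rfl⟩ : ∃ m, k = m + 2 := ⟨k - 2, by lia⟩
  have hpairs : ∀ R : PM (2 * (m + 2)), IsCycleBelow m R ↔ (R.Joins (2 * m) (2 * m + 1) ∧
      R.Joins (2 * m + 2) (2 * m + 3)) ∧ numComp (basePM (m + 2)) R = 3 := by
    intro R
    constructor
    · rintro ⟨h1, h2⟩
      exact ⟨⟨h1 _ le_rfl (by lia), h1 (m + 1) (by lia) (by lia)⟩, by lia⟩
    · rintro ⟨⟨h1, h2⟩, h3⟩
      refine ⟨fun p hp hpk => ?_, by lia⟩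
      obtain rfl | rfl : p = m ∨ p = m + 1 := by lia
      exacts [h1, h2]
  have hcomp : ∀ a < 2 * m + 2, Q.Joins a (2 * m + 3) →
      numComp (basePM (m + 2)) (swap (Fin.ofNat (2 * (m + 2)) a)
        (Fin.ofNat (2 * (m + 2)) (2 * m + 2)) • Q) = numComp (basePM (m + 2)) Q + 1 :=
    fun a ha h => numComp_basePM_swap_smul (p := m + 1) (by lia) (by lia) (by lia) h
  have e1 : IsCycleBelow m (swap (Fin.ofNat (2 * (m + 2)) (2 * m))
      (Fin.ofNat (2 * (m + 2)) (2 * m + 2)) • Q) ↔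
      (Q.Joins (2 * m) (2 * m + 3) ∧ Q.Joins (2 * m + 1) (2 * m + 2)) ∧
        numComp (basePM (m + 2)) Q = 2 := by
    rw [hpairs, joins_swap_smul Q (by lia) (by lia) (by lia) (by lia),
      joins_swap_smul Q (by lia) (by lia) (by lia) (by lia), swap_apply_left, swap_apply_right,
      swap_apply_of_ne_of_ne (by lia) (by lia), swap_apply_of_ne_of_ne (by lia) (by lia)]
    constructor
    · rintro ⟨⟨h1, h2⟩, h3⟩
      rw [hcomp _ (by lia) h2] at h3
      exact ⟨⟨h2, h1.symm⟩, by lia⟩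
    · rintro ⟨⟨h2, h1⟩, h3⟩
      exact ⟨⟨h1.symm, h2⟩, by rw [hcomp _ (by lia) h2, h3]⟩
  have e2 : IsCycleBelow m (swap (Fin.ofNat (2 * (m + 2)) (2 * m + 1))
      (Fin.ofNat (2 * (m + 2)) (2 * m + 2)) • Q) ↔
      (Q.Joins (2 * m) (2 * m + 2) ∧ Q.Joins (2 * m + 1) (2 * m + 3)) ∧
        numComp (basePM (m + 2)) Q = 2 := by
    rw [hpairs, joins_swap_smul Q (by lia) (by lia) (by lia) (by lia),
      joins_swap_smul Q (by lia) (by lia) (by lia) (by lia), swap_apply_left, swap_apply_right,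
      swap_apply_of_ne_of_ne (by lia) (by lia), swap_apply_of_ne_of_ne (by lia) (by lia)]
    constructor
    · rintro ⟨⟨h1, h2⟩, h3⟩
      rw [hcomp _ (by lia) h2] at h3
      exact ⟨⟨h1, h2⟩, by lia⟩
    · rintro ⟨⟨h1, h2⟩, h3⟩
      exact ⟨⟨h1, h2⟩, by rw [hcomp _ (by lia) h2, h3]⟩
  rw [show m + 2 - 2 = m by lia, show m + 2 - 1 = m + 1 by lia, PM.IsFourCycle, e1, e2,
    show 2 * (m + 1) = 2 * m + 2 by lia]
  by_cases h1 : Q.Joins (2 * m) (2 * m + 2)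
  · have h2 : ¬ Q.Joins (2 * m) (2 * m + 3) := fun h => by
      have := h.right_unique h1 (by lia) (by lia)
      lia
    simp [h1, h2]
  · simp [h1]

theorem isFourCycle_pairSwap_smul (Q : PM (2 * k)) {a b p q : ℕ} (ha : a < k) (hb : b < k)
    (hp : p < k) (hq : q < k) :
    (pairSwap k a b • Q).IsFourCycle (swap a b p) (swap a b q) ↔ Q.IsFourCycle p q := by
  have key : ∀ e f, e < 2 → f < 2 →
      ((pairSwap k a b • Q).Joins (2 * swap a b p + e) (2 * swap a b q + f) ↔
        Q.Joins (2 * p + e) (2 * q + f)) := by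
    intro e f he hf
    rw [← joins_pairSwap_smul Q ha hb (show 2 * p + e < 2 * k by lia) (by lia),
      show (2 * p + e) / 2 = p by lia, show (2 * q + f) / 2 = q by lia,
      show (2 * p + e) % 2 = e by lia, show (2 * q + f) % 2 = f by lia]
  have h00 := key 0 0 (by lia) (by lia)
  have h01 := key 0 1 (by lia) (by lia)
  have h10 := key 1 0 (by lia) (by lia)
  have h11 := key 1 1 (by lia) (by lia)
  simp only [add_zero] at h00 h01 h10
  rw [PM.IsFourCycle, h00, h01, h10, h11, PM.IsFourCycle]

section Sums

variable {w : PM (2 * k) → ℝ} (hw : ∀ a < k, ∀ b < k, ∀ Q, w (pairSwap k a b • Q) = w Q)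

include hw

theorem sum_pairSwap (F G : PM (2 * k) → ℝ) {a b : ℕ} (ha : a < k) (hb : b < k)
    (h : ∀ Q, G (pairSwap k a b • Q) = F Q) : ∑ Q, F Q * w Q = ∑ Q, G Q * w Q := by
  refine Fintype.sum_equiv (MulAction.toPerm (pairSwap k a b)) _ _ fun Q => ?_
  rw [MulAction.toPerm_apply, h, hw a ha b hb]

open Classical in
theorem sum_joins_pair_eq {p : ℕ} (hp : p < k) :
    (∑ Q : PM (2 * k), (if Q.Joins (2 * p) (2 * p + 1) ∧ numComp (basePM k) Q = 2
      then (1 : ℝ) else 0) * w Q) =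
      ∑ Q, (if IsCycleBelow (k - 1) Q then 1 else 0) * w Q := by
  refine sum_pairSwap hw _ _ hp (show k - 1 < k by lia) fun Q => ?_
  refine if_congr ?_ rfl rfl
  rw [isCycleBelow_pred_iff (by lia), numComp_basePM_pairSwap_smul Q hp (by lia),
    ← joins_pairSwap_smul Q hp (show k - 1 < k by lia) (show 2 * p < 2 * k by lia) (by lia),
    show 2 * p / 2 = p by lia, show (2 * p + 1) / 2 = p by lia, swap_apply_left,
    show 2 * p % 2 = 0 by lia, show (2 * p + 1) % 2 = 1 by lia, add_zero]

open Classical in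
theorem sum_isFourCycle_eq {p q : ℕ} (hp : p < k) (hq : q < k) (hpq : p ≠ q) :
    (∑ Q : PM (2 * k), (if Q.IsFourCycle p q ∧ numComp (basePM k) Q = 2
      then (1 : ℝ) else 0) * w Q) =
      ∑ Q : PM (2 * k), (if Q.IsFourCycle (k - 2) (k - 1) ∧ numComp (basePM k) Q = 2
        then (1 : ℝ) else 0) * w Q := by
  have key : ∀ a b p q, a < k → b < k → p < k → q < k →
      (∑ Q : PM (2 * k), (if Q.IsFourCycle p q ∧ numComp (basePM k) Q = 2
        then (1 : ℝ) else 0) * w Q) = ∑ Q : PM (2 * k), (if Q.IsFourCycle (swap a b p)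
          (swap a b q) ∧ numComp (basePM k) Q = 2 then (1 : ℝ) else 0) * w Q := by
    intro a b p q ha hb hp hq
    refine sum_pairSwap hw _ _ ha hb fun Q => ?_
    refine if_congr ?_ rfl rfl
    rw [isFourCycle_pairSwap_smul Q ha hb hp hq, numComp_basePM_pairSwap_smul Q ha hb]
  have hq' : swap p (k - 2) q < k ∧ swap p (k - 2) q ≠ k - 2 := by
    constructor
    · rw [swap_apply_def]; split_ifs <;> lia
    · exact fun h => hpq ((swap p (k - 2)).injective (h.trans (swap_apply_left _ _).symm)).symm
  rw [key p (k - 2) p q hp (by lia) hp hq, swap_apply_left,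
    key (swap p (k - 2) q) (k - 1) _ _ hq'.1 (by lia) (by lia) hq'.1, swap_apply_left,
    swap_apply_of_ne_of_ne hq'.2.symm (by lia)]

open Classical in
theorem sum_pmWeight_mul (hk : 5 ≤ k) :
    ∑ Q, pmWeight (basePM k) Q * w Q =
      1 / 4 * ∑ Q, (if IsCycleBelow k Q then 1 else 0) * w Q +
      k * ∑ Q, (if IsCycleBelow (k - 1) Q then 1 else 0) * w Q +
      k * (k - 1) / 2 * (∑ Q, (if IsCycleBelow (k - 2) (swap (Fin.ofNat (2 * k) (2 * (k - 2)))
          (Fin.ofNat (2 * k) (2 * (k - 2) + 2)) • Q) then 1 else 0) * w Q +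
        ∑ Q, (if IsCycleBelow (k - 2) (swap (Fin.ofNat (2 * k) (2 * (k - 2) + 1))
          (Fin.ofNat (2 * k) (2 * (k - 2) + 2)) • Q) then 1 else 0) * w Q) := by
  have hc2 : ∑ Q : PM (2 * k), (if ((basePM k).1 ∩ Q.1).card = 1 ∧ numComp (basePM k) Q = 2
      then (1 : ℝ) else 0) * w Q =
      k * ∑ Q, (if IsCycleBelow (k - 1) Q then 1 else 0) * w Q := by
    simp_rw [← sum_joins_pair _ (show 3 ≤ k by lia), sum_mul]
    rw [sum_comm, sum_congr rfl fun p hp => sum_joins_pair_eq hw (mem_range.1 hp), sum_const,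
      card_range, nsmul_eq_mul]
  have hc3 : 2 * ∑ Q : PM (2 * k), (if (basePM k).1 ∩ Q.1 = ∅ ∧ numComp (basePM k) Q = 2 ∧
      ∃ c : (unionGraph (basePM k) Q).ConnectedComponent, c.supp.ncard = 4
        then (1 : ℝ) else 0) * w Q = k * (k - 1) * ∑ Q : PM (2 * k),
      (if Q.IsFourCycle (k - 2) (k - 1) ∧ numComp (basePM k) Q = 2
        then (1 : ℝ) else 0) * w Q := by
    rw [mul_sum]
    simp_rw [← mul_assoc (2 : ℝ), ← sum_isFourCycle _ hk, sum_mul]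
    rw [sum_comm]
    rw [sum_eq_card_nsmul fun p hp => sum_isFourCycle_eq hw
      (mem_range.1 (mem_offDiag.1 hp).1) (mem_range.1 (mem_offDiag.1 hp).2.1)
      (mem_offDiag.1 hp).2.2, offDiag_card, card_range, nsmul_eq_mul,
      Nat.cast_sub (Nat.le_mul_self k), Nat.cast_mul]
    ring
  simp_rw [isFourCycle_eq_add _ (show 3 ≤ k by lia), add_mul, sum_add_distrib] at hc3
  simp_rw [pmWeight, add_mul, sum_add_distrib, isCycleBelow_iff_connected _ (show 2 ≤ k by lia),
    mul_assoc, ← mul_sum]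
  rw [hc2]
  linear_combination 1 / 2 * hc3

end Sums

end Weight

section PermutationRepresentation

open Equiv Finset
open scoped InnerProductSpace

/-- The permutation representation on the real functions on the perfect matchings. -/
noncomputable def pmRep (n : ℕ) : Perm (Fin n) →* Module.End ℝ (EuclideanSpace ℝ (PM n)) where
  toFun g :=
    { toFun := fun x => WithLp.toLp 2 fun Q => x (g⁻¹ • Q)
      map_add' := fun _ _ => rfl
      map_smul' := fun _ _ => rfl }
  map_one' := by ext x Q; simp
  map_mul' g h := by ext x Q; simp [mul_smul]; rfl

theorem pmRep_apply {n : ℕ} (g : Perm (Fin n)) (x : EuclideanSpace ℝ (PM n)) (Q : PM n) :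
    pmRep n g x Q = x (g⁻¹ • Q) := rfl

theorem inner_pmRep {n : ℕ} (g : Perm (Fin n)) (x y : EuclideanSpace ℝ (PM n)) :
    ⟪pmRep n g x, pmRep n g y⟫_ℝ = ⟪x, y⟫_ℝ := by
  simp only [PiLp.inner_apply, pmRep_apply]
  exact Equiv.sum_comp (MulAction.toPerm g⁻¹) fun Q => ⟪x Q, y Q⟫_ℝ

theorem sum_pmWeight_pmRep {n : ℕ} (g : Perm (Fin n)) (x : EuclideanSpace ℝ (PM n)) (P : PM n) :
    ∑ Q, pmWeight P Q * pmRep n g x Q = ∑ Q, pmWeight (g⁻¹ • P) Q * x Q := by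
  rw [← Equiv.sum_comp (MulAction.toPerm g⁻¹) fun Q => pmWeight (g⁻¹ • P) Q * x Q]
  exact sum_congr rfl fun Q _ => by
    rw [MulAction.toPerm_apply, pmWeight_smul, pmRep_apply]

variable {k : ℕ} [NeZero (2 * k)]

theorem transp_pmRep_apply (i j : ℕ) (x : EuclideanSpace ℝ (PM (2 * k))) (Q : PM (2 * k)) :
    transp (pmRep (2 * k)) i j x Q = x (swap (Fin.ofNat (2 * k) i) (Fin.ofNat (2 * k) j) • Q) := by
  rw [transp, pmRep_apply, swap_inv]

theorem jm_pmRep_apply (m : ℕ) (x : EuclideanSpace ℝ (PM (2 * k))) (Q : PM (2 * k)) :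
    jm (pmRep (2 * k)) m x Q =
      ∑ i ∈ range m, x (swap (Fin.ofNat (2 * k) i) (Fin.ofNat (2 * k) m) • Q) := by
  rw [jm, LinearMap.sum_apply, WithLp.ofLp_sum, Finset.sum_apply]
  exact sum_congr rfl fun i _ => transp_pmRep_apply i m x Q

theorem sum_swap_smul (F G : PM (2 * k) → ℝ) (i j : ℕ) :
    ∑ Q, F Q * G (swap (Fin.ofNat (2 * k) i) (Fin.ofNat (2 * k) j) • Q) =
      ∑ Q, F (swap (Fin.ofNat (2 * k) i) (Fin.ofNat (2 * k) j) • Q) * G Q := by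
  rw [← Equiv.sum_comp (MulAction.toPerm (swap (Fin.ofNat (2 * k) i) (Fin.ofNat (2 * k) j)))
    fun Q => F (swap (Fin.ofNat (2 * k) i) (Fin.ofNat (2 * k) j) • Q) * G Q]
  exact sum_congr rfl fun Q _ => by
    rw [MulAction.toPerm_apply, ← mul_smul, swap_mul_self, one_smul]

theorem jm_mul_jmProd {V : Type*} [AddCommGroup V] [Module ℝ V] {N : ℕ} [NeZero N]
    (ρ : Perm (Fin N) →* Module.End ℝ V) {m n : ℕ} (hm : m < N) (hn : 2 * n < N) :
    Commute (jm ρ m) (jmProd ρ n) := by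
  induction n with
  | zero => exact Commute.one_right _
  | succ n ih => exact (jm_commute ρ hm hn).mul_right (ih (by lia))

theorem transp_mul_jmProd {V : Type*} [AddCommGroup V] [Module ℝ V] {N : ℕ} [NeZero N]
    (ρ : Perm (Fin N) →* Module.End ℝ V) {a b n : ℕ} (ha : 2 * n < a) (hb : 2 * n < b) (haN : a < N)
    (hbN : b < N) : Commute (transp ρ a b) (jmProd ρ n) := by
  induction n with
  | zero => exact Commute.one_right _
  | succ n ih =>
    exact Commute.mul_right (transp_mul_jm_of_gt ρ ha hb haN hbN) (ih (by lia) (by lia))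

open Classical in
theorem jmProd_pmRep_basePM {n : ℕ} (hn : n < k) (x : EuclideanSpace ℝ (PM (2 * k))) :
    jmProd (pmRep (2 * k)) n x (basePM k) =
      ∑ Q, (if IsCycleBelow (n + 1) Q then 1 else 0) * x Q := by
  induction n generalizing x with
  | zero => simp [jmProd, isCycleBelow_one]
  | succ n ih =>
    rw [jmProd, (jm_mul_jmProd _ (by lia) (by lia)).eq, Module.End.mul_apply, ih (by lia)]
    simp_rw [jm_pmRep_apply, mul_sum]
    rw [sum_comm]
    simp_rw [sum_swap_smul (fun Q => if IsCycleBelow (n + 1) Q then (1 : ℝ) else 0) x]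
    rw [sum_comm]
    simp_rw [← sum_mul]
    exact sum_congr rfl fun Q _ => by rw [sum_isCycleBelow_swap_smul Q (by lia) hn]

open Classical in
theorem transp_jmProd_pmRep_basePM {a b n : ℕ} (ha : 2 * n < a) (hb : 2 * n < b)
    (hak : a < 2 * k) (hbk : b < 2 * k) (x : EuclideanSpace ℝ (PM (2 * k))) :
    transp (pmRep (2 * k)) a b (jmProd (pmRep (2 * k)) n x) (basePM k) =
      ∑ Q, (if IsCycleBelow (n + 1)
        (swap (Fin.ofNat (2 * k) a) (Fin.ofNat (2 * k) b) • Q) then 1 else 0) * x Q := by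
  rw [← Module.End.mul_apply, (transp_mul_jmProd _ ha hb hak hbk).eq, Module.End.mul_apply,
    jmProd_pmRep_basePM (by lia)]
  simp_rw [transp_pmRep_apply]
  exact sum_swap_smul (fun Q => if IsCycleBelow (n + 1) Q then (1 : ℝ) else 0) x a b

theorem sum_pmWeight_basePM (hk : 5 ≤ k) (x : EuclideanSpace ℝ (PM (2 * k)))
    (hx : ∀ a < k, ∀ b < k, ∀ Q, x (pairSwap k a b • Q) = x Q) :
    ∑ Q, pmWeight (basePM k) Q * x Q =
      1 / 4 * jmProd (pmRep (2 * k)) (k - 1) x (basePM k) +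
      k * jmProd (pmRep (2 * k)) (k - 2) x (basePM k) + k * (k - 1) / 2 *
        (transp (pmRep (2 * k)) (2 * (k - 2)) (2 * (k - 2) + 2)
            (jmProd (pmRep (2 * k)) (k - 3) x) (basePM k) +
          transp (pmRep (2 * k)) (2 * (k - 2) + 1) (2 * (k - 2) + 2)
            (jmProd (pmRep (2 * k)) (k - 3) x) (basePM k)) := by
  classical
  rw [sum_pmWeight_mul hx hk, jmProd_pmRep_basePM (by lia), jmProd_pmRep_basePM (by lia),
    transp_jmProd_pmRep_basePM (by lia) (by lia) (by lia) (by lia),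
    transp_jmProd_pmRep_basePM (by lia) (by lia) (by lia) (by lia),
    show k - 1 + 1 = k by lia, show k - 2 + 1 = k - 1 by lia, show k - 3 + 1 = k - 2 by lia]

end PermutationRepresentation

section Subrepresentation

open scoped InnerProductSpace

/-- Every nonzero invariant subspace contains a minimal one. -/
theorem exists_minimal_invariant {G V : Type*} [Group G] [AddCommGroup V] [Module ℝ V]
    [FiniteDimensional ℝ V] (ρ : G →* Module.End ℝ V) {U : Submodule ℝ V}
    (hU : ∀ g, ∀ x ∈ U, ρ g x ∈ U) (h0 : U ≠ ⊥) :
    ∃ W ≤ U, (∀ g, ∀ x ∈ W, ρ g x ∈ W) ∧ W ≠ ⊥ ∧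
      ∀ W' ≤ W, (∀ g, ∀ x ∈ W', ρ g x ∈ W') → W' = ⊥ ∨ W' = W := by
  obtain ⟨W, ⟨hWU, hW, hW0⟩, hmin⟩ := wellFounded_lt.has_min
    {W : Submodule ℝ V | W ≤ U ∧ (∀ g, ∀ x ∈ W, ρ g x ∈ W) ∧ W ≠ ⊥} ⟨U, le_rfl, hU, h0⟩
  refine ⟨W, hWU, hW, hW0, fun W' hle hW' => or_iff_not_imp_left.2 fun hne => ?_⟩
  exact hle.eq_of_not_lt (hmin W' ⟨hle.trans hWU, hW', hne⟩)

/-- The restriction of a representation to an invariant subspace. -/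
def subRep {G V : Type*} [Group G] [AddCommGroup V] [Module ℝ V] (ρ : G →* Module.End ℝ V)
    {U : Submodule ℝ V} (hU : ∀ g, ∀ x ∈ U, ρ g x ∈ U) : G →* Module.End ℝ U where
  toFun g := (ρ g).restrict (hU g)
  map_one' := by ext x; simp
  map_mul' g h := by ext x; simp

theorem subRep_apply {G V : Type*} [Group G] [AddCommGroup V] [Module ℝ V]
    (ρ : G →* Module.End ℝ V) {U : Submodule ℝ V} (hU : ∀ g, ∀ x ∈ U, ρ g x ∈ U) (g : G) (x : U) :
    (subRep ρ hU g x : V) = ρ g x := rfl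

variable {V : Type*} [AddCommGroup V] [Module ℝ V] {N : ℕ} [NeZero N]
  (ρ : Equiv.Perm (Fin N) →* Module.End ℝ V) {U : Submodule ℝ V} (hU : ∀ g, ∀ x ∈ U, ρ g x ∈ U)

theorem transp_subRep (i j : ℕ) (x : U) : (transp (subRep ρ hU) i j x : V) = transp ρ i j x := rfl

theorem jm_subRep (m : ℕ) (x : U) : (jm (subRep ρ hU) m x : V) = jm ρ m x := by
  simp [jm, LinearMap.sum_apply, transp_subRep]

theorem jmProd_subRep (n : ℕ) (x : U) : (jmProd (subRep ρ hU) n x : V) = jmProd ρ n x := by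
  induction n with
  | zero => rfl
  | succ n ih => rw [jmProd, jmProd, Module.End.mul_apply, Module.End.mul_apply, jm_subRep, ih]

omit [NeZero N] in
theorem subRep_irreducible
    (h : ∀ W' ≤ U, (∀ g, ∀ x ∈ W', ρ g x ∈ W') → W' = ⊥ ∨ W' = U) (W : Submodule ℝ U)
    (hW : ∀ g, ∀ x ∈ W, subRep ρ hU g x ∈ W) : W = ⊥ ∨ W = ⊤ := by
  have hinj := Submodule.map_injective_of_injective (f := U.subtype) U.injective_subtype
  refine (h (W.map U.subtype) (Submodule.map_subtype_le _ _) ?_).imp (fun h => ?_) fun h => ?_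
  · rintro g _ ⟨x, hx, rfl⟩
    exact ⟨_, hW g x hx, rfl⟩
  · exact hinj (h.trans (Submodule.map_bot _).symm)
  · exact hinj (h.trans (Submodule.map_subtype_top _).symm)

end Subrepresentation

section Model

open Equiv
open scoped InnerProductSpace

variable {k : ℕ} [NeZero (2 * k)]

theorem swap_smul_basePM {p : ℕ} (hp : p < k) :
    swap (Fin.ofNat (2 * k) (2 * p)) (Fin.ofNat (2 * k) (2 * p + 1)) • basePM k = basePM k := by
  refine PM.eq_of_joins fun i hi j hj h => ?_
  rw [joins_swap_smul _ (by lia) (by lia) hi hj] at h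
  have h1 := swap_nat_lt (a := 2 * p) (b := 2 * p + 1) (m := 2 * k) (by lia) (by lia) hi
  have h2 := swap_nat_lt (a := 2 * p) (b := 2 * p + 1) (m := 2 * k) (by lia) (by lia) hj
  rw [basePM_joins h1 h2] at h
  rw [basePM_joins hi hj]
  simp only [swap_apply_def] at h
  split_ifs at h <;> lia

/-- The eigenvalue of the weighted adjacency matrix on an invariant subspace of an eigenspace is
computed by a domino model with the contents of a joint eigenvector in the subspace. -/
theorem exists_dominoModel_of_invariant (hk : 5 ≤ k) {θ : ℝ}
    {U : Submodule ℝ (EuclideanSpace ℝ (PM (2 * k)))}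
    (hU : ∀ g, ∀ x ∈ U, pmRep (2 * k) g x ∈ U) (h0 : U ≠ ⊥)
    (hθ : ∀ x ∈ U, ∀ P, ∑ Q, pmWeight P Q * x Q = θ * (2 * k - 6).doubleFactorial * x P) :
    ∃ (ι : Type) (_ : Fintype ι) (_ : Nonempty ι) (Mo : DominoModel k θ ι), ∀ T, ∃ y ∈ U, y ≠ 0 ∧
      ∀ j < k, jm (pmRep (2 * k)) (2 * j) y = (Mo.c T j : ℝ) • y ∧
        jm (pmRep (2 * k)) (2 * j + 1) y = ((Mo.c T j : ℝ) + 1) • y := by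
  obtain ⟨W, hWU, hW, hW0, hmin⟩ := exists_minimal_invariant (pmRep (2 * k)) hU h0
  set σ := subRep (pmRep (2 * k)) hW
  have hσ : ∀ g x y, ⟪σ g x, σ g y⟫_ℝ = ⟪x, y⟫_ℝ := fun g x y => inner_pmRep g (x : _) (y : _)
  let v : W := W.orthogonalProjectionOnto (EuclideanSpace.single (basePM k) 1)
  have hv : ∀ y : W, ⟪v, y⟫_ℝ = (y : EuclideanSpace ℝ (PM (2 * k))) (basePM k) := fun y => by
    rw [Submodule.inner_orthogonalProjectionOnto_eq_of_mem_right]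
    simp [EuclideanSpace.inner_single_left]
  have hinv : ∀ g : Perm (Fin (2 * k)), ∀ y : W, ⟪v, σ g y⟫_ℝ =
      (y : EuclideanSpace ℝ (PM (2 * k))) (g⁻¹ • basePM k) := fun g y => hv _
  have hfix : ∀ g : Perm (Fin (2 * k)), g • basePM k = basePM k → σ g v = v := fun g hg => by
    refine ext_inner_right ℝ fun y => ?_
    have hy : y = σ g (σ g⁻¹ y) := by rw [← Module.End.mul_apply, ← map_mul]; simp
    conv_lhs => rw [hy, hσ, hinv, inv_inv, hg, ← hv]
  have hv0 : v ≠ 0 := fun h => hW0 <| (Submodule.eq_bot_iff _).2 fun x hx => by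
    ext Q
    obtain ⟨g, hg⟩ := exists_smul_eq_basePM Q
    have := hinv g ⟨x, hx⟩
    rw [h, inner_zero_left, ← hg, inv_smul_smul] at this
    exact this.symm
  obtain ⟨ι, _, ⟨D⟩⟩ := exists_jmDecomp hσ v
  have : Nonempty ι := by
    by_contra h
    rw [not_nonempty_iff] at h
    exact hv0 (by rw [← D.sum_u, Finset.univ_eq_empty, Finset.sum_empty])
  have hpair : ∀ a < k, ∀ b < k, pairSwap k a b • basePM k = basePM k := fun a ha b hb =>
    pairSwap_smul_basePM ha hb
  have hvI : IsEdgeInvariant σ {p | p < k} v :=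
    ⟨fun p hp => hfix _ (swap_smul_basePM hp), fun p hp q hq => by
      have h := hfix _ (hpair p hp q hq)
      rwa [pairSwap, map_mul] at h⟩
  have hvQ : ∀ a < k, ∀ b < k, ∀ Q, (v : EuclideanSpace ℝ (PM (2 * k))) (pairSwap k a b • Q) =
      (v : EuclideanSpace ℝ (PM (2 * k))) Q := fun a ha b hb Q => by
    have h := hfix (pairSwap k a b)⁻¹ (by rw [inv_smul_eq_iff, hpair a ha b hb])
    conv_rhs => rw [← h]
    rw [subRep_apply, pmRep_apply, inv_inv]
  obtain ⟨Mo, hMo⟩ := D.exists_dominoModel hσ (subRep_irreducible _ hW hmin) (by lia) rfl hvI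
    (θ := θ) (by
      simp only [hv, jmProd_subRep, transp_subRep, σ]
      rw [← sum_pmWeight_basePM hk _ hvQ, hθ _ (hWU v.2)])
  refine ⟨ι, inferInstance, inferInstance, Mo, fun T => ⟨D.u T, hWU (D.u T).2, ?_, fun j hj => ?_⟩⟩
  · exact fun h => D.ne_zero T (Subtype.ext h)
  · obtain ⟨h1, h2⟩ := hMo T j hj
    rw [← jm_subRep _ hW, ← jm_subRep _ hW, ← h2, ← h1]
    exact ⟨congrArg Subtype.val (D.eigen T (2 * j) (by lia)),
      congrArg Subtype.val (D.eigen T (2 * j + 1) (by lia))⟩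

end Model

section Eigenspaces

open Equiv Finset
open scoped InnerProductSpace

/-- The weighted adjacency matrix, multiplied by `(2k - 6)!!`, as an operator. -/
noncomputable def pmWeightEnd (n : ℕ) : Module.End ℝ (EuclideanSpace ℝ (PM n)) where
  toFun x := WithLp.toLp 2 fun P => ∑ Q, pmWeight P Q * x Q
  map_add' x y := by ext P; simp [mul_add, sum_add_distrib]
  map_smul' c x := by ext P; simp [mul_sum, mul_left_comm]

theorem pmWeightEnd_apply {n : ℕ} (x : EuclideanSpace ℝ (PM n)) (P : PM n) :
    pmWeightEnd n x P = ∑ Q, pmWeight P Q * x Q := rfl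

theorem pmWeightEnd_isSymmetric (n : ℕ) : (pmWeightEnd n).IsSymmetric := fun x y => by
  simp only [PiLp.inner_apply, pmWeightEnd_apply, RCLike.inner_apply, conj_trivial,
    mul_sum, sum_mul]
  rw [sum_comm]
  exact sum_congr rfl fun P _ => sum_congr rfl fun Q _ => by rw [pmWeight_comm]; ring

theorem pmWeightEnd_commute {n : ℕ} (g : Perm (Fin n)) :
    Commute (pmWeightEnd n) (pmRep n g) := by
  ext x P
  exact sum_pmWeight_pmRep g x P

/-- The sum of all transpositions over ordered pairs of points. -/
noncomputable def swapEnd (n : ℕ) : Module.End ℝ (EuclideanSpace ℝ (PM n)) :=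
  ∑ a : Fin n, ∑ b : Fin n, pmRep n (swap a b)

theorem swapEnd_apply {n : ℕ} (x : EuclideanSpace ℝ (PM n)) (Q : PM n) :
    swapEnd n x Q = ∑ a : Fin n, ∑ b : Fin n, x (swap a b • Q) := by
  simp [swapEnd, LinearMap.sum_apply, pmRep_apply]

theorem swapEnd_commute {n : ℕ} (g : Perm (Fin n)) : Commute (swapEnd n) (pmRep n g) := by
  rw [Commute, SemiconjBy, swapEnd, sum_mul, mul_sum, ← Equiv.sum_comp g]
  refine sum_congr rfl fun a _ => ?_
  rw [sum_mul, mul_sum, ← Equiv.sum_comp g]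
  refine sum_congr rfl fun b _ => ?_
  rw [← map_mul, ← map_mul, mul_swap_eq_swap_mul]

theorem pmWeightEnd_commute_swapEnd (n : ℕ) : Commute (pmWeightEnd n) (swapEnd n) :=
  Commute.sum_right _ _ _ fun _ _ => Commute.sum_right _ _ _ fun _ _ => pmWeightEnd_commute _

theorem sum_range_sum_range_of_symm {M : Type*} [AddCommMonoid M] (f : ℕ → ℕ → M)
    (hf : ∀ i j, f i j = f j i) (n : ℕ) :
    ∑ i ∈ range n, ∑ j ∈ range n, f i j =
      2 • ∑ j ∈ range n, ∑ i ∈ range j, f i j + ∑ i ∈ range n, f i i := by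
  induction n with
  | zero => simp
  | succ n ih =>
    simp only [sum_range_succ, sum_add_distrib, ih, hf n, smul_add, two_smul]
    abel

theorem swapEnd_eq {k : ℕ} [NeZero (2 * k)] :
    swapEnd (2 * k) = 2 • ∑ i ∈ range (2 * k), jm (pmRep (2 * k)) i + (2 * k) • 1 := by
  have h := sum_range_sum_range_of_symm (transp (pmRep (2 * k))) (transp_comm _) (2 * k)
  have h1 : ∀ i, transp (pmRep (2 * k)) i i = 1 := fun i => by
    rw [transp, swap_self]; exact map_one _
  simp only [h1, sum_const, card_range] at h
  refine Eq.trans ?_ h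
  rw [swapEnd, ← Fin.sum_univ_eq_sum_range (fun i => ∑ j ∈ range (2 * k), transp _ i j)]
  refine sum_congr rfl fun a _ => ?_
  rw [← Fin.sum_univ_eq_sum_range]
  exact sum_congr rfl fun b _ => by rw [transp, ofNat_val, ofNat_val]

theorem sum_swap_apply {α : Type*} [Fintype α] [DecidableEq α] (F : α → α → ℝ) (h0 : ∀ x, F x x = 0)
    (hs : ∀ x y, F x y = F y x) (h1 : ∀ x, ∑ y, F x y = 1) {u v : α} (huv : u ≠ v) :
    ∑ a, ∑ b, F (swap a b u) (swap a b v) = 4 + (Fintype.card α - 2 : ℝ) ^ 2 * F u v := by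
  have h1' : ∀ y, ∑ x, F x y = 1 := fun y => by simp_rw [hs _ y, h1]
  have key : ∀ a, ∑ b, F (swap a b u) (swap a b v) =
      (Fintype.card α - 2 : ℝ) * F u v + F a v + F u a +
        (if a = u then 1 - (Fintype.card α - 2 : ℝ) * F u v else 0) +
        (if a = v then 1 - (Fintype.card α - 2 : ℝ) * F u v else 0) := fun a => by
    by_cases hau : a = u
    · subst hau
      have : ∀ b, F (swap a b a) (swap a b v) = F b v + if b = v then F a v else 0 := fun b => by
        rw [swap_apply_left]
        by_cases hb : b = v
        · subst hb; simp [h0, hs]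
        · simp [hb, swap_apply_of_ne_of_ne huv.symm (Ne.symm hb)]
      simp only [this, sum_add_distrib, h1', sum_ite_eq', mem_univ, if_true, h0, huv, if_false]
      ring
    · by_cases hav : a = v
      · subst hav
        have : ∀ b, F (swap a b u) (swap a b a) = F u b + if b = u then F u a else 0 := fun b => by
          rw [swap_apply_left]
          by_cases hb : b = u
          · subst hb; simp [h0, hs]
          · simp [hb, swap_apply_of_ne_of_ne huv (Ne.symm hb)]
        simp only [this, sum_add_distrib, h1, sum_ite_eq', mem_univ, if_true, h0, hau, if_false]
        ring
      · have : ∀ b, F (swap a b u) (swap a b v) = F u v + (if b = u then F a v - F u v else 0) +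
            if b = v then F u a - F u v else 0 := fun b => by
          by_cases hb : b = u
          · subst hb; simp [huv, swap_apply_of_ne_of_ne (Ne.symm hav) huv.symm]
          · by_cases hb' : b = v
            · subst hb'; simp [huv.symm, swap_apply_of_ne_of_ne (Ne.symm hau) huv]
            · simp [hb, hb', swap_apply_of_ne_of_ne (Ne.symm hau) (Ne.symm hb),
                swap_apply_of_ne_of_ne (Ne.symm hav) (Ne.symm hb')]
        simp [this, sum_add_distrib, hau, hav]
        ring
  simp [key, sum_add_distrib, h1, h1']
  ring

/-- The indicator of the perfect matchings containing the edge `{u, v}`. -/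
noncomputable def edgeIndicator {n : ℕ} (u v : Fin n) : EuclideanSpace ℝ (PM n) :=
  WithLp.toLp 2 fun Q => if s(u, v) ∈ Q.1 then 1 else 0

theorem swapEnd_edgeIndicator {n : ℕ} {u v : Fin n} (huv : u ≠ v) (Q : PM n) :
    swapEnd n (edgeIndicator u v) Q = 4 + (n - 2 : ℝ) ^ 2 * edgeIndicator u v Q := by
  have h := sum_swap_apply (fun x y => if s(x, y) ∈ Q.1 then (1 : ℝ) else 0)
    (fun x => if_neg fun h => Q.ne_of_mem h rfl) (fun x y => by rw [Sym2.eq_swap])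
    (fun x => by
      obtain ⟨y, hy⟩ := Q.exists_mate x
      rw [sum_eq_single y (fun z _ hz => if_neg fun h => hz (Q.mate_unique h hy)) (by simp),
        if_pos hy])
    huv
  rw [Fintype.card_fin] at h
  rw [swapEnd_apply, edgeIndicator]
  simp only [PM.mk_mem_smul_iff, swap_inv]
  exact h

theorem invariant_of_commute {n : ℕ} {A : Module.End ℝ (EuclideanSpace ℝ (PM n))}
    (hA : ∀ g, Commute A (pmRep n g)) (μ : ℝ) (g : Perm (Fin n)) :
    ∀ x ∈ A.eigenspace μ, pmRep n g x ∈ A.eigenspace μ := fun x hx => by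
  rw [Module.End.mem_eigenspace_iff] at hx ⊢
  rw [← Module.End.mul_apply, (hA g).eq, Module.End.mul_apply, hx, map_smul]

end Eigenspaces

section Spectrum

variable {k : ℕ} [NeZero (2 * k)]

theorem neg_one_le_of_pmWeightEnd (hk : 10 ≤ k) {θ : ℝ} {x : EuclideanSpace ℝ (PM (2 * k))}
    (hx0 : x ≠ 0) (hx : pmWeightEnd (2 * k) x = (θ * (2 * k - 6).doubleFactorial) • x) :
    -1 ≤ θ := by
  obtain ⟨ι, _, _, Mo, -⟩ := exists_dominoModel_of_invariant (by lia)
    (invariant_of_commute pmWeightEnd_commute (θ * (2 * k - 6).doubleFactorial))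
    (Submodule.ne_bot_iff _ |>.2 ⟨x, Module.End.mem_eigenspace_iff.2 hx, hx0⟩) fun y hy P => by
      rw [← pmWeightEnd_apply, Module.End.mem_eigenspace_iff.1 hy]; rfl
  exact Mo.neg_one_le hk

theorem eq_neg_one_of_swapEnd (hk : 10 ≤ k) {θ : ℝ} {x : EuclideanSpace ℝ (PM (2 * k))}
    (hx0 : x ≠ 0) (hx : pmWeightEnd (2 * k) x = (θ * (2 * k - 6).doubleFactorial) • x)
    (hxs : swapEnd (2 * k) x = (2 * k - 2 : ℝ) ^ 2 • x) : θ = -1 := by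
  obtain ⟨ι, _, _, Mo, hMo⟩ := exists_dominoModel_of_invariant (θ := θ) (by lia)
    (U := (pmWeightEnd (2 * k)).eigenspace (θ * (2 * k - 6).doubleFactorial) ⊓
      (swapEnd (2 * k)).eigenspace ((2 * k - 2 : ℝ) ^ 2))
    (fun g x hx => ⟨invariant_of_commute pmWeightEnd_commute _ g x hx.1,
      invariant_of_commute swapEnd_commute _ g x hx.2⟩)
    (Submodule.ne_bot_iff _ |>.2 ⟨x, ⟨Module.End.mem_eigenspace_iff.2 hx,
      Module.End.mem_eigenspace_iff.2 hxs⟩, hx0⟩) fun y hy P => by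
      rw [← pmWeightEnd_apply, Module.End.mem_eigenspace_iff.1 hy.1]; rfl
  let T := Classical.arbitrary ι
  obtain ⟨y, hy, hy0, hc⟩ := hMo T
  refine Mo.eigenvalue_of_row_zero_add_one hk
    ((Mo.fills T).row_zero_add_one_of_sum_content ?_ (by lia))
  have h := Module.End.mem_eigenspace_iff.1 hy.2
  rw [swapEnd_eq, LinearMap.add_apply, LinearMap.smul_apply, LinearMap.sum_apply,
    sum_range_two_mul, Finset.sum_congr rfl fun j hj => show _ = (2 * (Mo.c T j : ℝ) + 1) • y by
      rw [(hc j (Finset.mem_range.1 hj)).1, (hc j (Finset.mem_range.1 hj)).2]; module,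
    ← Finset.sum_smul, LinearMap.smul_apply, Module.End.one_apply, ← Nat.cast_smul_eq_nsmul ℝ,
    ← Nat.cast_smul_eq_nsmul ℝ, smul_smul, ← add_smul] at h
  have h2 := smul_left_injective ℝ hy0 h
  rw [Finset.sum_add_distrib, ← Finset.mul_sum] at h2
  simp only [Finset.sum_const, Finset.card_range, nsmul_eq_mul] at h2
  push_cast at h2
  have h3 : ∑ j ∈ Finset.range k, (Mo.c T j : ℝ) = (k : ℝ) ^ 2 - 3 * k + 1 := by linarith
  exact_mod_cast h3

theorem exists_pmWeightEnd_eq_neg (hk : 10 ≤ k) : ∃ x : EuclideanSpace ℝ (PM (2 * k)), x ≠ 0 ∧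
    pmWeightEnd (2 * k) x = (-1 * (2 * k - 6).doubleFactorial : ℝ) • x := by
  set W := (swapEnd (2 * k)).eigenspace ((2 * k - 2 : ℝ) ^ 2)
  have hW : ∀ x ∈ W, pmWeightEnd (2 * k) x ∈ W := fun x hx => by
    rw [Module.End.mem_eigenspace_iff] at hx ⊢
    rw [← Module.End.mul_apply, ← (pmWeightEnd_commute_swapEnd _).eq, Module.End.mul_apply, hx,
      map_smul]
  have hne : ∀ {a b : ℕ}, a < 2 * k → b < 2 * k → a ≠ b →
      Fin.ofNat (2 * k) a ≠ Fin.ofNat (2 * k) b := fun ha hb h h' =>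
    h ((ofNat_inj_of_lt ha hb).1 h')
  have : Nontrivial W := by
    refine Submodule.nontrivial_iff_ne_bot.2 <| (Submodule.ne_bot_iff _).2
      ⟨edgeIndicator (Fin.ofNat (2 * k) 0) (Fin.ofNat (2 * k) 1) -
        edgeIndicator (Fin.ofNat (2 * k) 0) (Fin.ofNat (2 * k) 2), ?_, fun h => ?_⟩
    · refine Module.End.mem_eigenspace_iff.2 ?_
      ext Q
      rw [map_sub]
      simp only [PiLp.sub_apply, PiLp.smul_apply, smul_eq_mul]
      rw [swapEnd_edgeIndicator (hne (by lia) (by lia) (by lia)),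
        swapEnd_edgeIndicator (hne (by lia) (by lia) (by lia))]
      push_cast
      ring
    · have h1 := congrArg (fun x : EuclideanSpace ℝ (PM (2 * k)) => x (basePM k)) h
      have e1 : s(Fin.ofNat (2 * k) 0, Fin.ofNat (2 * k) 1) ∈ (basePM k).1 :=
        (basePM_joins (by lia) (by lia)).2 (by lia)
      have e2 : s(Fin.ofNat (2 * k) 0, Fin.ofNat (2 * k) 2) ∉ (basePM k).1 := fun h => by
        have := (basePM_joins (by lia) (by lia)).1 h
        lia
      simp only [PiLp.sub_apply, edgeIndicator, PiLp.zero_apply] at h1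
      rw [if_pos e1, if_neg e2] at h1
      norm_num at h1
  obtain ⟨μ, hμ⟩ : ∃ μ : ℝ, Module.End.HasEigenvalue ((pmWeightEnd (2 * k)).restrict hW) μ :=
    ⟨_, ((pmWeightEnd_isSymmetric _).restrict_invariant hW).hasEigenvalue_iSup_of_finiteDimensional⟩
  obtain ⟨x, hx⟩ := hμ.exists_hasEigenvector
  have hx0 : (x : EuclideanSpace ℝ (PM (2 * k))) ≠ 0 := fun h => hx.2 (Subtype.ext h)
  have hxμ : pmWeightEnd (2 * k) x = μ • (x : EuclideanSpace ℝ (PM (2 * k))) :=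
    congrArg Subtype.val hx.apply_eq_smul
  have hd : ((2 * k - 6).doubleFactorial : ℝ) ≠ 0 := by
    exact_mod_cast (Nat.doubleFactorial_pos _).ne'
  rw [← div_mul_cancel₀ μ hd] at hxμ
  refine ⟨x, hx0, ?_⟩
  rw [hxμ, eq_neg_one_of_swapEnd hk hx0 hxμ (Module.End.mem_eigenspace_iff.1 x.2)]

theorem sum_pmWeight (hk : 5 ≤ k) (P : PM (2 * k)) : ∑ Q, pmWeight P Q =
    ((2 * k - 1 : ℝ) * (2 * k - 3) - 1) * (2 * k - 6).doubleFactorial := by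
  obtain ⟨g, hg⟩ := exists_smul_eq_basePM P
  have hP : ∑ Q, pmWeight P Q = ∑ Q, pmWeight (basePM k) Q := by
    rw [← hg, ← Equiv.sum_comp (MulAction.toPerm g) (pmWeight (g • P))]
    exact Finset.sum_congr rfl fun Q _ => (pmWeight_smul g P Q).symm
  set x : EuclideanSpace ℝ (PM (2 * k)) := WithLp.toLp 2 fun _ => 1
  have hx : ∀ i j, transp (pmRep (2 * k)) i j x = x := fun i j => rfl
  have hjm : ∀ m, jm (pmRep (2 * k)) m x = (m : ℝ) • x := fun m => by
    simp [jm, LinearMap.sum_apply, hx, Nat.cast_smul_eq_nsmul]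
  have hprod : ∀ n, jmProd (pmRep (2 * k)) n x = ((2 * n).doubleFactorial : ℝ) • x := fun n => by
    induction n with
    | zero => simp [jmProd]
    | succ n ih =>
      rw [jmProd, Module.End.mul_apply, ih, map_smul, hjm, smul_smul, mul_add_one,
        Nat.doubleFactorial_add_two]
      push_cast
      ring_nf
  have h := sum_pmWeight_basePM hk x fun _ _ _ _ _ => rfl
  simp only [hprod, map_smul, hx, PiLp.smul_apply, x, mul_one, smul_eq_mul] at h
  rw [hP, h]
  obtain ⟨n, rfl⟩ := Nat.exists_eq_add_of_le' (show 3 ≤ k by lia)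
  rw [show 2 * (n + 3 - 1) = 2 * n + 2 + 2 by lia, show 2 * (n + 3 - 2) = 2 * n + 2 by lia,
    show 2 * (n + 3 - 3) = 2 * n by lia, show 2 * (n + 3) - 6 = 2 * n by lia,
    Nat.doubleFactorial_add_two, Nat.doubleFactorial_add_two]
  push_cast
  ring

end Spectrum

section Main

theorem pmWeight_eq_mul {n : ℕ} [NeZero n] {M : Matrix (PM n) (PM n) ℝ} {d : ℝ} (hd : d ≠ 0)
    (h1 : ∀ P Q : PM n, P.1 ∩ Q.1 = ∅ → (unionGraph P Q).Connected → M P Q = 1 / (4 * d))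
    (h2 : ∀ P Q : PM n, (P.1 ∩ Q.1).card = 1 →
      Nat.card (unionGraph P Q).ConnectedComponent = 2 → M P Q = 1 / d)
    (h3 : ∀ P Q : PM n, P.1 ∩ Q.1 = ∅ → Nat.card (unionGraph P Q).ConnectedComponent = 2 →
      (∃ c : (unionGraph P Q).ConnectedComponent, c.supp.ncard = 4) → M P Q = 1 / d)
    (h0 : ∀ P Q : PM n, ¬ (P.1 ∩ Q.1 = ∅ ∧ (unionGraph P Q).Connected) →
      ¬ ((P.1 ∩ Q.1).card = 1 ∧ Nat.card (unionGraph P Q).ConnectedComponent = 2) →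
      ¬ (P.1 ∩ Q.1 = ∅ ∧ Nat.card (unionGraph P Q).ConnectedComponent = 2 ∧
          ∃ c : (unionGraph P Q).ConnectedComponent, c.supp.ncard = 4) → M P Q = 0)
    (P Q : PM n) : pmWeight P Q = M P Q * d := by
  have hn : numComp P Q = 2 → ¬ (unionGraph P Q).Connected := fun h h' => by
    rw [← numComp_eq_one_iff] at h'
    lia
  rw [pmWeight]
  by_cases c1 : P.1 ∩ Q.1 = ∅ ∧ (unionGraph P Q).Connected
  · rw [if_pos c1, if_neg fun h => hn h.2 c1.2, if_neg fun h => hn h.2.1 c1.2, h1 P Q c1.1 c1.2]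
    field_simp
    norm_num
  · rw [if_neg c1]
    by_cases c2 : (P.1 ∩ Q.1).card = 1 ∧ numComp P Q = 2
    · rw [if_pos c2, if_neg fun h => by simp [h.1] at c2, h2 P Q c2.1 c2.2]
      field_simp
      norm_num
    · rw [if_neg c2]
      by_cases c3 : P.1 ∩ Q.1 = ∅ ∧ numComp P Q = 2 ∧
          ∃ c : (unionGraph P Q).ConnectedComponent, c.supp.ncard = 4
      · rw [if_pos c3, h3 P Q c3.1 c3.2.1 c3.2.2]
        field_simp
        norm_num
      · rw [if_neg c3, h0 P Q c1 c2 c3]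
        norm_num

end Main

/-- For `k ≥ 10`, the weighted adjacency matrix `M` of `M₂(2k)` whose `(P,Q)` entry is
`1/(4·(2k-6)!!)` when `P ∪ Q` is a single `2k`-cycle, `1/(2k-6)!!` when `P` and `Q` share
exactly one edge and `P ∪ Q` has exactly two components, `1/(2k-6)!!` when `P` and `Q` share
no edge and `P ∪ Q` has exactly two components one of which has exactly `4` vertices, and `0`
otherwise, has all row sums equal to `(2k-1)(2k-3) - 1` and least eigenvalue `-1`. -/
theorem weighted_adjacency_large_k (k : ℕ) (hk : 10 ≤ k)
    (M : Matrix (PM (2 * k)) (PM (2 * k)) ℝ)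
    (h1 : ∀ P Q : PM (2 * k), P.1 ∩ Q.1 = ∅ → (unionGraph P Q).Connected →
      M P Q = 1 / (4 * (Nat.doubleFactorial (2 * k - 6) : ℝ)))
    (h2 : ∀ P Q : PM (2 * k), (P.1 ∩ Q.1).card = 1 →
      Nat.card (unionGraph P Q).ConnectedComponent = 2 →
      M P Q = 1 / (Nat.doubleFactorial (2 * k - 6) : ℝ))
    (h3 : ∀ P Q : PM (2 * k), P.1 ∩ Q.1 = ∅ →
      Nat.card (unionGraph P Q).ConnectedComponent = 2 →
      (∃ c : (unionGraph P Q).ConnectedComponent, c.supp.ncard = 4) →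
      M P Q = 1 / (Nat.doubleFactorial (2 * k - 6) : ℝ))
    (h0 : ∀ P Q : PM (2 * k),
      ¬ (P.1 ∩ Q.1 = ∅ ∧ (unionGraph P Q).Connected) →
      ¬ ((P.1 ∩ Q.1).card = 1 ∧ Nat.card (unionGraph P Q).ConnectedComponent = 2) →
      ¬ (P.1 ∩ Q.1 = ∅ ∧ Nat.card (unionGraph P Q).ConnectedComponent = 2 ∧
          ∃ c : (unionGraph P Q).ConnectedComponent, c.supp.ncard = 4) →
      M P Q = 0) :
    (∀ P : PM (2 * k), ∑ Q : PM (2 * k), M P Q = (2 * k - 1 : ℝ) * (2 * k - 3 : ℝ) - 1) ∧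
    (∃ x : PM (2 * k) → ℝ, x ≠ 0 ∧ M.mulVec x = (-1 : ℝ) • x) ∧
    (∀ (μ : ℝ) (x : PM (2 * k) → ℝ), x ≠ 0 → M.mulVec x = μ • x → -1 ≤ μ) := by
  have : NeZero (2 * k) := ⟨by lia⟩
  have hd : ((2 * k - 6).doubleFactorial : ℝ) ≠ 0 := by
    exact_mod_cast (Nat.doubleFactorial_pos _).ne'
  have hM := pmWeight_eq_mul hd h1 h2 h3 h0
  have happ : ∀ x P, pmWeightEnd (2 * k) (WithLp.toLp 2 x) P =
      M.mulVec x P * (2 * k - 6).doubleFactorial := fun x P => by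
    rw [pmWeightEnd_apply, Matrix.mulVec, dotProduct, Finset.sum_mul]
    exact Finset.sum_congr rfl fun Q _ => by rw [hM]; ring
  refine ⟨fun P => ?_, ?_, fun μ x hx0 hx => ?_⟩
  · have h := sum_pmWeight (show 5 ≤ k by lia) P
    simp_rw [hM, ← Finset.sum_mul] at h
    exact mul_right_cancel₀ hd h
  · obtain ⟨x, hx0, hx⟩ := exists_pmWeightEnd_eq_neg hk
    refine ⟨x, fun h => hx0 (WithLp.ofLp_injective 2 h), funext fun P => mul_right_cancel₀ hd ?_⟩
    rw [← happ, WithLp.toLp_ofLp, hx]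
    simp only [PiLp.smul_apply, Pi.smul_apply, smul_eq_mul]
    ring
  · refine neg_one_le_of_pmWeightEnd hk (x := WithLp.toLp 2 x)
      (fun h => hx0 (WithLp.toLp_injective 2 h)) ?_
    ext P
    rw [happ, hx]
    simp only [PiLp.smul_apply, Pi.smul_apply, smul_eq_mul]
    ring
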